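/- (Juhnke-Kubitzke–Murai) Let Δ be the boundary complex of a balanced simplicial d-polytope, with coloring c : Δ^(0) → [d], and let S be any subset of [d]. Then there exist a projection of the restricted complex Δ_S to an |S|-dimensional linear subspace realizing it as a proper geometric simplicial complex Δ̃_S in ℝ^{|S|} and a linear differential ω such that for every k ≤ (|S|+1)/2 the map ω : S_k(Δ̃_S) → S_{k−1}(Δ̃_S) is surjective. -/

import Mathlib

open MvPolynomial

open MvPolynomial

/-- An abstract simplicial complex on the vertex set `Fin n`:
a collection of finite subsets closed under taking subsets. -/
def IsComplex {n : ℕ} (Δ : Set (Finset (Fin n))) : Prop :=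
  ∀ σ ∈ Δ, ∀ τ ⊆ σ, τ ∈ Δ

/-- The vertex set `Δ^(0)` of a simplicial complex. -/
def verts {n : ℕ} (Δ : Set (Finset (Fin n))) : Set (Fin n) := {v | {v} ∈ Δ}

/-- The partial derivative `∂/∂xᵢ` as a linear endomorphism of `ℝ[x₁,…,xₙ]`. -/
noncomputable def pd {n : ℕ} (i : Fin n) : Module.End ℝ (MvPolynomial (Fin n) ℝ) :=
  (pderiv i).toLinearMap

/-- The constant coefficient differential operator `(x^a)^∨ = ∏ᵢ (∂/∂xᵢ)^(aᵢ)`. -/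
noncomputable def monDiff {n : ℕ} (a : Fin n →₀ ℕ) : Module.End ℝ (MvPolynomial (Fin n) ℝ) :=
  ((List.finRange n).map fun i => pd i ^ a i).prod

/-- The stress space `S̃(Δ)`: polynomials annihilated by `q^∨` for every `q` in the
nonface ideal `I_Δ` (equivalently, by `(x^a)^∨` for every monomial generator `x^a` of `I_Δ`). -/
noncomputable def tStress {n : ℕ} (Δ : Set (Finset (Fin n))) :
    Submodule ℝ (MvPolynomial (Fin n) ℝ) :=
  ⨅ a ∈ {a : Fin n →₀ ℕ | a.support ∉ Δ}, LinearMap.ker (monDiff a)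

/-- A linear differential `Σᵢ cᵢ ∂/∂xᵢ`. -/
noncomputable def linDiff {n : ℕ} (c : Fin n → ℝ) : Module.End ℝ (MvPolynomial (Fin n) ℝ) :=
  ∑ i, c i • pd i

/-- The canonical differential `δ = Σᵢ ∂/∂xᵢ`. -/
noncomputable def canDiff (n : ℕ) : Module.End ℝ (MvPolynomial (Fin n) ℝ) :=
  linDiff fun _ => (1 : ℝ)

/-- The coordinate differential `θⱼ = Σᵢ (vᵢ)ⱼ ∂/∂xᵢ` of a geometric simplicial complex. -/
noncomputable def coordDiff {n d : ℕ} (V : Fin n → Fin d → ℝ) (j : Fin d) :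
    Module.End ℝ (MvPolynomial (Fin n) ℝ) :=
  linDiff fun i => V i j

/-- The stress space `S(Δ)` of a geometric simplicial complex with vertex coordinates `V`. -/
noncomputable def stress {n d : ℕ} (V : Fin n → Fin d → ℝ) (Δ : Set (Finset (Fin n))) :
    Submodule ℝ (MvPolynomial (Fin n) ℝ) :=
  tStress Δ ⊓ ⨅ j : Fin d, LinearMap.ker (coordDiff V j)

/-- The degree-`k` graded piece `S_k(Δ)` of the stress space. -/
noncomputable def stressK {n d : ℕ} (V : Fin n → Fin d → ℝ) (Δ : Set (Finset (Fin n)))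
    (k : ℕ) : Submodule ℝ (MvPolynomial (Fin n) ℝ) :=
  stress V Δ ⊓ homogeneousSubmodule (Fin n) ℝ k

/-- A geometric simplicial complex in `ℝ^d` is proper if the coordinates of each face of
dimension `< d` are linearly independent. -/
def IsProper {n d : ℕ} (V : Fin n → Fin d → ℝ) (Δ : Set (Finset (Fin n))) : Prop :=
  ∀ σ ∈ Δ, σ.card ≤ d → LinearIndependent ℝ (fun i : {x // x ∈ σ} => V i.1)

/-- The star of a face. -/
def cStar {n : ℕ} (Δ : Set (Finset (Fin n))) (σ : Finset (Fin n)) : Set (Finset (Fin n)) :=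
  {τ ∈ Δ | σ ∪ τ ∈ Δ}

/-- The star of a vertex. -/
def vStar {n : ℕ} (Δ : Set (Finset (Fin n))) (v : Fin n) : Set (Finset (Fin n)) :=
  cStar Δ {v}

/-- The boundary `∂St_v Δ` of the star of a vertex: faces of the star not containing `v`. -/
def vStarBd {n : ℕ} (Δ : Set (Finset (Fin n))) (v : Fin n) : Set (Finset (Fin n)) :=
  {τ ∈ vStar Δ v | v ∉ τ}

/-- The link of a face. -/
def lk {n : ℕ} (Δ : Set (Finset (Fin n))) (σ : Finset (Fin n)) : Set (Finset (Fin n)) :=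
  {τ | Disjoint σ τ ∧ σ ∪ τ ∈ Δ}

/-- The vertex set `γ^(0)` of the support of a stress `γ`. -/
noncomputable def stressVerts {n : ℕ} (γ : MvPolynomial (Fin n) ℝ) : Finset (Fin n) :=
  γ.support.biUnion fun a => a.support

/-- `g_k = dim S_k − dim S_{k−1}` (with `S_{−1} = 0`). -/
noncomputable def gnum {n d : ℕ} (V : Fin n → Fin d → ℝ) (Δ : Set (Finset (Fin n)))
    (k : ℕ) : ℤ :=
  (Module.finrank ℝ ↥(stressK V Δ k) : ℤ) -
    if k = 0 then 0 else (Module.finrank ℝ ↥(stressK V Δ (k - 1)) : ℤ)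

/-- The homogenizing embedding `ℝ^d → ℝ^d × {1} ⊆ ℝ^{d+1}` applied to vertex coordinates. -/
noncomputable def homV {n d : ℕ} (p : Fin n → Fin d → ℝ) : Fin n → Fin (d + 1) → ℝ :=
  fun i => Fin.snoc (p i) 1

/-- `Δ` is the boundary complex of the simplicial `d`-polytope `conv{p 1, …, p n}`:
the polytope is full-dimensional, every `p i` is a vertex, the faces of `Δ` are exactly the
vertex sets cut out by supporting hyperplanes, and every proper face is a simplex. -/
def IsSimplicialPolytopeBoundary {n d : ℕ} (p : Fin n → Fin d → ℝ)
    (Δ : Set (Finset (Fin n))) : Prop :=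
  affineSpan ℝ (Set.range p) = ⊤ ∧
  (∀ i, p i ∉ convexHull ℝ (p '' {j | j ≠ i})) ∧
  (∀ σ ∈ Δ, AffineIndependent ℝ (fun i : {x // x ∈ σ} => p i.1)) ∧
  (∀ σ : Finset (Fin n), σ ∈ Δ ↔
    ∃ (f : (Fin d → ℝ) →ₗ[ℝ] ℝ) (c : ℝ),
      (∃ i, f (p i) < c) ∧ (∀ i, f (p i) ≤ c) ∧ (∀ i, f (p i) = c ↔ i ∈ σ))

/-- The simplicial boundary operator (with real coefficients), on the free module spanned by
all finite subsets of `Fin n`; the empty set plays the role of the `(−1)`-face, so that the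
associated homology is reduced. -/
noncomputable def bdry {n : ℕ} : (Finset (Fin n) →₀ ℝ) →ₗ[ℝ] (Finset (Fin n) →₀ ℝ) :=
  Finsupp.lsum ℝ fun σ => LinearMap.toSpanSingleton ℝ _
    (∑ i ∈ σ, ((-1 : ℝ) ^ (σ.filter (· < i)).card) • Finsupp.single (σ.erase i) (1 : ℝ))

/-- The space of simplicial `k`-chains of `Δ` (spanned by faces of `Δ` of dimension `k`). -/
noncomputable def chains {n : ℕ} (Δ : Set (Finset (Fin n))) (k : ℤ) :
    Submodule ℝ (Finset (Fin n) →₀ ℝ) :=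
  Finsupp.supported ℝ ℝ {σ | σ ∈ Δ ∧ (σ.card : ℤ) = k + 1}

/-- Reduced simplicial `k`-cycles of `Δ`. -/
noncomputable def cycles {n : ℕ} (Δ : Set (Finset (Fin n))) (k : ℤ) :
    Submodule ℝ (Finset (Fin n) →₀ ℝ) :=
  chains Δ k ⊓ LinearMap.ker bdry

/-- Simplicial `k`-boundaries of `Δ`. -/
noncomputable def bdries {n : ℕ} (Δ : Set (Finset (Fin n))) (k : ℤ) :
    Submodule ℝ (Finset (Fin n) →₀ ℝ) :=
  Submodule.map bdry (chains Δ (k + 1))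

/-- The reduced Betti number `β̃_k(Δ)` (with real coefficients). -/
noncomputable def rBetti {n : ℕ} (Δ : Set (Finset (Fin n))) (k : ℤ) : ℕ :=
  Module.finrank ℝ ↥(cycles Δ k) - Module.finrank ℝ ↥(bdries Δ k)

/-- The induced subcomplex `Δ_W` on a vertex set `W`. -/
def induced {n : ℕ} (Δ : Set (Finset (Fin n))) (W : Finset (Fin n)) : Set (Finset (Fin n)) :=
  {σ ∈ Δ | σ ⊆ W}

/-- The vertex set of the support of a simplicial chain. -/
def chainVerts {n : ℕ} (c : Finset (Fin n) →₀ ℝ) : Finset (Fin n) :=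
  c.support.biUnion id

/-- `Δ` is resolution `k`-chordal: every `k`-cycle `z` admits a resolution, i.e. a
`(k+1)`-chain `c` with `∂c = z` and `c^(0) = z^(0)`. -/
def ResolutionChordal {n : ℕ} (Δ : Set (Finset (Fin n))) (k : ℤ) : Prop :=
  ∀ z ∈ cycles Δ k, ∃ c ∈ chains Δ (k + 1), bdry c = z ∧ chainVerts c = chainVerts z

/-- `(Δ, ω)` is toric `k`-chordal: `ω : S_{k+1}(Δ) → S_k(Δ)` is surjective and
`ω : S_k(Δ) → S_{k−1}(Δ)` is injective. -/
def ToricChordal {n d : ℕ} (V : Fin n → Fin d → ℝ) (Δ : Set (Finset (Fin n)))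
    (ω : Module.End ℝ (MvPolynomial (Fin n) ℝ)) (k : ℕ) : Prop :=
  (∀ γ ∈ stressK V Δ k, ∃ γ' ∈ stressK V Δ (k + 1), ω γ' = γ) ∧
  (∀ γ ∈ stressK V Δ k, ω γ = 0 → γ = 0)

/-- `(Δ, ω)` is weakly toric `k`-chordal: `ω : S_k(St_v Δ) → S_{k−1}(St_v Δ)` is injective
for every vertex `v` of `Δ`. -/
def WeaklyToricChordal {n d : ℕ} (V : Fin n → Fin d → ℝ) (Δ : Set (Finset (Fin n)))
    (ω : Module.End ℝ (MvPolynomial (Fin n) ℝ)) (k : ℕ) : Prop :=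
  ∀ v ∈ verts Δ, ∀ γ ∈ stressK V (vStar Δ v) k, ω γ = 0 → γ = 0

/-- A missing face of `Δ`: a nonface all of whose proper subsets are faces. -/
def IsMissingFace {n : ℕ} (Δ : Set (Finset (Fin n))) (σ : Finset (Fin n)) : Prop :=
  σ ∉ Δ ∧ ∀ τ ⊂ σ, τ ∈ Δ

/-- Representatives of relative `k`-stresses of the relative complex `(Δ', Γ)`:
homogeneous degree-`k` elements of `S̃(Δ')` whose image under each coordinate differential
lies in `S̃(Γ)`.  The relative stress space `S_k(Δ', Γ)` is the quotient of this space by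
(the degree-`k` part of) `S̃(Γ)`. -/
noncomputable def relStressK {n d : ℕ} (V : Fin n → Fin d → ℝ)
    (Δ' Γ : Set (Finset (Fin n))) (k : ℕ) : Submodule ℝ (MvPolynomial (Fin n) ℝ) :=
  tStress Δ' ⊓ homogeneousSubmodule (Fin n) ℝ k ⊓
    ⨅ j : Fin d, (tStress Γ).comap (coordDiff V j)

/-- A shelling of a pure `(d−1)`-dimensional simplicial complex: a linear order on the facets
such that the intersection of each facet with the union of all subsequent facets is a pure
`(d−2)`-dimensional complex or empty. -/
def IsShelling {n : ℕ} (Δ : Set (Finset (Fin n))) (d : ℕ) (L : List (Finset (Fin n))) : Prop :=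
  L.Nodup ∧ (∀ σ, σ ∈ L ↔ σ ∈ Δ ∧ σ.card = d) ∧
  (∀ σ ∈ Δ, ∃ F ∈ L, σ ⊆ F) ∧
  ∀ (i : ℕ) (hi : i < L.length) (τ : Finset (Fin n)), τ ⊆ L.get ⟨i, hi⟩ →
    (∃ (j : ℕ) (hj : j < L.length), i < j ∧ τ ⊆ L.get ⟨j, hj⟩) →
    ∃ ρ, τ ⊆ ρ ∧ ρ ⊆ L.get ⟨i, hi⟩ ∧ ρ.card = d - 1 ∧
      ∃ (j : ℕ) (hj : j < L.length), i < j ∧ ρ ⊆ L.get ⟨j, hj⟩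

/-- The degree-`k` graded piece of the stress space `S̃(Δ)`. -/
noncomputable def tStressK {n : ℕ} (Δ : Set (Finset (Fin n))) (k : ℕ) :
    Submodule ℝ (MvPolynomial (Fin n) ℝ) :=
  tStress Δ ⊓ homogeneousSubmodule (Fin n) ℝ k

/-- A sequence `θ` of linear differentials is regular up to degree `k` on `S̃(Δ)`: each
`θ_j` maps the degree-`(i+1)` part of the common kernel of `θ_1, …, θ_{j−1}` in `S̃(Δ)` onto
the degree-`i` part, for every `i ≤ k`. -/
def RegularUpTo {n : ℕ} (Δ : Set (Finset (Fin n)))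
    (θ : List (Module.End ℝ (MvPolynomial (Fin n) ℝ))) (k : ℕ) : Prop :=
  ∀ j < θ.length, ∀ i ≤ k,
    ∀ γ ∈ tStressK Δ i ⊓ ⨅ l ∈ Finset.range j, LinearMap.ker (θ.getD l 0),
      ∃ γ' ∈ tStressK Δ (i + 1) ⊓ ⨅ l ∈ Finset.range j, LinearMap.ker (θ.getD l 0),
        θ.getD j 0 γ' = γ

/-- `dim Δ + 1`: the maximal cardinality of a face. -/
noncomputable def dim1 {n : ℕ} (Δ : Set (Finset (Fin n))) : ℕ :=
  sSup {m | ∃ σ ∈ Δ, σ.card = m}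

/-- `Δ` is Cohen–Macaulay over `ℝ`: the reduced homology of every face link vanishes below
the expected dimension. -/
def IsCM {n : ℕ} (Δ : Set (Finset (Fin n))) : Prop :=
  ∀ σ ∈ Δ, ∀ i : ℤ, i < (dim1 Δ : ℤ) - 1 - σ.card →
    cycles (lk Δ σ) i ≤ bdries (lk Δ σ) i

/-- `(q, T)` is a triangulation of the simplicial polytope `P = conv{p i}` whose faces contained
in the boundary `∂P` form exactly the boundary complex `Δ` of `P`. -/
def IsTriangulation {n d m : ℕ} (p : Fin n → Fin d → ℝ) (Δ : Set (Finset (Fin n)))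
    (q : Fin m → Fin d → ℝ) (T : Set (Finset (Fin m))) : Prop :=
  IsComplex T ∧
  (∀ σ ∈ T, AffineIndependent ℝ (fun i : {x // x ∈ σ} => q i.1)) ∧
  (∀ σ ∈ T, ∀ τ ∈ T,
    convexHull ℝ (q '' ↑σ) ∩ convexHull ℝ (q '' ↑τ) = convexHull ℝ (q '' ↑(σ ∩ τ))) ∧
  (⋃ σ ∈ T, convexHull ℝ (q '' ↑σ)) = convexHull ℝ (Set.range p) ∧
  {s : Set (Fin d → ℝ) | ∃ σ ∈ T,
      convexHull ℝ (q '' ↑σ) ⊆ frontier (convexHull ℝ (Set.range p)) ∧ s = q '' ↑σ}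
    = {s : Set (Fin d → ℝ) | ∃ σ ∈ Δ, s = p '' ↑σ}

/-- The restriction `Δ_S` of a balanced complex to the set `S` of colors. -/
def colorRestrict {n d : ℕ} (Δ : Set (Finset (Fin n))) (col : Fin n → Fin d)
    (S : Finset (Fin d)) : Set (Finset (Fin n)) :=
  {σ ∈ Δ | ∀ v ∈ σ, col v ∈ S}

namespace JKM
open Module

section LinAlg
variable {M : Type*} [AddCommGroup M] [Module ℝ M]

/-- negative definite on a subspace -/
def NegOn (B : LinearMap.BilinForm ℝ M) (N : Submodule ℝ M) : Prop :=
  ∀ x ∈ N, x ≠ 0 → B x x < 0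

/-- the negative index of a form on a subspace -/
noncomputable def negIdx (B : LinearMap.BilinForm ℝ M) (U : Submodule ℝ M) : ℕ :=
  sSup {k | ∃ N : Submodule ℝ M, N ≤ U ∧ NegOn B N ∧ finrank ℝ N = k}

lemma negIdx_bdd (B : LinearMap.BilinForm ℝ M) (U : Submodule ℝ M) [FiniteDimensional ℝ U] :
    BddAbove {k | ∃ N : Submodule ℝ M, N ≤ U ∧ NegOn B N ∧ finrank ℝ N = k} := by
  refine ⟨finrank ℝ U, ?_⟩
  rintro k ⟨N, hN, -, rfl⟩
  exact Submodule.finrank_mono hN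

lemma le_negIdx (B : LinearMap.BilinForm ℝ M) (U : Submodule ℝ M) [FiniteDimensional ℝ U]
    (N : Submodule ℝ M) (hN : N ≤ U) (h : NegOn B N) : finrank ℝ N ≤ negIdx B U :=
  le_csSup (negIdx_bdd B U) ⟨N, hN, h, rfl⟩

lemma negIdx_attained (B : LinearMap.BilinForm ℝ M) (U : Submodule ℝ M) [FiniteDimensional ℝ U] :
    ∃ N : Submodule ℝ M, N ≤ U ∧ NegOn B N ∧ finrank ℝ N = negIdx B U := by
  apply Nat.sSup_mem _ (negIdx_bdd B U)
  exact ⟨0, ⊥, bot_le, by intro x hx h; exact absurd ((Submodule.mem_bot ℝ).1 hx) h, by simp⟩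

lemma negIdx_eq (B : LinearMap.BilinForm ℝ M) (U N P : Submodule ℝ M) [FiniteDimensional ℝ U]
    (hN : N ≤ U) (hP : P ≤ U) (hU : U ≤ N ⊔ P) (hn : NegOn B N) (hp : ∀ x ∈ P, 0 ≤ B x x) :
    negIdx B U = finrank ℝ N := by
  apply le_antisymm _ (le_negIdx B U N hN hn)
  obtain ⟨N', h1, h2, h3⟩ := negIdx_attained B U
  rw [← h3]
  have e : U = N ⊔ P := le_antisymm hU (sup_le hN hP)
  have : FiniteDimensional ℝ N := Submodule.finiteDimensional_of_le hN
  have : FiniteDimensional ℝ P := Submodule.finiteDimensional_of_le hP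
  have : FiniteDimensional ℝ N' := Submodule.finiteDimensional_of_le h1
  have d0 : N' ⊓ P = ⊥ := by
    rw [eq_bot_iff]
    intro x hx
    by_contra hne
    exact absurd (h2 x hx.1 (by simpa using hne)) (not_lt.2 (hp x hx.2))
  have a1 := Submodule.finrank_sup_add_finrank_inf_eq N' P
  have a2 := Submodule.finrank_sup_add_finrank_inf_eq N P
  have a3 : finrank ℝ ↥(N' ⊔ P) ≤ finrank ℝ ↥U := Submodule.finrank_mono (sup_le h1 hP)
  rw [d0, finrank_bot] at a1
  rw [← e] at a2
  omega

lemma orthoBasis (B : LinearMap.BilinForm ℝ M) (hB : ∀ x y, B x y = B y x) (U : Submodule ℝ M)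
    [FiniteDimensional ℝ U] : ∃ (n : ℕ) (v : Basis (Fin n) ℝ U), 
      ∀ i j, i ≠ j → B (v i) (v j) = 0 := by
  have : Invertible (2:ℝ) := invertibleOfNonzero two_ne_zero
  obtain ⟨v, hv⟩ := LinearMap.BilinForm.exists_orthogonal_basis (B := B.restrict U)
    (by constructor; intro x y; simpa using hB x y)
  refine ⟨_, v, fun i j hij => ?_⟩
  exact hv hij

lemma coe_repr (U : Submodule ℝ M) {n : ℕ} (v : Basis (Fin n) ℝ U) (x : U) :
    (x : M) = ∑ i, v.repr x i • (v i : M) := by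
  have := congrArg U.subtype (v.sum_repr x)
  rw [map_sum] at this
  simp only [map_smul, Submodule.subtype_apply] at this
  exact this.symm

lemma form_expand (B : LinearMap.BilinForm ℝ M) (U : Submodule ℝ M) {n : ℕ}
    (v : Basis (Fin n) ℝ U) (h : ∀ i j, i ≠ j → B (v i) (v j) = 0) (x y : U) :
    B x y = ∑ i, v.repr x i * v.repr y i * B (v i) (v i) := by
  conv_lhs => rw [coe_repr U v x, coe_repr U v y]
  simp only [map_sum, LinearMap.sum_apply, map_smul, LinearMap.smul_apply, smul_eq_mul,
    Finset.mul_sum]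
  rw [Finset.sum_comm]
  refine Finset.sum_congr rfl fun i _ => ?_
  rw [Finset.sum_eq_single i]
  · ring
  · intro j _ hj; rw [h i j hj.symm]; simp
  · simp

lemma decomp (B : LinearMap.BilinForm ℝ M) (hB : ∀ x y, B x y = B y x) (U : Submodule ℝ M)
    [FiniteDimensional ℝ U] : ∃ N P Z : Submodule ℝ M, N ≤ U ∧ P ≤ U ∧ Z ≤ U ∧ U ≤ N ⊔ (P ⊔ Z) ∧
      NegOn B N ∧ NegOn (-B) P ∧ (∀ z ∈ Z, ∀ u ∈ U, B z u = 0) := by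
  obtain ⟨n, v, hv⟩ := orthoBasis B hB U
  let sub : Set (Fin n) → Submodule ℝ M := fun S => 
    Submodule.map U.subtype (⨅ i ∈ Sᶜ, LinearMap.ker (v.coord i))
  have hsub : ∀ S x, x ∈ sub S → ∃ u : U, (u : M) = x ∧ ∀ i ∉ S, v.repr u i = 0 := by
    rintro S x ⟨u, hu, rfl⟩
    refine ⟨u, rfl, fun i hi => ?_⟩
    simp only [Submodule.mem_iInf, Set.mem_compl_iff, SetLike.mem_coe] at hu
    simpa using hu i hi
  have hle : ∀ S, sub S ≤ U := by
    intro S x hx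
    obtain ⟨u, rfl, -⟩ := hsub S x hx
    exact u.2
  have hv' : ∀ S i, i ∈ S → (v i : M) ∈ sub S := by
    intro S i hi
    refine ⟨v i, ?_, rfl⟩
    simp only [Submodule.mem_iInf, Set.mem_compl_iff, SetLike.mem_coe]
    intro j hj
    have : i ≠ j := by rintro rfl; exact hj hi
    simp [this, Finsupp.single_apply]
  refine ⟨sub {i | B (v i) (v i) < 0}, sub {i | 0 < B (v i) (v i)}, sub {i | B (v i) (v i) = 0},
    hle _, hle _, hle _, ?_, ?_, ?_, ?_⟩
  · intro x hx
    have : x = ∑ i, v.repr ⟨x, hx⟩ i • (v i : M) := coe_repr U v ⟨x, hx⟩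
    rw [this]
    refine Submodule.sum_mem _ fun i _ => Submodule.smul_mem _ _ ?_
    rcases lt_trichotomy (B (v i) (v i)) 0 with h | h | h
    · exact Submodule.mem_sup_left (hv' _ i h)
    · exact Submodule.mem_sup_right (Submodule.mem_sup_right (hv' _ i h))
    · exact Submodule.mem_sup_right (Submodule.mem_sup_left (hv' _ i h))
  · intro x hx hne
    obtain ⟨u, rfl, hu⟩ := hsub _ x hx
    rw [form_expand B U v hv]
    have hu0 : u ≠ 0 := by rintro rfl; simp at hne
    have : ∃ i, v.repr u i ≠ 0 := by
      by_contra hcon; push Not at hcon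
      exact hu0 (v.ext_elem (by simpa using hcon))
    obtain ⟨i, hi⟩ := this
    apply Finset.sum_neg'
    · intro j _
      by_cases hj : B (v j) (v j) < 0
      · exact mul_nonpos_of_nonneg_of_nonpos (mul_self_nonneg _) hj.le
      · rw [hu j hj]; simp
    · refine ⟨i, Finset.mem_univ _, ?_⟩
      have : B (v i) (v i) < 0 := by by_contra hj; exact hi (hu i hj)
      exact mul_neg_of_pos_of_neg (mul_self_pos.2 hi) this
  · intro x hx hne
    obtain ⟨u, rfl, hu⟩ := hsub _ x hx
    simp only [LinearMap.neg_apply, Left.neg_neg_iff]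
    rw [form_expand B U v hv]
    have hu0 : u ≠ 0 := by rintro rfl; simp at hne
    have : ∃ i, v.repr u i ≠ 0 := by
      by_contra hcon; push Not at hcon
      exact hu0 (v.ext_elem (by simpa using hcon))
    obtain ⟨i, hi⟩ := this
    apply Finset.sum_pos'
    · intro j _
      by_cases hj : 0 < B (v j) (v j)
      · exact mul_nonneg (mul_self_nonneg _) hj.le
      · rw [hu j hj]; simp
    · refine ⟨i, Finset.mem_univ _, ?_⟩
      have : 0 < B (v i) (v i) := by by_contra hj; exact hi (hu i hj)
      exact mul_pos (mul_self_pos.2 hi) this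
  · intro z hz y hy
    obtain ⟨u, rfl, hu⟩ := hsub _ z hz
    have := form_expand B U v hv u ⟨y, hy⟩
    simp only at this
    rw [this]
    refine Finset.sum_eq_zero fun i _ => ?_
    by_cases h : B (v i) (v i) = 0
    · rw [h]; simp
    · rw [hu i h]; simp

lemma solve_form (B : LinearMap.BilinForm ℝ M) (hB : ∀ x y, B x y = B y x) (U : Submodule ℝ M)
    [FiniteDimensional ℝ U] (φ : M →ₗ[ℝ] ℝ)
    (h : ∀ p ∈ U, (∀ u ∈ U, B p u = 0) → φ p = 0) : ∃ p ∈ U, ∀ u ∈ U, B p u = φ u := by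
  obtain ⟨n, v, hv⟩ := orthoBasis B hB U
  let p : U := ∑ i, (φ (v i) / B (v i) (v i)) • v i
  refine ⟨p, p.2, fun u hu => ?_⟩
  have e1 : B p u = _ := form_expand B U v hv p ⟨u, hu⟩
  rw [e1]
  have hx : u = ∑ i, v.repr ⟨u, hu⟩ i • (v i : M) := coe_repr U v ⟨u, hu⟩
  conv_rhs => rw [hx]
  rw [map_sum φ]
  refine Finset.sum_congr rfl fun i _ => ?_
  have hr : v.repr p i = φ (v i) / B (v i) (v i) := by
    have := congrFun (v.repr_sum_self (fun i => φ (v i) / B (v i) (v i))) i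
    simpa [p] using this
  rw [hr, map_smul, smul_eq_mul]
  by_cases h0 : B (v i) (v i) = 0
  · have : φ (v i) = 0 := by
      apply h _ (v i).2
      intro w hw
      have := form_expand B U v hv (v i) ⟨w, hw⟩
      simp only at this
      rw [this]
      refine Finset.sum_eq_zero fun j _ => ?_
      by_cases hij : i = j
      · subst hij; rw [h0]; simp
      · simp [Finsupp.single_apply, hij]
    simp [this]
  · field_simp

lemma negIdx_add_neg (B : LinearMap.BilinForm ℝ M) (hB : ∀ x y, B x y = B y x)
    (U U' : Submodule ℝ M) [FiniteDimensional ℝ U] (z : M)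
    (hU' : U' ≤ U) (hz : z ∈ U) (hU : U ≤ U' ⊔ Submodule.span ℝ {z})
    (ho : ∀ u ∈ U', B z u = 0) (hn : B z z < 0) : negIdx B U = negIdx B U' + 1 := by
  have : FiniteDimensional ℝ U' := Submodule.finiteDimensional_of_le hU'
  obtain ⟨N, P, Z, h1, h2, h3, h4, h5, h6, h7⟩ := decomp B hB U'
  have hPZ : ∀ x ∈ P ⊔ Z, 0 ≤ B x x := by
    intro x hx
    obtain ⟨p, hp, y, hy, rfl⟩ := Submodule.mem_sup.1 hx
    have e1 : B y p = 0 := h7 y hy p (h2 hp)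
    have e2 : B p y = 0 := by rw [hB]; exact e1
    have e3 : B y y = 0 := h7 y hy y (h3 hy)
    simp only [map_add, LinearMap.add_apply, e1, e2, e3, add_zero]
    by_cases h0 : p = 0
    · simp [h0]
    · have := h6 p hp h0
      simp only [LinearMap.neg_apply, Left.neg_neg_iff] at this
      exact this.le
  rw [negIdx_eq B U' N (P ⊔ Z) h1 (sup_le h2 h3) h4 h5 hPZ]
  have hzs : Submodule.span ℝ {z} ≤ U := by simpa [Submodule.span_le] using hz
  rw [negIdx_eq B U (N ⊔ Submodule.span ℝ {z}) (P ⊔ Z) (sup_le (h1.trans hU') hzs)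
    ((sup_le h2 h3).trans hU') _ _ hPZ]
  · have : FiniteDimensional ℝ N := Submodule.finiteDimensional_of_le h1
    have hz0 : z ≠ 0 := by rintro rfl; simp at hn
    have d0 : N ⊓ Submodule.span ℝ {z} = ⊥ := by
      rw [eq_bot_iff]
      rintro x ⟨hx, hx2⟩
      obtain ⟨a, rfl⟩ := Submodule.mem_span_singleton.1 hx2
      have := ho _ (h1 hx)
      simp only [map_smul, smul_eq_mul, mul_eq_zero, hn.ne, or_false] at this
      simp [this]
    have a1 := Submodule.finrank_sup_add_finrank_inf_eq N (Submodule.span ℝ {z})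
    rw [d0, finrank_bot, finrank_span_singleton hz0] at a1
    omega
  · refine hU.trans (sup_le (h4.trans ?_) ?_)
    · exact sup_le (le_sup_left.trans le_sup_left) le_sup_right
    · exact le_sup_right.trans le_sup_left
  · intro x hx hne
    obtain ⟨m, hm, y, hy, rfl⟩ := Submodule.mem_sup.1 hx
    obtain ⟨a, rfl⟩ := Submodule.mem_span_singleton.1 hy
    have e1 : B z m = 0 := ho m (h1 hm)
    have e2 : B m z = 0 := by rw [hB]; exact e1
    simp only [map_add, LinearMap.add_apply, map_smul, LinearMap.smul_apply, e1, e2, smul_eq_mul,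
      mul_zero, add_zero, zero_add]
    by_cases h0 : m = 0
    · subst h0
      have : a ≠ 0 := by rintro rfl; simp at hne
      simp only [map_zero, zero_add]
      have := mul_self_pos.2 this
      nlinarith
    · have := h5 m hm h0
      nlinarith [mul_self_nonneg a]

lemma negIdx_add_nonneg (B : LinearMap.BilinForm ℝ M) (hB : ∀ x y, B x y = B y x)
    (U U' : Submodule ℝ M) [FiniteDimensional ℝ U] (z : M)
    (hU' : U' ≤ U) (hz : z ∈ U) (hU : U ≤ U' ⊔ Submodule.span ℝ {z})
    (ho : ∀ u ∈ U', B z u = 0) (hn : 0 ≤ B z z) : negIdx B U = negIdx B U' := by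
  have : FiniteDimensional ℝ U' := Submodule.finiteDimensional_of_le hU'
  obtain ⟨N, P, Z, h1, h2, h3, h4, h5, h6, h7⟩ := decomp B hB U'
  have hPZ : ∀ x ∈ P ⊔ Z, 0 ≤ B x x := by
    intro x hx
    obtain ⟨p, hp, y, hy, rfl⟩ := Submodule.mem_sup.1 hx
    have e1 : B y p = 0 := h7 y hy p (h2 hp)
    have e2 : B p y = 0 := by rw [hB]; exact e1
    have e3 : B y y = 0 := h7 y hy y (h3 hy)
    simp only [map_add, LinearMap.add_apply, e1, e2, e3, add_zero]
    by_cases h0 : p = 0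
    · simp [h0]
    · have := h6 p hp h0
      simp only [LinearMap.neg_apply, Left.neg_neg_iff] at this
      exact this.le
  rw [negIdx_eq B U' N (P ⊔ Z) h1 (sup_le h2 h3) h4 h5 hPZ]
  have hzs : Submodule.span ℝ {z} ≤ U := by simpa [Submodule.span_le] using hz
  rw [negIdx_eq B U N (P ⊔ Z ⊔ Submodule.span ℝ {z}) (h1.trans hU')
    (sup_le ((sup_le h2 h3).trans hU') hzs) _ h5]
  · intro x hx
    obtain ⟨m, hm, y, hy, rfl⟩ := Submodule.mem_sup.1 hx
    obtain ⟨a, rfl⟩ := Submodule.mem_span_singleton.1 hy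
    have e1 : B z m = 0 := ho m ((sup_le h2 h3) hm)
    have e2 : B m z = 0 := by rw [hB]; exact e1
    simp only [map_add, LinearMap.add_apply, map_smul, LinearMap.smul_apply, e1, e2, smul_eq_mul,
      mul_zero, add_zero, zero_add]
    have := hPZ m hm
    nlinarith [mul_self_nonneg a, mul_nonneg (mul_self_nonneg a) hn]
  · refine hU.trans (sup_le (h4.trans ?_) ?_)
    · exact sup_le le_sup_left (le_sup_left.trans le_sup_right)
    · exact le_sup_right.trans le_sup_right

lemma negOn_open (B : ℝ → LinearMap.BilinForm ℝ M) (hc : ∀ x y, Continuous fun s => B s x y)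
    (s₀ : ℝ) (N : Submodule ℝ M) [FiniteDimensional ℝ N] (h : NegOn (B s₀) N) :
    ∀ᶠ s in nhds s₀, NegOn (B s) N := by
  let v := finBasis ℝ N
  set n := finrank ℝ N
  let F : ℝ → EuclideanSpace ℝ (Fin n) → ℝ := fun s x => ∑ i, ∑ j, x i * x j * B s (v i) (v j)
  have hF : Continuous (fun q : ℝ × EuclideanSpace ℝ (Fin n) => F q.1 q.2) := by
    refine continuous_finsetSum _ fun i _ => continuous_finsetSum _ fun j _ => ?_
    have := (hc (v i) (v j)).comp (continuous_fst (X := ℝ) (Y := EuclideanSpace ℝ (Fin n)))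
    have h1 : Continuous fun q : ℝ × EuclideanSpace ℝ (Fin n) => q.2 i := by fun_prop
    have h2 : Continuous fun q : ℝ × EuclideanSpace ℝ (Fin n) => q.2 j := by fun_prop
    exact (h1.mul h2).mul this
  have hFe : ∀ s (x : EuclideanSpace ℝ (Fin n)), F s x =
      B s (∑ i, x i • (v i : M)) (∑ i, x i • (v i : M)) := by
    intro s x
    simp only [map_sum, LinearMap.sum_apply, map_smul, LinearMap.smul_apply, smul_eq_mul, F,
      Finset.mul_sum]
    rw [Finset.sum_comm]
    refine Finset.sum_congr rfl fun i _ => Finset.sum_congr rfl fun j _ => ?_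
    ring
  have hcomp : IsCompact (Metric.sphere (0 : EuclideanSpace ℝ (Fin n)) 1) := isCompact_sphere _ _
  have := hcomp.eventually_forall_of_forall_eventually (x₀ := s₀)
    (P := fun s x => F s x < 0) (by
      intro x hx
      have hneg : F s₀ x < 0 := by
        rw [hFe]
        apply h
        · exact Submodule.sum_mem _ fun i _ => Submodule.smul_mem _ _ (v i).2
        · intro h0
          have h0' : ∑ i, x i • v i = 0 := by
            apply Subtype.ext
            simpa using h0
          have hx0 := Fintype.linearIndependent_iff.1 v.linearIndependent (fun i => x i) h0'
          have : x = 0 := by ext i; exact hx0 i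
          rw [this] at hx
          simp at hx
      exact (hF.continuousAt (x := (s₀, x))).eventually (gt_mem_nhds hneg) |>.mono (fun _ h => h))
  filter_upwards [this] with s hs
  intro x hx hne
  let u : N := ⟨x, hx⟩
  let a : EuclideanSpace ℝ (Fin n) := WithLp.toLp 2 (fun i => v.repr u i)
  have ha : a ≠ 0 := by
    intro h0
    apply hne
    have : u = 0 := by
      apply v.ext_elem
      intro i
      have := congrArg (fun z : EuclideanSpace ℝ (Fin n) => z i) h0
      simpa [a] using this
    exact congrArg Subtype.val this
  have hna : 0 < ‖a‖ := norm_pos_iff.2 ha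
  have h1 := hs (‖a‖⁻¹ • a) (by simp [norm_smul, hna.ne'])
  have hx' : x = ∑ i, a i • (v i : M) := coe_repr N v u
  have h2 : F s (‖a‖⁻¹ • a) = (‖a‖⁻¹)^2 * F s a := by
    simp only [F, PiLp.smul_apply, smul_eq_mul, Finset.mul_sum]
    refine Finset.sum_congr rfl fun i _ => Finset.sum_congr rfl fun j _ => ?_
    ring
  rw [h2, hFe, ← hx'] at h1
  have : 0 < (‖a‖⁻¹)^2 := by positivity
  by_contra hcon
  push Not at hcon
  nlinarith [mul_nonneg this.le hcon]

lemma negIdx_const (B : ℝ → LinearMap.BilinForm ℝ M) (hc : ∀ x y, Continuous fun s => B s x y)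
    (hB : ∀ s x y, B s x y = B s y x) (s₀ : ℝ) (U : Submodule ℝ M) [FiniteDimensional ℝ U] :
    ∀ᶠ s in nhds s₀, (∀ x ∈ U, (∀ y ∈ U, B s₀ x y = 0) → ∀ y ∈ U, B s x y = 0) →
      negIdx (B s) U = negIdx (B s₀) U := by
  obtain ⟨N, P, Z, h1, h2, h3, h4, h5, h6, h7⟩ := decomp (B s₀) (hB s₀) U
  have : FiniteDimensional ℝ N := Submodule.finiteDimensional_of_le h1
  have : FiniteDimensional ℝ P := Submodule.finiteDimensional_of_le h2
  have key : ∀ s, NegOn (B s) N → NegOn (-(B s)) P → (∀ z ∈ Z, ∀ u ∈ U, B s z u = 0) → 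
      negIdx (B s) U = finrank ℝ N := by
    intro s hn hp hz
    apply negIdx_eq (B s) U N (P ⊔ Z) h1 (sup_le h2 h3) h4 hn
    intro x hx
    obtain ⟨p, hp', y, hy, rfl⟩ := Submodule.mem_sup.1 hx
    have e1 : B s y p = 0 := hz y hy p (h2 hp')
    have e2 : B s p y = 0 := by rw [hB]; exact e1
    have e3 : B s y y = 0 := hz y hy y (h3 hy)
    simp only [map_add, LinearMap.add_apply, e1, e2, e3, add_zero]
    by_cases h0 : p = 0
    · simp [h0]
    · have := hp p hp' h0
      simp only [LinearMap.neg_apply, Left.neg_neg_iff] at this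
      exact this.le
  filter_upwards [negOn_open B hc s₀ N h5, negOn_open (fun s => -(B s))
    (fun x y => (hc x y).neg) s₀ P h6] with s g1 g2 hrad
  rw [key s g1 g2 (fun z hz => hrad z (h3 hz) (h7 z hz)), key s₀ h5 h6 h7]

lemma negIdx_transfer {M' : Type*} [AddCommGroup M'] [Module ℝ M'] (B : LinearMap.BilinForm ℝ M)
    (B' : LinearMap.BilinForm ℝ M') (U : Submodule ℝ M) (U' : Submodule ℝ M')
    [FiniteDimensional ℝ U] [FiniteDimensional ℝ U'] (f : M →ₗ[ℝ] M')
    (hf : ∀ x ∈ U, f x ∈ U') (h : ∀ x ∈ U, B x x = B' (f x) (f x)) :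
    negIdx B U ≤ negIdx B' U' := by
  obtain ⟨N, h1, h2, h3⟩ := negIdx_attained B U
  rw [← h3]
  have hinj : ∀ x ∈ N, f x = 0 → x = 0 := by
    intro x hx h0
    by_contra hne
    have := h2 x hx hne
    rw [h x (h1 hx), h0] at this
    simp at this
  have : finrank ℝ N = finrank ℝ (N.map f) := by
    have hi : Function.Injective (f.domRestrict N) := by
      rw [← LinearMap.ker_eq_bot, eq_bot_iff]
      intro x hx
      have := hinj x.1 x.2 (by simpa using hx)
      exact (Submodule.mem_bot ℝ).2 (Subtype.ext this)
    rw [← LinearMap.finrank_range_of_inj hi, LinearMap.range_domRestrict]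
  rw [this]
  apply le_negIdx
  · rintro _ ⟨x, hx, rfl⟩
    exact hf x (h1 hx)
  · rintro _ ⟨x, hx, rfl⟩ hne
    rw [← h x (h1 hx)]
    exact h2 x hx (by rintro rfl; simp at hne)

lemma negIdx_congr (B B' : LinearMap.BilinForm ℝ M) (U : Submodule ℝ M)
    [FiniteDimensional ℝ U] (h : ∀ x ∈ U, B x x = B' x x) :
    negIdx B U = negIdx B' U :=
  le_antisymm (negIdx_transfer B B' U U LinearMap.id (fun _ h => h) (by simpa using h))
    (negIdx_transfer B' B U U LinearMap.id (fun _ h => h) (by simpa using fun x hx => (h x hx).symm))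

lemma hrcore {M' : Type*} [AddCommGroup M'] [Module ℝ M']
    (Q : LinearMap.BilinForm ℝ M) (Q' : LinearMap.BilinForm ℝ M')
    (hQ : ∀ x y, Q x y = Q y x) (hQ' : ∀ x y, Q' x y = Q' y x)
    (U : Submodule ℝ M) (U' : Submodule ℝ M') [FiniteDimensional ℝ U] [FiniteDimensional ℝ U']
    (f : M' →ₗ[ℝ] M) (hf : ∀ x ∈ U', f x ∈ U) (hff : ∀ x ∈ U', ∀ y ∈ U', Q (f x) (f y) = Q' x y)
    (hidx : negIdx Q U ≤ negIdx Q' U')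
    (hrad : ∀ p ∈ U', (∀ y ∈ U', Q' p y = 0) → ∀ g ∈ U, Q g (f p) = 0)
    (q : M) (hq : q ∈ U) (hprim : ∀ p ∈ U', Q q (f p) = 0) :
    0 ≤ Q q q ∧ (Q q q = 0 → ∀ g ∈ U, Q q g = 0) := by
  have hpos : ∀ q ∈ U, (∀ p ∈ U', Q q (f p) = 0) → 0 ≤ Q q q := by
    intro q hq hprim
    by_contra hneg
    push Not at hneg
    obtain ⟨N, h1, h2, h3⟩ := negIdx_attained Q' U'
    have hle : N.map f ⊔ Submodule.span ℝ {q} ≤ U := by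
      refine sup_le ?_ (by simpa [Submodule.span_le] using hq)
      rintro _ ⟨x, hx, rfl⟩; exact hf x (h1 hx)
    have : FiniteDimensional ℝ ↥(N.map f ⊔ Submodule.span ℝ {q}) :=
      Submodule.finiteDimensional_of_le hle
    have e1 := negIdx_add_neg Q hQ (N.map f ⊔ Submodule.span ℝ {q}) (N.map f) q le_sup_left
      (Submodule.mem_sup_right (Submodule.mem_span_singleton_self q)) le_rfl
      (by rintro _ ⟨x, hx, rfl⟩; exact hprim x (h1 hx)) hneg
    have : FiniteDimensional ℝ N := Submodule.finiteDimensional_of_le h1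
    have : FiniteDimensional ℝ (N.map f) := inferInstance
    have e2 : negIdx Q' N ≤ negIdx Q (N.map f) :=
      negIdx_transfer Q' Q N (N.map f) f (fun x hx => ⟨x, hx, rfl⟩)
        (fun x hx => (hff x (h1 hx) x (h1 hx)).symm)
    have e3 := le_negIdx Q' N N le_rfl h2
    have e4 : negIdx Q (N.map f ⊔ Submodule.span ℝ {q}) ≤ negIdx Q U :=
      negIdx_transfer Q Q _ _ LinearMap.id (fun x hx => hle hx) (fun _ _ => rfl)
    omega
  refine ⟨hpos q hq hprim, fun h0 g hg => ?_⟩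
  -- solve
  obtain ⟨p, hp, hpe⟩ := solve_form Q' hQ' U' ((Q g).comp f) (by
    intro p hp h; exact hrad p hp h g hg)
  have e0 : Q q g = Q q (g - f p) := by rw [map_sub, hprim p hp, sub_zero]
  rw [e0]
  set x := g - f p with hx
  have hxU : x ∈ U := U.sub_mem hg (hf p hp)
  have hxp : ∀ p' ∈ U', Q x (f p') = 0 := by
    intro p' hp'
    have := hpe p' hp'
    simp only [LinearMap.comp_apply] at this
    rw [hx, map_sub, LinearMap.sub_apply, hff p hp p' hp', this, sub_self]
  have hall : ∀ t : ℝ, 0 ≤ 2 * t * Q q x + Q x x := by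
    intro t
    have := hpos (t • q + x) (U.add_mem (U.smul_mem _ hq) hxU) (by
      intro p' hp'
      simp [hprim p' hp', hxp p' hp'])
    simp only [map_add, LinearMap.add_apply, map_smul, LinearMap.smul_apply, smul_eq_mul, h0] at this
    rw [hQ x q] at this
    linarith
  by_contra hne
  have := hall (-(Q x x + 1) / (2 * Q q x))
  have e : 2 * (-(Q x x + 1) / (2 * Q q x)) * Q q x = -(Q x x + 1) := by field_simp
  rw [e] at this
  linarith

end LinAlg
end JKM

namespace JKM
open Module

section Basic
variable {ι : Type} [Fintype ι] [DecidableEq ι]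

/-- linear form with given coefficients -/
noncomputable def lin (c : ι → ℝ) : MvPolynomial ι ℝ := ∑ i, c i • X i

/-- squarefree monomial -/
noncomputable def xm (T : Finset ι) : MvPolynomial ι ℝ := ∏ i ∈ T, X i

lemma lin_hom (c : ι → ℝ) : (lin c).IsHomogeneous 1 := by
  apply IsHomogeneous.sum
  intro i _
  rw [smul_eq_C_mul]
  simpa using (isHomogeneous_C ι (c i)).mul (isHomogeneous_X ℝ i)

lemma xm_hom (T : Finset ι) : (xm T).IsHomogeneous T.card := by
  have := IsHomogeneous.prod T (fun i => (X i : MvPolynomial ι ℝ)) (fun _ => 1)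
    (fun i _ => isHomogeneous_X ℝ i)
  simpa [xm] using this

lemma xm_insert {T : Finset ι} {w : ι} (h : w ∉ T) : xm (insert w T) = X w * xm T := by
  simp [xm, Finset.prod_insert h]

lemma lin_sub (c c' : ι → ℝ) : lin (fun i => c i - c' i) = lin c - lin c' := by
  simp [lin, sub_smul, Finset.sum_sub_distrib]

/-- homogeneous polynomials -/
noncomputable abbrev Em (ι : Type) (m : ℕ) : Submodule ℝ (MvPolynomial ι ℝ) :=
  homogeneousSubmodule ι ℝ m

instance (m : ℕ) : FiniteDimensional ℝ (Em ι m) := by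
  exact Module.Finite.iff_fg.2 (homogeneousSubmodule_fg ι ℝ m)

/-- the form `p, q ↦ L (K p q)` -/
noncomputable def QF (L : MvPolynomial ι ℝ →ₗ[ℝ] ℝ) (K : MvPolynomial ι ℝ) :
    LinearMap.BilinForm ℝ (MvPolynomial ι ℝ) :=
  (LinearMap.mul ℝ (MvPolynomial ι ℝ)).compr₂ (L.comp (LinearMap.mulLeft ℝ K))

lemma QF_apply (L : MvPolynomial ι ℝ →ₗ[ℝ] ℝ) (K p q : MvPolynomial ι ℝ) :
    QF L K p q = L (K * (p * q)) := rfl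

lemma QF_symm (L : MvPolynomial ι ℝ →ₗ[ℝ] ℝ) (K p q : MvPolynomial ι ℝ) :
    QF L K p q = QF L K q p := by rw [QF_apply, QF_apply, mul_comm p q]

lemma L_lin (L : MvPolynomial ι ℝ →ₗ[ℝ] ℝ) (c : ι → ℝ) (q : MvPolynomial ι ℝ) :
    L (lin c * q) = ∑ i, c i * L (X i * q) := by
  simp [lin, Finset.sum_mul, smul_mul_assoc]

variable {E : Type} [AddCommGroup E] [Module ℝ E] [FiniteDimensional ℝ E]

def InP (V : ι → Dual ℝ E) (c : ι → ℝ) (x : E) : Prop := ∀ i, V i x ≤ c i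

open Classical in
noncomputable def act (V : ι → Dual ℝ E) (c : ι → ℝ) (x : E) : Finset ι :=
  Finset.univ.filter fun i => V i x = c i

lemma mem_act {V : ι → Dual ℝ E} {c : ι → ℝ} {x : E} {i : ι} : i ∈ act V c x ↔ V i x = c i := by
  simp [act]

def Simple (V : ι → Dual ℝ E) (c : ι → ℝ) : Prop :=
  ∀ x, InP V c x → LinearIndepOn ℝ V (act V c x : Set ι)

def Cone (V : ι → Dual ℝ E) : Prop := ∀ x, (∀ i, V i x ≤ 0) → x = 0

def Fc (V : ι → Dual ℝ E) (c : ι → ℝ) (τ : Finset ι) : Prop :=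
  ∃ x, InP V c x ∧ τ ⊆ act V c x

lemma Fc.mono {V : ι → Dual ℝ E} {c : ι → ℝ} {σ τ : Finset ι} (h : Fc V c τ) (hs : σ ⊆ τ) :
    Fc V c σ := by
  obtain ⟨x, h1, h2⟩ := h
  exact ⟨x, h1, hs.trans h2⟩

lemma exists_sol {V : ι → Dual ℝ E} {T : Set ι} (h : LinearIndepOn ℝ V T) (b : ι → ℝ) :
    ∃ u : E, ∀ i ∈ T, V i u = b i := by
  have hli : LinearIndependent ℝ (fun i : T => V i) := h
  let f := (Basis.span hli).constr ℝ (fun i : T => b i)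
  obtain ⟨g, hg⟩ := LinearMap.exists_extend f
  refine ⟨(evalEquiv ℝ E).symm g, fun i hi => ?_⟩
  have e1 : V i ((evalEquiv ℝ E).symm g) = g (V i) := by
    have := congrArg (fun z => z (V i)) ((evalEquiv ℝ E).apply_symm_apply g)
    simpa using this
  rw [e1]
  have e2 : V i = (Submodule.span ℝ (Set.range fun i : T => V i)).subtype
      (Basis.span hli ⟨i, hi⟩) := by
    simp [Basis.span_apply]
  rw [e2, ← LinearMap.comp_apply, hg]
  exact (Basis.span hli).constr_basis ℝ _ ⟨i, hi⟩

/-- move off constraints -/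
lemma move_off {V : ι → Dual ℝ E} {c : ι → ℝ} {x : E} (hx : InP V c x) (u : E)
    (hu : ∀ i ∈ act V c x, V i u ≤ 0) :
    ∀ᶠ s : ℝ in nhdsWithin 0 (Set.Ioi 0), InP V c (x + s • u) ∧
      ∀ i, i ∈ act V c (x + s • u) ↔ i ∈ act V c x ∧ V i u = 0 := by
  have : ∀ᶠ s : ℝ in nhdsWithin 0 (Set.Ioi 0), ∀ i, V i (x + s • u) ≤ c i ∧
      (V i (x + s • u) = c i ↔ i ∈ act V c x ∧ V i u = 0) := by
    rw [Filter.eventually_all]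
    intro i
    by_cases hi : i ∈ act V c x
    · have hi' := mem_act.1 hi
      filter_upwards [self_mem_nhdsWithin] with s hs
      have hs' : 0 < s := hs
      simp only [map_add, map_smul, smul_eq_mul, hi', hi, true_and]
      have := hu i hi
      constructor
      · nlinarith
      · constructor
        · intro h
          have : s * V i u = 0 := by linarith
          rcases mul_eq_zero.1 this with h | h
          · exact absurd h hs'.ne'
          · exact h
        · intro h; rw [h]; ring
    · have hlt : V i x < c i := lt_of_le_of_ne (hx i) (fun h => hi (mem_act.2 h))
      have hc : Continuous fun s : ℝ => V i x + s * V i u := by fun_prop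
      have h1 : ∀ᶠ s : ℝ in nhds 0, V i x + s * V i u < c i := by
        apply (hc.continuousAt).eventually (gt_mem_nhds _)
        simpa using hlt
      filter_upwards [nhdsWithin_le_nhds h1] with s hs
      simp only [map_add, map_smul, smul_eq_mul, hi, false_and, iff_false]
      exact ⟨hs.le, hs.ne⟩
  filter_upwards [this] with s hs
  exact ⟨fun i => (hs i).1, fun i => by rw [mem_act]; exact (hs i).2⟩

lemma face_exact {V : ι → Dual ℝ E} {c : ι → ℝ} (hs : Simple V c) {T : Finset ι} (hT : Fc V c T) :
    ∃ x, InP V c x ∧ act V c x = T := by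
  obtain ⟨x, hx, hT⟩ := hT
  obtain ⟨u, hu⟩ := exists_sol (hs x hx) (fun i => if i ∈ T then 0 else -1)
  have := move_off hx u (by
    intro i hi
    rw [hu i hi]
    split_ifs <;> norm_num)
  obtain ⟨s, h1, h2⟩ := this.exists
  refine ⟨x + s • u, h1, ?_⟩
  ext i
  rw [h2]
  constructor
  · rintro ⟨hi, h0⟩
    rw [hu i hi] at h0
    by_contra hn
    simp [hn] at h0
  · intro hi
    refine ⟨hT hi, ?_⟩
    rw [hu i (hT hi)]
    simp [hi]

structure IsVol (V : ι → Dual ℝ E) (c : ι → ℝ) (L : MvPolynomial ι ℝ →ₗ[ℝ] ℝ) : Prop where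
  simple : Simple V c
  cone : Cone V
  deg : ∀ n q, IsHomogeneous q n → n ≠ finrank ℝ E → L q = 0
  nonface : ∀ τ, ¬ Fc V c τ → ∀ q, L (xm τ * q) = 0
  theta : ∀ u q, L (lin (fun i => V i u) * q) = 0
  pos : ∀ τ, Fc V c τ → τ.card = finrank ℝ E → 0 < L (xm τ)

/-- degree property -/
def DegP (L : MvPolynomial ι ℝ →ₗ[ℝ] ℝ) (d : ℕ) : Prop :=
  ∀ n q, IsHomogeneous q n → n ≠ d → L q = 0

lemma DegP.all {L : MvPolynomial ι ℝ →ₗ[ℝ] ℝ} {d : ℕ} (hL : DegP L d) {K : MvPolynomial ι ℝ}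
    {a n : ℕ} (hK : K.IsHomogeneous a) (han : a + n = d)
    (h : ∀ g, IsHomogeneous g n → L (K * g) = 0) (g : MvPolynomial ι ℝ) : L (K * g) = 0 := by
  rw [← sum_homogeneousComponent g, Finset.mul_sum, map_sum]
  refine Finset.sum_eq_zero fun i _ => ?_
  by_cases hi : i = n
  · subst hi; exact h _ (homogeneousComponent_isHomogeneous _ _)
  · exact hL _ _ (hK.mul (homogeneousComponent_isHomogeneous i g)) (by omega)

def HR (d : ℕ) (c : ι → ℝ) (L : MvPolynomial ι ℝ →ₗ[ℝ] ℝ) (T : Finset ι) : Prop :=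
  ∀ m k, 2 * m + k + T.card = d → ∀ q : MvPolynomial ι ℝ, q.IsHomogeneous m →
    (∀ g, L (xm T * lin c ^ (k+1) * q * g) = 0) →
    0 ≤ (-1) ^ m * L (xm T * lin c ^ k * (q * q)) ∧
    (L (xm T * lin c ^ k * (q * q)) = 0 → ∀ g, L (xm T * q * g) = 0)

def HL (d : ℕ) (c : ι → ℝ) (L : MvPolynomial ι ℝ →ₗ[ℝ] ℝ) (T : Finset ι) : Prop :=
  ∀ m k, 2 * m + k + T.card = d → ∀ q : MvPolynomial ι ℝ, q.IsHomogeneous m →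
    (∀ g, L (xm T * lin c ^ k * q * g) = 0) → ∀ g, L (xm T * q * g) = 0

def HRI (d : ℕ) (c : ι → ℝ) (L : MvPolynomial ι ℝ →ₗ[ℝ] ℝ) (T : Finset ι) : Prop :=
  ∀ m k, 2 * m + 2 + k + T.card = d →
    negIdx ((-1 : ℝ) ^ (m+1) • QF L (xm T * lin c ^ k)) (Em ι (m+1)) ≤
    negIdx ((-1 : ℝ) ^ (m+1) • QF L (xm T * lin c ^ (k+2))) (Em ι m)

/-- reduce `L(X w K) = 0` for `w ∈ T` to `w ∉ T` -/
lemma X_reduce {V : ι → Dual ℝ E} {L : MvPolynomial ι ℝ →ₗ[ℝ] ℝ}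
    (hth : ∀ u q, L (lin (fun i => V i u) * q) = 0) {T : Finset ι}
    (hT : LinearIndepOn ℝ V (T : Set ι)) (K : MvPolynomial ι ℝ)
    (h : ∀ w ∉ T, L (X w * K) = 0) (w : ι) : L (X w * K) = 0 := by
  by_cases hw : w ∈ T
  · obtain ⟨u, hu⟩ := exists_sol hT (fun i => if i = w then 1 else 0)
    have := hth u K
    rw [L_lin, Finset.sum_eq_single w] at this
    · rw [hu w hw] at this; simpa using this
    · intro i _ hi
      by_cases hiT : i ∈ T
      · rw [hu i hiT]; simp [hi]
      · rw [h i hiT]; simp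
    · simp
  · exact h w hw

/-- expand `c` using a point -/
lemma L_lin_point {V : ι → Dual ℝ E} {L : MvPolynomial ι ℝ →ₗ[ℝ] ℝ}
    (hth : ∀ u q, L (lin (fun i => V i u) * q) = 0) (c : ι → ℝ) (x : E) (K : MvPolynomial ι ℝ) :
    L (lin c * K) = ∑ i, (c i - V i x) * L (X i * K) := by
  rw [← L_lin L (fun i => c i - V i x), lin_sub, sub_mul, map_sub, hth, sub_zero]

lemma zero_of_X {L : MvPolynomial ι ℝ →ₗ[ℝ] ℝ} {d : ℕ} (hL : DegP L d) {K : MvPolynomial ι ℝ}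
    {a : ℕ} (hK : K.IsHomogeneous a) (ha : a ≠ d) (h : ∀ w g, L (X w * (K * g)) = 0)
    (g : MvPolynomial ι ℝ) : L (K * g) = 0 := by
  induction g using MvPolynomial.induction_on with
  | C b => 
    apply hL a _ _ ha
    simpa using hK.mul (isHomogeneous_C ι b)
  | add p q hp hq => rw [mul_add, map_add, hp, hq, add_zero]
  | mul_X p w _ => 
    have := h w p
    rw [← this]; congr 1; ring

lemma HL_of_HR {V : ι → Dual ℝ E} {c : ι → ℝ} {L : MvPolynomial ι ℝ →ₗ[ℝ] ℝ}
    (hV : IsVol V c L) (T : Finset ι)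
    (h : ∀ w ∉ T, HR (finrank ℝ E) c L (insert w T)) : HL (finrank ℝ E) c L T := by
  intro m k hmk q hq h0 
  by_cases hT : Fc V c T
  swap
  · intro g; rw [mul_assoc]; exact hV.nonface T hT _
  obtain ⟨x, hx, hxT⟩ := face_exact hV.simple hT
  have hli := hV.simple x hx
  rw [hxT] at hli
  rcases k with _ | k
  · simpa using h0
  have hsign : ∀ w ∉ T, 0 ≤ (-1) ^ m * L (X w * (xm T * lin c ^ k * (q * q))) ∧
      (L (X w * (xm T * lin c ^ k * (q * q))) = 0 → ∀ g, L (X w * (xm T * q * g)) = 0) := by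
    intro w hw
    have := h w hw m k (by rw [Finset.card_insert_of_notMem hw]; omega) q hq (by
      intro g
      have := h0 (X w * g)
      rw [← this, xm_insert hw]; congr 1; ring)
    rw [xm_insert hw] at this
    simpa only [mul_assoc] using this
  have hsum : ∑ i, (c i - V i x) * ((-1) ^ m * L (X i * (xm T * lin c ^ k * (q * q)))) = 0 := by
    have h1 := h0 q
    have e : xm T * lin c ^ (k+1) * q * q = lin c * (xm T * lin c ^ k * (q * q)) := by ring
    rw [e, L_lin_point hV.theta c x] at h1
    have : ∀ i, (c i - V i x) * ((-1) ^ m * L (X i * (xm T * lin c ^ k * (q * q)))) =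
      (-1) ^ m * ((c i - V i x) * L (X i * (xm T * lin c ^ k * (q * q)))) := by intro i; ring
    simp_rw [this]
    rw [← Finset.mul_sum, h1, mul_zero]
  have hc0 : ∀ i ∈ T, c i - V i x = 0 := by
    intro i hi; rw [← hxT, mem_act] at hi; linarith
  have hcpos : ∀ i ∉ T, 0 < c i - V i x := by
    intro i hi; rw [← hxT, mem_act] at hi
    have := lt_of_le_of_ne (hx i) hi
    linarith
  have hz := (Finset.sum_eq_zero_iff_of_nonneg (by
    intro i _
    by_cases hi : i ∈ T
    · rw [hc0 i hi]; simp
    · exact mul_nonneg (hcpos i hi).le (hsign i hi).1)).1 hsum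
  have hX : ∀ w g, L (X w * (xm T * q * g)) = 0 := by
    intro w g
    refine X_reduce hV.theta hli _ (fun w hw => ?_) w
    apply (hsign w hw).2
    have := hz w (Finset.mem_univ _)
    rcases mul_eq_zero.1 this with h | h
    · exact absurd h (hcpos w hw).ne'
    · rcases mul_eq_zero.1 h with h | h
      · exact absurd h (pow_ne_zero _ (by norm_num))
      · exact h
  exact zero_of_X hV.deg ((xm_hom T).mul hq) (by omega) hX

lemma L_pow_nonneg {V : ι → Dual ℝ E} {c : ι → ℝ} {L : MvPolynomial ι ℝ →ₗ[ℝ] ℝ}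
    (hV : IsVol V c L) (k : ℕ) : ∀ T : Finset ι, k + T.card = finrank ℝ E →
    0 ≤ L (xm T * lin c ^ k) := by
  induction k with
  | zero =>
    intro T hT
    by_cases h : Fc V c T
    · simpa using (hV.pos T h (by omega)).le
    · rw [hV.nonface T h]
  | succ k ih =>
    intro T hT
    by_cases h : Fc V c T
    swap
    · rw [hV.nonface T h]
    obtain ⟨x, hx, hxT⟩ := face_exact hV.simple h
    have e : xm T * lin c ^ (k+1) = lin c * (xm T * lin c ^ k) := by ring
    rw [e, L_lin_point hV.theta c x]
    refine Finset.sum_nonneg fun i _ => ?_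
    by_cases hi : i ∈ T
    · rw [← hxT, mem_act] at hi; rw [hi]; simp
    · refine mul_nonneg (by have := hx i; linarith) ?_
      have := ih (insert i T) (by rw [Finset.card_insert_of_notMem hi]; omega)
      rwa [xm_insert hi, mul_assoc] at this

lemma hom_zero_eq {q : MvPolynomial ι ℝ} (h : q.IsHomogeneous 0) : ∃ a, q = C a := by
  refine ⟨coeff 0 q, ?_⟩
  exact (totalDegree_eq_zero_iff_eq_C).1 (Nat.le_zero.1 h.totalDegree_le)

lemma HR_of_HRI {V : ι → Dual ℝ E} {c : ι → ℝ} {L : MvPolynomial ι ℝ →ₗ[ℝ] ℝ}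
    (hV : IsVol V c L) (T : Finset ι) (hHL : HL (finrank ℝ E) c L T)
    (hI : HRI (finrank ℝ E) c L T) : HR (finrank ℝ E) c L T := by
  intro m k hmk q hq h0
  rcases m with _ | m
  · obtain ⟨a, rfl⟩ := hom_zero_eq hq
    have e : ∀ b, L (xm T * lin c ^ k * (C a * C b)) = a * b * L (xm T * lin c ^ k) := by
      intro b
      rw [← C_mul, mul_comm _ (C (a * b)), ← smul_eq_C_mul, map_smul, smul_eq_mul]
    rw [e]
    have hp := L_pow_nonneg hV k T (by omega)
    refine ⟨by simpa using mul_nonneg (mul_self_nonneg a) hp, fun hz => ?_⟩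
    apply hHL 0 k hmk _ hq
    have hK : (xm T * lin c ^ k * C a).IsHomogeneous (T.card + 1 * k + 0) :=
      ((xm_hom T).mul ((lin_hom c).pow k)).mul (isHomogeneous_C _ _)
    apply DegP.all hV.deg hK (n := 0) (by omega)
    intro g hg
    obtain ⟨b, rfl⟩ := hom_zero_eq hg
    rw [mul_assoc, e]
    rcases mul_eq_zero.1 hz with h | h
    · rw [mul_self_eq_zero.1 h]; simp
    · rw [h]; simp
  · set ε : ℝ := (-1) ^ (m+1) with hε
    have hε0 : ε ≠ 0 := pow_ne_zero _ (by norm_num)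
    have key := hrcore (ε • QF L (xm T * lin c ^ k)) (ε • QF L (xm T * lin c ^ (k+2)))
      (fun x y => by simp only [LinearMap.smul_apply]; rw [QF_symm])
      (fun x y => by simp only [LinearMap.smul_apply]; rw [QF_symm])
      (Em ι (m+1)) (Em ι m) (LinearMap.mulLeft ℝ (lin c))
      (by
        intro x hx
        have := (lin_hom c).mul hx
        rw [add_comm] at this
        exact this)
      (by
        intro x _ y _
        simp only [LinearMap.smul_apply, QF_apply, LinearMap.mulLeft_apply]
        congr 2; ring)
      (hI m k (by omega))
      (by
        intro p hp hpp g hg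
        have : ∀ g, L (xm T * lin c ^ (k+2) * p * g) = 0 := by
          apply DegP.all hV.deg (((xm_hom T).mul ((lin_hom c).pow (k+2))).mul hp) (n := m)
            (by omega)
          intro g hg
          have := hpp g hg
          simp only [LinearMap.smul_apply, QF_apply, smul_eq_mul, mul_eq_zero, hε0, false_or] at this
          rw [← this]; congr 1; ring
        have := hHL m (k+2) (by omega) p hp this (lin c ^ (k+1) * g)
        simp only [LinearMap.smul_apply, QF_apply, LinearMap.mulLeft_apply]
        have e : xm T * lin c ^ k * (g * (lin c * p)) = xm T * p * (lin c ^ (k + 1) * g) := by ring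
        rw [e, this, smul_zero])
      q hq (by
        intro p _
        simp only [LinearMap.smul_apply, QF_apply, LinearMap.mulLeft_apply]
        have e : xm T * lin c ^ k * (q * (lin c * p)) = xm T * lin c ^ (k+1) * q * p := by ring
        rw [e, h0, smul_zero])
    simp only [LinearMap.smul_apply, QF_apply, smul_eq_mul, mul_eq_zero, hε0, false_or] at key
    refine ⟨key.1, fun hz => ?_⟩
    apply hHL (m+1) k hmk q hq
    apply DegP.all hV.deg (((xm_hom T).mul ((lin_hom c).pow k)).mul hq) (n := m+1) (by omega)
    intro g hg
    have := key.2 hz g hg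
    rw [← this]; congr 1; ring

end Basic
end JKM

namespace JKM
open Module

section Ev
variable {ι : Type} [Fintype ι] [DecidableEq ι]

/-- evaluation of the degree `n` component -/
noncomputable def ev (n : ℕ) (lam : ι → ℝ) : MvPolynomial ι ℝ →ₗ[ℝ] ℝ :=
  (aeval lam).toLinearMap.comp (homogeneousComponent n)

lemma ev_apply (n : ℕ) (lam : ι → ℝ) (q : MvPolynomial ι ℝ) :
    ev n lam q = eval lam (homogeneousComponent n q) := by
  simp [ev, aeval_eq_eval]

lemma ev_hom {n : ℕ} (lam : ι → ℝ) {q : MvPolynomial ι ℝ} (h : q.IsHomogeneous n) :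
    ev n lam q = eval lam q := by
  rw [ev_apply, homogeneousComponent_of_mem h]; simp

lemma ev_hom_ne {n m : ℕ} (lam : ι → ℝ) {q : MvPolynomial ι ℝ} (h : q.IsHomogeneous m)
    (hn : m ≠ n) : ev n lam q = 0 := by
  rw [ev_apply, homogeneousComponent_of_mem h, if_neg (Ne.symm hn)]; simp

lemma ev_deg (n : ℕ) (lam : ι → ℝ) : DegP (ev n lam) n :=
  fun _ _ h hn => ev_hom_ne lam h hn

lemma hom_ext {L L' : MvPolynomial ι ℝ →ₗ[ℝ] ℝ} 
    (h : ∀ n q, IsHomogeneous q n → L q = L' q) (q : MvPolynomial ι ℝ) : L q = L' q := by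
  rw [← sum_homogeneousComponent q, map_sum, map_sum]
  exact Finset.sum_congr rfl fun i _ => h i _ (homogeneousComponent_isHomogeneous i q)

lemma ev_mul {m : ℕ} (n : ℕ) (lam : ι → ℝ) {q : MvPolynomial ι ℝ} (h : q.IsHomogeneous m)
    (g : MvPolynomial ι ℝ) : ev (m + n) lam (q * g) = eval lam q * ev n lam g := by
  have := hom_ext (L := (ev (m+n) lam).comp (LinearMap.mulLeft ℝ q))
    (L' := eval lam q • ev n lam) (by
      intro k g hg
      simp only [LinearMap.comp_apply, LinearMap.mulLeft_apply, LinearMap.smul_apply, smul_eq_mul]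
      by_cases hk : k = n
      · subst hk
        rw [ev_hom lam (h.mul hg), ev_hom lam hg, map_mul]
      · rw [ev_hom_ne lam (h.mul hg) (by omega), ev_hom_ne lam hg hk, mul_zero]) g
  simpa using this

lemma ev_mul_lt {m n : ℕ} (lam : ι → ℝ) {q : MvPolynomial ι ℝ} (h : q.IsHomogeneous m)
    (hmn : n < m) (g : MvPolynomial ι ℝ) : ev n lam (q * g) = 0 := by
  have := hom_ext (L := (ev n lam).comp (LinearMap.mulLeft ℝ q))
    (L' := 0) (by
      intro k g hg
      simp only [LinearMap.comp_apply, LinearMap.mulLeft_apply, LinearMap.zero_apply]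
      rw [ev_hom_ne lam (h.mul hg) (by omega)]) g
  simpa using this

lemma DegP.mul {L : MvPolynomial ι ℝ →ₗ[ℝ] ℝ} {d a n : ℕ} (hL : DegP L d) {K : MvPolynomial ι ℝ}
    (hK : K.IsHomogeneous a) (h : a + n = d) : DegP (L.comp (LinearMap.mulLeft ℝ K)) n := by
  intro k q hq hk
  exact hL _ _ (hK.mul hq) (by omega)

lemma eq_ev {lam : ι → ℝ} {j : ι} (hj : lam j ≠ 0) (n : ℕ) :
    ∀ (N : MvPolynomial ι ℝ →ₗ[ℝ] ℝ), DegP N n →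
    (∀ a b q, N (X a * q) * lam b = lam a * N (X b * q)) → 
    ∃ κ, ∀ q, N q = κ * ev n lam q := by
  induction n with
  | zero =>
    intro N hN _
    refine ⟨N 1, fun q => ?_⟩
    have := hom_ext (L := N) (L' := N 1 • ev 0 lam) (by
      intro k q hq
      by_cases hk : k = 0
      · subst hk
        obtain ⟨a, rfl⟩ := hom_zero_eq hq
        rw [LinearMap.smul_apply, ev_hom lam hq, eval_C, smul_eq_mul]
        have : (C a : MvPolynomial ι ℝ) = a • 1 := by rw [smul_eq_C_mul, mul_one]
        rw [this, map_smul, smul_eq_mul, mul_comm]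
      · rw [hN k q hq hk, LinearMap.smul_apply, ev_hom_ne lam hq hk, smul_zero]) q
    simpa using this
  | succ n ih =>
    intro N hN hrel
    have h1 : ∀ a, ∃ κ, ∀ q, N (X a * q) = κ * ev n lam q := by
      intro a
      apply ih (N.comp (LinearMap.mulLeft ℝ (X a)))
      · exact hN.mul (isHomogeneous_X ℝ a) (by omega)
      · intro b e q
        simp only [LinearMap.comp_apply, LinearMap.mulLeft_apply]
        have := hrel b e (X a * q)
        rw [mul_left_comm, this]; congr 2; ring
    choose κ hκ using h1
    refine ⟨κ j / lam j, fun q => ?_⟩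
    have hev : ev n lam (X j ^ n) = lam j ^ n := by
      have : (X j ^ n : MvPolynomial ι ℝ).IsHomogeneous n := by
        simpa using (isHomogeneous_X ℝ j).pow n
      rw [ev_hom lam this]; simp
    have hrel' : ∀ a, κ a = κ j / lam j * lam a := by
      intro a
      have := hrel a j (X j ^ n)
      rw [hκ, hκ, hev] at this
      have hp : lam j ^ n ≠ 0 := pow_ne_zero _ hj
      field_simp
      apply mul_right_cancel₀ hp
      linarith
    have hX : ∀ a q, N (X a * q) = κ j / lam j * ev (n+1) lam (X a * q) := by
      intro a q
      rw [hκ, hrel' a, add_comm n 1, ev_mul n lam (isHomogeneous_X ℝ a)]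
      simp; ring
    induction q using MvPolynomial.induction_on with
    | C b => 
      rw [hN 0 _ (isHomogeneous_C ι b) (by omega),
        ev_hom_ne lam (isHomogeneous_C ι b) (by omega), mul_zero]
    | add p q hp hq => rw [map_add, map_add, hp, hq]; ring
    | mul_X p w _ => rw [mul_comm, hX]

lemma eval_xm (lam : ι → ℝ) (T : Finset ι) : eval lam (xm T) = ∏ i ∈ T, lam i := by
  simp [xm]

lemma eval_lin (lam c : ι → ℝ) : eval lam (lin c) = ∑ i, lam i * c i := by
  simp [lin, smul_eval, mul_comm]

lemma cont_L (L : MvPolynomial ι ℝ →ₗ[ℝ] ℝ) (c η : ι → ℝ) (k : ℕ) : ∀ K,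
    Continuous fun s : ℝ => L (lin (c + s • η) ^ k * K) := by
  induction k with
  | zero => intro K; simp; exact continuous_const
  | succ k ih =>
    intro K
    have : ∀ s : ℝ, L (lin (c + s • η) ^ (k+1) * K) =
        ∑ i, (c i + s * η i) * L (lin (c + s • η) ^ k * (X i * K)) := by
      intro s
      have e : lin (c + s • η) ^ (k+1) * K = lin (c + s • η) * (lin (c + s • η) ^ k * K) := by ring
      rw [e, L_lin]
      refine Finset.sum_congr rfl fun i _ => ?_
      simp only [Pi.add_apply, Pi.smul_apply, smul_eq_mul]
      congr 2; ring
    simp_rw [this]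
    refine continuous_finsetSum _ fun i _ => Continuous.mul (by fun_prop) (ih _)

lemma xm_union (S T : Finset ι) : xm T * xm (S \ T) = xm S * xm (T \ S) := by
  have h1 : xm T * xm (S \ T) = xm (T ∪ S) := by
    rw [xm, xm, xm, ← Finset.prod_union Finset.disjoint_sdiff, Finset.union_sdiff_self_eq_union]
  have h2 : xm S * xm (T \ S) = xm (T ∪ S) := by
    rw [xm, xm, xm, ← Finset.prod_union Finset.disjoint_sdiff, Finset.union_sdiff_self_eq_union,
      Finset.union_comm]
  rw [h1, h2]

end Ev
end JKM

namespace JKM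
open Module

section Wall
variable {ι : Type} [Fintype ι] [DecidableEq ι]
variable {E : Type} [AddCommGroup E] [Module ℝ E] [FiniteDimensional ℝ E]

structure Side (V : ι → Dual ℝ E) (c₀ η : ι → ℝ) (L : MvPolynomial ι ℝ →ₗ[ℝ] ℝ) (lam : ι → ℝ)
    (A B : Finset ι) (κ : ℝ) : Prop where
  vol : ∀ᶠ s : ℝ in nhdsWithin 0 (Set.Ioi 0), IsVol V (c₀ + s • η) L
  disj : Disjoint A B
  card : A.card + B.card = finrank ℝ E + 1
  posA : ∀ i ∈ A, 0 < lam i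
  negB : ∀ i ∈ B, lam i < 0
  zero : ∀ i, i ∉ A → i ∉ B → lam i = 0
  LB : ∀ q, L (xm B * q) = 0
  LA : ∀ q, L (xm A * q) = κ * ev (finrank ℝ E) lam (xm A * q)
  sgn : 0 < (-1) ^ (B.card + 1) * κ
  c0 : ∑ i, lam i * c₀ i = 0
  eta : ∑ i, lam i * η i < 0
  nondeg : ∀ T : Finset ι, (∀ q, L (xm T * q) = 0) ∨ A ⊆ T ∨ (LinearIndepOn ℝ V (T : Set ι) ∧
    ∃ x, (∀ i ∈ T, V i x = c₀ i) ∧ ∀ i ∉ T, V i x < c₀ i)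

variable {V : ι → Dual ℝ E} {c₀ η : ι → ℝ} {L : MvPolynomial ι ℝ →ₗ[ℝ] ℝ} {lam : ι → ℝ}
    {A B : Finset ι} {κ : ℝ}

namespace Side
variable (H : Side V c₀ η L lam A B κ)
include H

lemma deg : DegP L (finrank ℝ E) := by
  obtain ⟨s, hs⟩ := H.vol.exists
  exact hs.deg

lemma theta : ∀ u q, L (lin (fun i => V i u) * q) = 0 := by
  obtain ⟨s, hs⟩ := H.vol.exists
  exact hs.theta

lemma ne_zero {i : ι} (h : i ∈ A ∪ B) : lam i ≠ 0 := by
  rcases Finset.mem_union.1 h with h | h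
  · exact (H.posA i h).ne'
  · exact (H.negB i h).ne

lemma exists_ne : ∃ j, lam j ≠ 0 := by
  have : (A ∪ B).Nonempty := by
    rw [← Finset.card_pos, Finset.card_union_of_disjoint H.disj, H.card]; omega
  obtain ⟨j, hj⟩ := this
  exact ⟨j, H.ne_zero hj⟩

lemma exists_z {S : Finset ι} (hS : S ⊆ A ∪ B) {m : ℕ} (hm : S.card ≤ m) :
    ∃ g : MvPolynomial ι ℝ, (xm S * g).IsHomogeneous m ∧ eval lam (xm S * g) ≠ 0 := by
  obtain ⟨j, hj⟩ := H.exists_ne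
  refine ⟨X j ^ (m - S.card), ?_, ?_⟩
  · have := (xm_hom S).mul ((isHomogeneous_X ℝ j).pow (m - S.card))
    have e : S.card + 1 * (m - S.card) = m := by omega
    rwa [e] at this
  · rw [map_mul, eval_xm, map_pow, eval_X]
    refine mul_ne_zero (Finset.prod_ne_zero_iff.2 fun i hi => H.ne_zero (hS hi)) (pow_ne_zero _ hj)

lemma sub_of_ne {T : Finset ι} (h : eval lam (xm T) ≠ 0) : T ⊆ A ∪ B := by
  intro i hi
  rw [eval_xm] at h
  by_contra hn
  rw [Finset.mem_union, not_or] at hn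
  exact Finset.prod_ne_zero_iff.1 h i hi (H.zero i hn.1 hn.2)

lemma LTA (T : Finset ι) (g : MvPolynomial ι ℝ) : L (xm T * (xm (A \ T) * g)) =
    κ * ev (finrank ℝ E) lam (xm T * (xm (A \ T) * g)) := by
  rw [← mul_assoc, xm_union, mul_assoc, H.LA]

lemma LTB (T : Finset ι) (g : MvPolynomial ι ℝ) : L (xm T * (xm (B \ T) * g)) = 0 := by
  rw [← mul_assoc, xm_union, mul_assoc, H.LB]

lemma LTz {T : Finset ι} {m n : ℕ} {g₀ : MvPolynomial ι ℝ} (h : (xm (A \ T) * g₀).IsHomogeneous m)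
    (hn : T.card + m + n = finrank ℝ E) (g : MvPolynomial ι ℝ) :
    L (xm T * (xm (A \ T) * g₀) * g) =
      κ * eval lam (xm T) * eval lam (xm (A \ T) * g₀) * ev n lam g := by
  have e : xm T * (xm (A \ T) * g₀) * g = xm T * (xm (A \ T) * (g₀ * g)) := by ring
  rw [e, H.LTA]
  have e : xm T * (xm (A \ T) * (g₀ * g)) = (xm T * (xm (A \ T) * g₀)) * g := by ring
  rw [e, ← hn, ev_mul n lam ((xm_hom T).mul h)]
  rw [map_mul]; ring

lemma LTA_sub {T : Finset ι} (hT : A ⊆ T) {n : ℕ} (hn : T.card + n = finrank ℝ E)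
    (g : MvPolynomial ι ℝ) : L (xm T * g) = κ * eval lam (xm T) * ev n lam g := by
  have := H.LTA T g
  have e : A \ T = ∅ := Finset.sdiff_eq_empty_iff_subset.2 hT
  have e2 : xm (∅ : Finset ι) = 1 := by simp [xm]
  rw [e, e2, one_mul, ← hn, ev_mul n lam (xm_hom T)] at this
  rw [this]; ring

lemma card_T {T : Finset ι} (h : eval lam (xm T) ≠ 0) :
    (A \ T).card + (B \ T).card + T.card = finrank ℝ E + 1 := by
  have hT := H.sub_of_ne h
  have h1 : (A \ T) ∪ (B \ T) = (A ∪ B) \ T := (Finset.union_sdiff_distrib A B T).symm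
  have h2 : Disjoint (A \ T) (B \ T) :=
    Finset.disjoint_of_subset_left Finset.sdiff_subset
      (Finset.disjoint_of_subset_right Finset.sdiff_subset H.disj)
  rw [← Finset.card_union_of_disjoint h2, h1, Finset.card_sdiff_of_subset hT,
    Finset.card_union_of_disjoint H.disj, H.card]
  have := Finset.card_le_card hT
  rw [Finset.card_union_of_disjoint H.disj, H.card] at this
  omega

lemma lin_c0 : eval lam (lin c₀) = 0 := by rw [eval_lin, H.c0]

lemma lin_cs {s : ℝ} (hs : 0 < s) : eval lam (lin (c₀ + s • η)) < 0 := by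
  rw [eval_lin]
  have : ∑ i, lam i * (c₀ + s • η) i = s * ∑ i, lam i * η i := by
    simp only [Pi.add_apply, Pi.smul_apply, smul_eq_mul, mul_add, Finset.sum_add_distrib, H.c0,
      zero_add, Finset.mul_sum]
    refine Finset.sum_congr rfl fun i _ => by ring
  rw [this]
  exact mul_neg_of_pos_of_neg hs H.eta

/-- sign of `κ λ_T` -/
lemma sign_T {T : Finset ι} (h : eval lam (xm T) ≠ 0) :
    0 < (-1) ^ ((B \ T).card + 1) * (κ * eval lam (xm T)) := by
  have hT := H.sub_of_ne h
  have e : eval lam (xm T) = (∏ i ∈ T ∩ A, lam i) * ∏ i ∈ T ∩ B, lam i := by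
    rw [eval_xm, ← Finset.prod_union]
    · congr 1
      rw [← Finset.inter_union_distrib_left, Finset.inter_eq_left.2 hT]
    · exact Finset.disjoint_of_subset_left Finset.inter_subset_right
        (Finset.disjoint_of_subset_right Finset.inter_subset_right H.disj)
  have e1 : 0 < ∏ i ∈ T ∩ A, lam i :=
    Finset.prod_pos fun i hi => H.posA i (Finset.mem_inter.1 hi).2
  have e2 : 0 < (-1) ^ (T ∩ B).card * ∏ i ∈ T ∩ B, lam i := by
    rw [← Finset.prod_const, ← Finset.prod_mul_distrib]
    exact Finset.prod_pos fun i hi => by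
      have := H.negB i (Finset.mem_inter.1 hi).2
      linarith
  have e3 : (B \ T).card + (T ∩ B).card = B.card := by
    rw [Finset.inter_comm]; exact Finset.card_sdiff_add_card_inter B T
  have := mul_pos (mul_pos H.sgn e2) e1
  have e4 : ((-1 : ℝ)) ^ (B.card + 1) * (-1) ^ (T ∩ B).card = (-1) ^ ((B \ T).card + 1) := by
    rw [← e3, ← pow_add]
    have : (B \ T).card + (T ∩ B).card + 1 + (T ∩ B).card =
      (B \ T).card + 1 + 2 * (T ∩ B).card := by ring
    rw [this, pow_add, pow_mul]; simp
  rw [e, ← e4]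
  calc 0 < _ := this
    _ = _ := by ring

end Side

def WHL (d : ℕ) (c : ι → ℝ) (L : MvPolynomial ι ℝ →ₗ[ℝ] ℝ) (lam : ι → ℝ) (T : Finset ι) : Prop :=
  ∀ m k, 2 * m + k + T.card = d → ∀ q : MvPolynomial ι ℝ, q.IsHomogeneous m →
    (∀ g, L (xm T * lin c ^ k * q * g) = 0) →
    ∃ α, ∀ g, L (xm T * q * g) = α * eval lam (xm T) * ev (m+k) lam g

def WHR (d : ℕ) (c : ι → ℝ) (L : MvPolynomial ι ℝ →ₗ[ℝ] ℝ) (lam : ι → ℝ) (A T : Finset ι) : Prop :=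
  ∀ m k, 2 * m + k + T.card = d → ∀ q : MvPolynomial ι ℝ, q.IsHomogeneous m →
    (eval lam (xm T) = 0 ∨ eval lam q = 0 ∨ m ≤ (A \ T).card) →
    (∀ g, L (xm T * lin c ^ (k+1) * q * g) = 0) →
    0 ≤ (-1) ^ m * L (xm T * lin c ^ k * (q * q)) ∧
    (L (xm T * lin c ^ k * (q * q)) = 0 →
      ∃ α, ∀ g, L (xm T * q * g) = α * eval lam (xm T) * ev (m+k) lam g)

lemma WHL_core (H : Side V c₀ η L lam A B κ) (T : Finset ι)
    (hli : LinearIndepOn ℝ V (T : Set ι))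
    (x : E) (hx1 : ∀ i ∈ T, V i x = c₀ i) (hx2 : ∀ i ∉ T, V i x < c₀ i)
    (h : ∀ w ∉ T, WHR (finrank ℝ E) c₀ L lam A (insert w T))
    (m k : ℕ) (hmk : 2 * m + (k+1) + T.card = finrank ℝ E) (q : MvPolynomial ι ℝ)
    (hq : q.IsHomogeneous m) (hcond : eval lam (xm T) = 0 ∨ eval lam q = 0 ∨ m < (A \ T).card)
    (h0 : ∀ g, L (xm T * lin c₀ ^ (k+1) * q * g) = 0) :
    ∃ α, ∀ g, L (xm T * q * g) = α * eval lam (xm T) * ev (m+(k+1)) lam g := by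
  have hsign : ∀ w ∉ T, 0 ≤ (-1) ^ m * L (X w * (xm T * lin c₀ ^ k * (q * q))) ∧
      (L (X w * (xm T * lin c₀ ^ k * (q * q))) = 0 → ∃ α, ∀ g, L (X w * (xm T * q * g)) =
        α * eval lam (xm T) * lam w * ev (m+k) lam g) := by
    intro w hw
    have := h w hw m k (by rw [Finset.card_insert_of_notMem hw]; omega) q hq (by
      rcases hcond with h | h | h
      · left; rw [xm_insert hw, map_mul, h, mul_zero]
      · right; left; exact h
      · right; right
        have e : (A \ T) ⊆ insert w (A \ insert w T) := by
          intro i; simp only [Finset.mem_sdiff, Finset.mem_insert]; tauto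
        have := (Finset.card_le_card e).trans (Finset.card_insert_le _ _)
        omega) (by
      intro g
      have := h0 (X w * g)
      rw [← this, xm_insert hw]; congr 1; ring)
    rw [xm_insert hw] at this
    refine ⟨by simpa only [mul_assoc] using this.1, fun hz => ?_⟩
    obtain ⟨α, hα⟩ := this.2 (by simpa only [mul_assoc] using hz)
    refine ⟨α, fun g => ?_⟩
    have := hα g
    rw [show eval lam (X w * xm T) = lam w * eval lam (xm T) by rw [map_mul, eval_X]] at this
    rw [show X w * (xm T * q * g) = X w * xm T * q * g by ring, this]; ring
  have hsum : ∑ i, (c₀ i - V i x) * ((-1) ^ m * L (X i * (xm T * lin c₀ ^ k * (q * q)))) = 0 := by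
    have h1 := h0 q
    have e : xm T * lin c₀ ^ (k+1) * q * q = lin c₀ * (xm T * lin c₀ ^ k * (q * q)) := by ring
    rw [e, L_lin_point H.theta c₀ x] at h1
    have : ∀ i, (c₀ i - V i x) * ((-1) ^ m * L (X i * (xm T * lin c₀ ^ k * (q * q)))) =
      (-1) ^ m * ((c₀ i - V i x) * L (X i * (xm T * lin c₀ ^ k * (q * q)))) := by intro i; ring
    simp_rw [this]
    rw [← Finset.mul_sum, h1, mul_zero]
  have hc0 : ∀ i ∈ T, c₀ i - V i x = 0 := by
    intro i hi; rw [hx1 i hi]; simp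
  have hcpos : ∀ i ∉ T, 0 < c₀ i - V i x := by
    intro i hi; have := hx2 i hi; linarith
  have hz := (Finset.sum_eq_zero_iff_of_nonneg (by
    intro i _
    by_cases hi : i ∈ T
    · rw [hc0 i hi]; simp
    · exact mul_nonneg (hcpos i hi).le (hsign i hi).1)).1 hsum
  have hzero : ∀ w ∉ T, L (X w * (xm T * lin c₀ ^ k * (q * q))) = 0 := by
    intro w hw
    have := hz w (Finset.mem_univ _)
    rcases mul_eq_zero.1 this with h | h
    · exact absurd h (hcpos w hw).ne'
    · rcases mul_eq_zero.1 h with h | h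
      · exact absurd h (pow_ne_zero _ (by norm_num))
      · exact h
  have hform : ∀ w, ∃ α, w ∉ T → ∀ g, L (X w * (xm T * q * g)) =
        α * eval lam (xm T) * lam w * ev (m+k) lam g := by
    intro w
    by_cases hw : w ∈ T
    · exact ⟨0, fun h => absurd hw h⟩
    · obtain ⟨α, hα⟩ := (hsign w hw).2 (hzero w hw)
      exact ⟨α, fun _ => hα⟩
  choose α hα using hform
  by_cases hlT : eval lam (xm T) = 0
  · refine ⟨0, fun g => ?_⟩
    rw [zero_mul, zero_mul]
    refine zero_of_X H.deg ((xm_hom T).mul hq) (by omega) (fun w g => ?_) g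
    refine X_reduce H.theta hli _ (fun w hw => ?_) w
    rw [hα w hw, hlT]; ring
  -- all w
  have hβ : ∀ w, ∃ β, ∀ g, L (X w * (xm T * q * g)) = β * ev (m+k) lam g := by
    intro w
    by_cases hw : w ∈ T
    · obtain ⟨u, hu⟩ := exists_sol hli (fun i => if i = w then 1 else 0)
      refine ⟨- ∑ i ∈ Tᶜ, V i u * (α i * eval lam (xm T) * lam i), fun g => ?_⟩
      have := H.theta u (xm T * q * g)
      rw [L_lin, ← Finset.sum_add_sum_compl T, Finset.sum_eq_single w] at this
      · rw [hu w hw] at this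
        simp only [if_true, one_mul] at this
        rw [eq_neg_of_add_eq_zero_left this, neg_mul, Finset.sum_mul]
        congr 1
        refine Finset.sum_congr rfl fun i hi => ?_
        rw [hα i (Finset.mem_compl.1 hi)]; ring
      · intro i hi hiw; rw [hu i hi]; simp [hiw]
      · intro h; exact absurd hw h
    · exact ⟨_, hα w hw⟩
  choose β hβ using hβ
  rcases Nat.eq_zero_or_pos (m + k) with hmk0 | hmk0
  · -- m = k = 0
    have hm : m = 0 := by omega
    have hk : k = 0 := by omega
    subst hm; subst hk
    obtain ⟨a, rfl⟩ := hom_zero_eq hq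
    refine ⟨0, fun g => ?_⟩
    rw [zero_mul, zero_mul]
    by_cases ha : a = 0
    · subst ha; simp
    refine zero_of_X H.deg ((xm_hom T).mul hq) (by omega) (fun w g => ?_) g
    refine X_reduce H.theta hli _ (fun w hw => ?_) w
    have e1 := hβ w (C a)
    have e2 := hzero w hw
    have e3 : X w * (xm T * lin c₀ ^ 0 * (C a * C a)) = X w * (xm T * C a * C a) := by ring
    rw [e3, e1, ev_hom lam (isHomogeneous_C ι a), eval_C] at e2
    rcases mul_eq_zero.1 e2 with h | h
    · rw [hβ, h, zero_mul]
    · exact absurd h ha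
  · obtain ⟨j, hj⟩ := H.exists_ne
    obtain ⟨n, hn⟩ : ∃ n, m + k = n + 1 := ⟨m + k - 1, by omega⟩
    have hevX : ∀ v, ev (m+k) lam (X v * X j ^ n) = lam v * lam j ^ n := by
      intro v
      have : (X j ^ n : MvPolynomial ι ℝ).IsHomogeneous n := by
        simpa using (isHomogeneous_X ℝ j).pow n
      rw [hn, add_comm n 1, ev_mul n lam (isHomogeneous_X ℝ v), ev_hom lam this]; simp
    have hcomm : ∀ w v, β w * lam v = β v * lam w := by
      intro w v
      have e1 := hβ w (X v * X j ^ n)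
      have e2 := hβ v (X w * X j ^ n)
      have e3 : X w * (xm T * q * (X v * X j ^ n)) = X v * (xm T * q * (X w * X j ^ n)) := by ring
      rw [e3, e2, hevX, hevX] at e1
      have hp : lam j ^ n ≠ 0 := pow_ne_zero _ hj
      apply mul_right_cancel₀ hp
      linarith
    obtain ⟨κ', hκ'⟩ := eq_ev hj (m + (k+1)) (L.comp (LinearMap.mulLeft ℝ (xm T * q)))
      (H.deg.mul ((xm_hom T).mul hq) (by omega)) (by
        intro a b g
        simp only [LinearMap.comp_apply, LinearMap.mulLeft_apply]
        rw [show xm T * q * (X a * g) = X a * (xm T * q * g) by ring,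
          show xm T * q * (X b * g) = X b * (xm T * q * g) by ring, hβ, hβ]
        linear_combination (ev (m+k) lam g) * hcomm a b)
    refine ⟨κ' / eval lam (xm T), fun g => ?_⟩
    have := hκ' g
    simp only [LinearMap.comp_apply, LinearMap.mulLeft_apply] at this
    rw [this, div_mul_cancel₀ _ hlT]

lemma WHL_of_WHR (H : Side V c₀ η L lam A B κ) (T : Finset ι)
    (h : ∀ w ∉ T, WHR (finrank ℝ E) c₀ L lam A (insert w T)) :
    WHL (finrank ℝ E) c₀ L lam T := by
  intro m k hmk q hq h0
  rcases k with _ | k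
  · refine ⟨0, fun g => ?_⟩
    have := h0 g
    simp only [pow_zero, mul_one] at this
    rw [this]; simp
  rcases H.nondeg T with hT | hT | ⟨hli, x, hx1, hx2⟩
  · exact ⟨0, fun g => by rw [mul_assoc, hT]; simp⟩
  · refine ⟨κ * eval lam q, fun g => ?_⟩
    rw [mul_assoc, H.LTA_sub hT (n := m + (m + (k+1))) (by omega), ev_mul _ lam hq]; ring
  by_cases hcond : eval lam (xm T) = 0 ∨ eval lam q = 0 ∨ m < (A \ T).card
  · exact WHL_core H T hli x hx1 hx2 h m k hmk q hq hcond h0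
  push Not at hcond
  obtain ⟨g₀, hz, hz0⟩ := H.exists_z (S := A \ T)
    (Finset.sdiff_subset.trans Finset.subset_union_left) hcond.2.2
  have hLz := fun g => H.LTz hz (n := m + (k+1)) (by omega) g
  set z := xm (A \ T) * g₀ with hzdef
  set a := eval lam q / eval lam z with ha
  have hsub : (q - a • z).IsHomogeneous m := by
    refine hq.sub ?_
    exact (homogeneousSubmodule ι ℝ m).smul_mem a hz
  obtain ⟨α, hα⟩ := WHL_core H T hli x hx1 hx2 h m k hmk (q - a • z) hsub (by
      right; left
      rw [map_sub, smul_eval, ha, div_mul_cancel₀ _ hz0, sub_self]) (by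
      intro g
      have e : xm T * lin c₀ ^ (k+1) * (q - a • z) * g =
        xm T * lin c₀ ^ (k+1) * q * g - a • (xm T * z * (lin c₀ ^ (k+1) * g)) := by
        rw [smul_eq_C_mul, smul_eq_C_mul]; ring
      rw [e, map_sub, h0, map_smul, hLz]
      have h1 : (lin c₀ ^ (k+1)).IsHomogeneous (k+1) := by simpa using (lin_hom c₀).pow (k+1)
      rw [add_comm m (k+1), ev_mul m lam h1, map_pow, H.lin_c0]
      simp)
  refine ⟨α + a * κ * eval lam z, fun g => ?_⟩
  have e : xm T * q * g = xm T * (q - a • z) * g + a • (xm T * z * g) := by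
    rw [smul_eq_C_mul, smul_eq_C_mul]; ring
  rw [e, map_add, hα, map_smul, hLz, smul_eq_mul]; ring

lemma alpha_zero (H : Side V c₀ η L lam A B κ) (T : Finset ι) (m k : ℕ)
    (hmk : 2 * m + k + T.card = finrank ℝ E) (q : MvPolynomial ι ℝ) (hq : q.IsHomogeneous m)
    (α : ℝ) (hα : ∀ g, L (xm T * q * g) = α * eval lam (xm T) * ev (m+k) lam g)
    (hcond : eval lam (xm T) = 0 ∨ eval lam q = 0 ∨ m < (A \ T).card) (g : MvPolynomial ι ℝ) :
    L (xm T * q * g) = 0 := by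
  by_cases hT : eval lam (xm T) = 0
  · rw [hα, hT]; ring
  have hα0 : α = 0 := by
    by_cases hb : m < (A \ T).card
    · have hc := H.card_T hT
      obtain ⟨g₀, hz, hz0⟩ := H.exists_z (S := B \ T)
        (Finset.sdiff_subset.trans Finset.subset_union_right) (m := m + k) (by omega)
      have e1 := hα (xm (B \ T) * g₀)
      rw [show xm T * q * (xm (B \ T) * g₀) = xm T * (xm (B \ T) * (g₀ * q)) by ring, H.LTB,
        ev_hom lam hz] at e1
      have := mul_eq_zero.1 e1.symm
      rcases this with h | h
      · exact (mul_eq_zero.1 h).resolve_right hT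
      · exact absurd h hz0
    · have hq0 : eval lam q = 0 := by tauto
      obtain ⟨g₀, hz, hz0⟩ := H.exists_z (S := A \ T)
        (Finset.sdiff_subset.trans Finset.subset_union_left) (m := m + k) (by omega)
      have e1 := hα (xm (A \ T) * g₀)
      rw [show xm T * q * (xm (A \ T) * g₀) = xm T * (xm (A \ T) * g₀) * q by ring,
        H.LTz hz (n := m) (by omega), ev_hom lam hz, ev_hom lam hq, hq0] at e1
      have := mul_eq_zero.1 (e1.symm.trans (mul_zero _))
      rcases this with h | h
      · exact (mul_eq_zero.1 h).resolve_right hT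
      · exact absurd h hz0
  rw [hα, hα0]; ring

end Wall
end JKM

namespace JKM
open Module

section Wall2
variable {ι : Type} [Fintype ι] [DecidableEq ι]
variable {E : Type} [AddCommGroup E] [Module ℝ E] [FiniteDimensional ℝ E]

def Cnd (lam : ι → ℝ) (A B T : Finset ι) (m : ℕ) : Prop :=
  eval lam (xm T) ≠ 0 ∧ ((A \ T).card ≤ m ∨ (B \ T).card ≤ m)

def UU (lam : ι → ℝ) (A B T : Finset ι) (m : ℕ) : Submodule ℝ (MvPolynomial ι ℝ) where
  carrier := {q | q.IsHomogeneous m ∧ (Cnd lam A B T m → eval lam q = 0)}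
  zero_mem' := ⟨isHomogeneous_zero _ _ _, fun _ => map_zero _⟩
  add_mem' := fun {a b} ha hb => ⟨ha.1.add hb.1, fun h => by rw [map_add, ha.2 h, hb.2 h, add_zero]⟩
  smul_mem' := fun r a ha => ⟨(homogeneousSubmodule ι ℝ m).smul_mem r ha.1,
    fun h => by rw [smul_eval, ha.2 h, mul_zero]⟩

lemma mem_UU {lam : ι → ℝ} {A B T : Finset ι} {m : ℕ} {q : MvPolynomial ι ℝ} :
    q ∈ UU lam A B T m ↔ q.IsHomogeneous m ∧ (Cnd lam A B T m → eval lam q = 0) := Iff.rfl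

lemma UU_le (lam : ι → ℝ) (A B T : Finset ι) (m : ℕ) : UU lam A B T m ≤ Em ι m :=
  fun _ h => h.1

instance (lam : ι → ℝ) (A B T : Finset ι) (m : ℕ) : FiniteDimensional ℝ (UU lam A B T m) :=
  Submodule.finiteDimensional_of_le (UU_le lam A B T m)

variable {V : ι → Dual ℝ E} {c₀ η : ι → ℝ} {L : MvPolynomial ι ℝ →ₗ[ℝ] ℝ} {lam : ι → ℝ}
    {A B : Finset ι} {κ : ℝ}

lemma pow_lin_hom (c : ι → ℝ) (k : ℕ) : (lin c ^ k).IsHomogeneous k := by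
  simpa using (lin_hom c).pow k

/-- the vector used to split off a line -/
lemma exists_zA (H : Side V c₀ η L lam A B κ) {T : Finset ι} {m k : ℕ}
    (hmk : 2 * m + k + T.card = finrank ℝ E) (ha : (A \ T).card ≤ m) :
    ∃ z : MvPolynomial ι ℝ, z.IsHomogeneous m ∧ eval lam z ≠ 0 ∧
      (∀ g, L (xm T * z * g) = κ * eval lam (xm T) * eval lam z * ev (m+k) lam g) ∧
      (∀ c g, L (xm T * lin c ^ k * (z * g)) =
        κ * eval lam (xm T) * eval lam z * (eval lam (lin c) ^ k * ev m lam g)) := by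
  obtain ⟨g₀, hz, hz0⟩ := H.exists_z (S := A \ T)
    (Finset.sdiff_subset.trans Finset.subset_union_left) ha
  have hLz := fun g => H.LTz hz (n := m + k) (by omega) g
  refine ⟨_, hz, hz0, hLz, fun c g => ?_⟩
  rw [show xm T * lin c ^ k * (xm (A \ T) * g₀ * g) = xm T * (xm (A \ T) * g₀) * (lin c ^ k * g)
    by ring, hLz, add_comm m k, ev_mul m lam (pow_lin_hom c k), map_pow]

lemma exists_zB (H : Side V c₀ η L lam A B κ) {T : Finset ι} {m : ℕ} (hb : (B \ T).card ≤ m) :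
    ∃ z : MvPolynomial ι ℝ, z.IsHomogeneous m ∧ eval lam z ≠ 0 ∧
      (∀ g, L (xm T * z * g) = 0) := by
  obtain ⟨g₀, hz, hz0⟩ := H.exists_z (S := B \ T)
    (Finset.sdiff_subset.trans Finset.subset_union_right) hb
  refine ⟨_, hz, hz0, fun g => ?_⟩
  rw [show xm T * (xm (B \ T) * g₀) * g = xm T * (xm (B \ T) * (g₀ * g)) by ring, H.LTB]

lemma sub_line {T : Finset ι} {q z : MvPolynomial ι ℝ} {m : ℕ} (hq : q.IsHomogeneous m) (hz : z.IsHomogeneous m)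
    (h0 : eval lam z ≠ 0) : ∃ β : ℝ, ∃ q', q = β • z + q' ∧ q' ∈ UU lam A B T m := by
  refine ⟨eval lam q / eval lam z, q - (eval lam q / eval lam z) • z, by ring, ?_, fun _ => ?_⟩
  · exact hq.sub ((homogeneousSubmodule ι ℝ m).smul_mem _ hz)
  · rw [map_sub, smul_eval, div_mul_cancel₀ _ h0, sub_self]

lemma rad_U (H : Side V c₀ η L lam A B κ) {T : Finset ι} (hW : WHL (finrank ℝ E) c₀ L lam T)
    {m k : ℕ} (hmk : 2 * m + k + T.card = finrank ℝ E) {q : MvPolynomial ι ℝ}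
    (hq : q ∈ UU lam A B T m)
    (h : ∀ g ∈ UU lam A B T m, L (xm T * lin c₀ ^ k * (q * g)) = 0) (g : MvPolynomial ι ℝ) :
    L (xm T * q * g) = 0 := by
  have h1 : ∀ g, IsHomogeneous g m → L (xm T * lin c₀ ^ k * (q * g)) = 0 := by
    intro g hg
    by_cases hC : Cnd lam A B T m
    swap
    · exact h g ⟨hg, fun h => absurd h hC⟩
    rcases hC.2 with ha | hb
    · obtain ⟨z, hz, hz0, hz1, hz2⟩ := exists_zA H hmk ha
      obtain ⟨β, g', rfl, hg'⟩ := sub_line (A := A) (B := B) (T := T) hg hz hz0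
      rw [show xm T * lin c₀ ^ k * (q * (β • z + g')) =
        xm T * lin c₀ ^ k * (q * g') + β • (xm T * lin c₀ ^ k * (z * q)) by
          rw [smul_eq_C_mul, smul_eq_C_mul]; ring, map_add, h g' hg', map_smul, hz2,
          ev_hom lam hq.1, hq.2 hC]
      simp
    · obtain ⟨z, hz, hz0, hz1⟩ := exists_zB H hb
      obtain ⟨β, g', rfl, hg'⟩ := sub_line (A := A) (B := B) (T := T) hg hz hz0
      rw [show xm T * lin c₀ ^ k * (q * (β • z + g')) =
        xm T * lin c₀ ^ k * (q * g') + β • (xm T * z * (lin c₀ ^ k * q)) by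
          rw [smul_eq_C_mul, smul_eq_C_mul]; ring, map_add, h g' hg', map_smul, hz1]
      simp
  have h2 := H.deg.all (K := xm T * lin c₀ ^ k * q) (n := m)
    (((xm_hom T).mul (pow_lin_hom c₀ k)).mul hq.1) (by omega)
    (fun g hg => by rw [mul_assoc]; exact h1 g hg)
  obtain ⟨α, hα⟩ := hW m k hmk q hq.1 h2
  refine alpha_zero H T m k hmk q hq.1 α hα ?_ g
  by_cases hC : Cnd lam A B T m
  · exact Or.inr (Or.inl (hq.2 hC))
  · by_cases hT : eval lam (xm T) = 0
    · exact Or.inl hT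
    · right; right
      by_contra hn
      exact hC ⟨hT, Or.inl (by omega)⟩

open Classical in
noncomputable def corr (lam : ι → ℝ) (A T : Finset ι) (m : ℕ) (ε : ℝ) : ℕ :=
  if eval lam (xm T) ≠ 0 ∧ (A \ T).card ≤ m ∧ ε * (-1) ^ (A \ T).card < 0 then 1 else 0

lemma smul_QF_symm (ε : ℝ) (K : MvPolynomial ι ℝ) (p q : MvPolynomial ι ℝ) :
    (ε • QF L K) p q = (ε • QF L K) q p := by
  rw [LinearMap.smul_apply, LinearMap.smul_apply, LinearMap.smul_apply, LinearMap.smul_apply,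
    QF_symm]

lemma smul_QF_apply (ε : ℝ) (K : MvPolynomial ι ℝ) (p q : MvPolynomial ι ℝ) :
    (ε • QF L K) p q = ε * L (K * (p * q)) := rfl

lemma idx_s (H : Side V c₀ η L lam A B κ) {T : Finset ι}
    {m k : ℕ} (hmk : 2 * m + k + T.card = finrank ℝ E) (ε : ℝ) {s : ℝ} (hs : 0 < s) :
    negIdx (ε • QF L (xm T * lin (c₀ + s • η) ^ k)) (Em ι m) =
      negIdx (ε • QF L (xm T * lin (c₀ + s • η) ^ k)) (UU lam A B T m) + corr lam A T m ε := by
  have hc := H.lin_cs hs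
  set c := c₀ + s • η
  by_cases hC : Cnd lam A B T m
  swap
  · have e : UU lam A B T m = Em ι m := le_antisymm (UU_le _ _ _ _ _)
      fun q hq => ⟨hq, fun h => absurd h hC⟩
    rw [e, corr, if_neg, add_zero]
    exact fun h => hC ⟨h.1, Or.inl h.2.1⟩
  have hcT := H.card_T hC.1
  have hsg := H.sign_T hC.1
  have hsup : ∀ z : MvPolynomial ι ℝ, z.IsHomogeneous m → eval lam z ≠ 0 →
      Em ι m ≤ UU lam A B T m ⊔ Submodule.span ℝ {z} := by
    intro z hz hz0 q hq
    obtain ⟨β, q', rfl, hq'⟩ := sub_line (A := A) (B := B) (T := T) (q := q) hq hz hz0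
    rw [add_comm]
    exact Submodule.add_mem_sup hq' (Submodule.smul_mem _ _ (Submodule.mem_span_singleton_self z))
  by_cases ha : (A \ T).card ≤ m
  · obtain ⟨z, hz, hz0, hz1, hz2⟩ := exists_zA H hmk ha
    have ho : ∀ u ∈ UU lam A B T m, (ε • QF L (xm T * lin c ^ k)) z u = 0 := by
      intro u hu
      rw [smul_QF_apply, hz2, ev_hom lam hu.1, hu.2 hC]; simp
    have hzz : (ε • QF L (xm T * lin c ^ k)) z z = (ε * (-1) ^ (A \ T).card) *
        (((-1) ^ ((B \ T).card + 1) * (κ * eval lam (xm T))) * (eval lam z) ^ 2 *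
          (- eval lam (lin c)) ^ k) := by
      rw [smul_QF_apply, hz2, ev_hom lam hz, neg_pow (eval lam (lin c)) k]
      have e : ((-1:ℝ)) ^ (A \ T).card * (-1) ^ ((B \ T).card + 1) * (-1) ^ k = 1 := by
        rw [← pow_add, ← pow_add]
        apply Even.neg_one_pow
        exact ⟨m + k + 1, by omega⟩
      linear_combination (-ε * κ * eval lam (xm T) * eval lam z ^ 2 * eval lam (lin c) ^ k) * e
    have hp : 0 < (((-1) ^ ((B \ T).card + 1) * (κ * eval lam (xm T))) * (eval lam z) ^ 2 *
          (- eval lam (lin c)) ^ k) :=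
      mul_pos (mul_pos hsg (by positivity)) (pow_pos (by linarith) _)
    by_cases hn : ε * (-1) ^ (A \ T).card < 0
    · rw [corr, if_pos ⟨hC.1, ha, hn⟩]
      exact negIdx_add_neg _ (smul_QF_symm ε _) _ _ z (UU_le _ _ _ _ _) hz (hsup z hz hz0) ho
        (by rw [hzz]; exact mul_neg_of_neg_of_pos hn hp)
    · rw [corr, if_neg (fun h => hn h.2.2), add_zero]
      exact negIdx_add_nonneg _ (smul_QF_symm ε _) _ _ z (UU_le _ _ _ _ _) hz (hsup z hz hz0) ho
        (by rw [hzz]; exact mul_nonneg (not_lt.1 hn) hp.le)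
  · obtain ⟨z, hz, hz0, hz1⟩ := exists_zB H (hC.2.resolve_left ha)
    rw [corr, if_neg (fun h => ha h.2.1), add_zero]
    have e : ∀ g, (ε • QF L (xm T * lin c ^ k)) z g = 0 := by
      intro g
      rw [smul_QF_apply, show xm T * lin c ^ k * (z * g) = xm T * z * (lin c ^ k * g) by ring, hz1,
        mul_zero]
    exact negIdx_add_nonneg _ (smul_QF_symm ε _) _ _ z (UU_le _ _ _ _ _) hz (hsup z hz hz0)
      (fun u _ => e u) (e z).ge

lemma idx_ev (H : Side V c₀ η L lam A B κ) {T : Finset ι} (hW : WHL (finrank ℝ E) c₀ L lam T)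
    {m k : ℕ} (hmk : 2 * m + k + T.card = finrank ℝ E) (ε : ℝ) :
    ∀ᶠ s : ℝ in nhdsWithin 0 (Set.Ioi 0),
    negIdx (ε • QF L (xm T * lin (c₀ + s • η) ^ k)) (Em ι m) =
      negIdx (ε • QF L (xm T * lin c₀ ^ k)) (UU lam A B T m) + corr lam A T m ε := by
  have h := negIdx_const (fun s : ℝ => ε • QF L (xm T * lin (c₀ + s • η) ^ k)) (by
    intro x y
    simp only [smul_QF_apply]
    have := cont_L L c₀ η k (xm T * (x * y))
    refine continuous_const.mul (this.congr fun s => ?_)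
    congr 1; ring) (fun s => smul_QF_symm ε _) 0 (UU lam A B T m)
  have h' := h.filter_mono (nhdsWithin_le_nhds (s := Set.Ioi (0:ℝ)))
  filter_upwards [h', self_mem_nhdsWithin] with s hs hs0
  rw [idx_s H hmk ε hs0, hs ?_]
  · simp
  intro x hx h0 y hy
  by_cases hε : ε = 0
  · simp [hε]
  have := rad_U H hW hmk hx (by
    intro g hg
    have := h0 g hg
    simp only [zero_smul, add_zero] at this
    rw [smul_QF_apply] at this
    exact (mul_eq_zero.1 this).resolve_left hε)
  rw [smul_QF_apply, show xm T * lin (c₀ + s • η) ^ k * (x * y) =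
    xm T * x * (lin (c₀ + s • η) ^ k * y) by ring, this, mul_zero]

def PR (d : ℕ) (c : ι → ℝ) (L : MvPolynomial ι ℝ →ₗ[ℝ] ℝ) (lam : ι → ℝ) (A B T : Finset ι) : Prop :=
  ∀ m k, 2 * m + 2 + k + T.card = d →
    negIdx ((-1 : ℝ) ^ (m+1) • QF L (xm T * lin c ^ k)) (UU lam A B T (m+1)) ≤
    negIdx ((-1 : ℝ) ^ (m+1) • QF L (xm T * lin c ^ (k+2))) (UU lam A B T m)

lemma corr_eq (lam : ι → ℝ) (A T : Finset ι) (m : ℕ) :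
    corr lam A T (m+1) ((-1) ^ (m+1)) = corr lam A T m ((-1) ^ (m+1)) := by
  unfold corr
  congr 1
  apply propext
  refine and_congr_right fun _ => ⟨fun h => ⟨?_, h.2⟩, fun h => ⟨by omega, h.2⟩⟩
  by_contra hn
  have e : (A \ T).card = m + 1 := by omega
  have := h.2
  rw [e, ← pow_add, Even.neg_one_pow ⟨m+1, rfl⟩] at this
  linarith

lemma PR_of_HRI (H : Side V c₀ η L lam A B κ) {T : Finset ι} (hW : WHL (finrank ℝ E) c₀ L lam T)
    (h : ∀ᶠ s : ℝ in nhdsWithin 0 (Set.Ioi 0), HRI (finrank ℝ E) (c₀ + s • η) L T) :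
    PR (finrank ℝ E) c₀ L lam A B T := by
  intro m k hmk
  have e1 := idx_ev H hW (m := m+1) (k := k) (by omega) ((-1) ^ (m+1))
  have e2 := idx_ev H hW (m := m) (k := k+2) (by omega) ((-1) ^ (m+1))
  obtain ⟨s, hs, hs1, hs2⟩ := (h.and (e1.and e2)).exists
  have := hs m k hmk
  rw [hs1, hs2, corr_eq] at this
  omega

lemma HRI_of_PR (H : Side V c₀ η L lam A B κ) {T : Finset ι} (hW : WHL (finrank ℝ E) c₀ L lam T)
    (h : PR (finrank ℝ E) c₀ L lam A B T) :
    ∀ᶠ s : ℝ in nhdsWithin 0 (Set.Ioi 0), HRI (finrank ℝ E) (c₀ + s • η) L T := by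
  have : ∀ m ∈ Finset.range (finrank ℝ E + 1), ∀ k ∈ Finset.range (finrank ℝ E + 1),
      ∀ᶠ s : ℝ in nhdsWithin 0 (Set.Ioi 0), 2 * m + 2 + k + T.card = finrank ℝ E →
    negIdx ((-1 : ℝ) ^ (m+1) • QF L (xm T * lin (c₀ + s • η) ^ k)) (Em ι (m+1)) ≤
    negIdx ((-1 : ℝ) ^ (m+1) • QF L (xm T * lin (c₀ + s • η) ^ (k+2))) (Em ι m) := by
    intro m _ k _
    by_cases hmk : 2 * m + 2 + k + T.card = finrank ℝ E
    swap
    · exact Filter.Eventually.of_forall fun s h => absurd h hmk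
    have e1 := idx_ev H hW (m := m+1) (k := k) (by omega) ((-1) ^ (m+1))
    have e2 := idx_ev H hW (m := m) (k := k+2) (by omega) ((-1) ^ (m+1))
    filter_upwards [e1, e2] with s hs1 hs2 _
    rw [hs1, hs2, corr_eq]
    have := h m k hmk
    omega
  have h2 := (Filter.eventually_all_finset _).2 fun m hm => (Filter.eventually_all_finset _).2 (this m hm)
  filter_upwards [h2] with s hs
  intro m k hmk
  exact hs m (Finset.mem_range.2 (by omega)) k (Finset.mem_range.2 (by omega)) hmk

lemma WHR_mem (H : Side V c₀ η L lam A B κ) {T : Finset ι} (hW : WHL (finrank ℝ E) c₀ L lam T)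
    (hP : PR (finrank ℝ E) c₀ L lam A B T) (m k : ℕ) (hmk : 2 * (m+1) + k + T.card = finrank ℝ E)
    (q : MvPolynomial ι ℝ) (hq : q ∈ UU lam A B T (m+1))
    (h0 : ∀ g, L (xm T * lin c₀ ^ (k+1) * q * g) = 0) :
    0 ≤ (-1) ^ (m+1) * L (xm T * lin c₀ ^ k * (q * q)) ∧
    (L (xm T * lin c₀ ^ k * (q * q)) = 0 → ∀ g, L (xm T * q * g) = 0) := by
  have := hrcore ((-1 : ℝ) ^ (m+1) • QF L (xm T * lin c₀ ^ k))
    ((-1 : ℝ) ^ (m+1) • QF L (xm T * lin c₀ ^ (k+2))) (smul_QF_symm _ _) (smul_QF_symm _ _)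
    (UU lam A B T (m+1)) (UU lam A B T m) (LinearMap.mulLeft ℝ (lin c₀))
    (by
      intro x hx
      rw [LinearMap.mulLeft_apply]
      refine ⟨?_, fun _ => by rw [map_mul, H.lin_c0, zero_mul]⟩
      rw [add_comm m 1]
      exact (lin_hom c₀).mul hx.1)
    (by
      intro x hx y hy
      simp only [smul_QF_apply, LinearMap.mulLeft_apply]
      congr 2; ring)
    (hP m k (by omega))
    (by
      intro p hp h g hg
      have := rad_U H hW (m := m) (k := k+2) (by omega) hp (by
        intro g hg
        have := h g hg
        rw [smul_QF_apply] at this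
        exact (mul_eq_zero.1 this).resolve_left (pow_ne_zero _ (by norm_num)))
      rw [smul_QF_apply, LinearMap.mulLeft_apply, show xm T * lin c₀ ^ k * (g * (lin c₀ * p)) =
        xm T * p * (lin c₀ ^ (k+1) * g) by ring, this, mul_zero])
    q hq
    (by
      intro p hp
      rw [smul_QF_apply, LinearMap.mulLeft_apply, show xm T * lin c₀ ^ k * (q * (lin c₀ * p)) =
        xm T * lin c₀ ^ (k+1) * q * p by ring, h0, mul_zero])
  simp only [smul_QF_apply] at this
  refine ⟨this.1, fun hz => rad_U H hW hmk hq fun g hg => ?_⟩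
  exact (mul_eq_zero.1 (this.2 (by rw [hz, mul_zero]) g hg)).resolve_left
    (pow_ne_zero _ (by norm_num))

lemma WHR_of_PR (H : Side V c₀ η L lam A B κ) {T : Finset ι} (hW : WHL (finrank ℝ E) c₀ L lam T)
    (hP : PR (finrank ℝ E) c₀ L lam A B T) : WHR (finrank ℝ E) c₀ L lam A T := by
  intro m k hmk q hq hcond h0
  rcases m with _ | m
  · obtain ⟨a, rfl⟩ := hom_zero_eq hq
    have e : ∀ b, L (xm T * lin c₀ ^ k * (C a * C b)) = a * b * L (xm T * lin c₀ ^ k) := by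
      intro b
      rw [← C_mul, mul_comm _ (C (a * b)), ← smul_eq_C_mul, map_smul, smul_eq_mul]
    have hnn : 0 ≤ L (xm T * lin c₀ ^ k) := by
      have hc : Continuous fun s : ℝ => L (xm T * lin (c₀ + s • η) ^ k) :=
        (cont_L L c₀ η k (xm T)).congr fun s => by rw [mul_comm]
      have ht := (hc.tendsto 0).mono_left (nhdsWithin_le_nhds (s := Set.Ioi (0:ℝ)))
      simp only [zero_smul, add_zero] at ht
      refine ge_of_tendsto ht ?_
      filter_upwards [H.vol] with s hs
      exact L_pow_nonneg hs k T (by omega)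
    refine ⟨by rw [e]; nlinarith [mul_self_nonneg a, mul_nonneg (mul_self_nonneg a) hnn],
      fun hz => ?_⟩
    refine hW 0 k hmk _ hq ?_
    refine H.deg.all (n := 0) (((xm_hom T).mul (pow_lin_hom c₀ k)).mul hq) (by omega) ?_
    intro g hg
    obtain ⟨b, rfl⟩ := hom_zero_eq hg
    rw [mul_assoc, e]
    rw [e] at hz
    rcases mul_eq_zero.1 hz with h | h
    · rw [mul_self_eq_zero.1 h]; ring
    · rw [h, mul_zero]
  by_cases hU : q ∈ UU lam A B T (m+1)
  · obtain ⟨h1, h2⟩ := WHR_mem H hW hP m k hmk q hU h0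
    refine ⟨h1, fun hz => ⟨0, fun g => ?_⟩⟩
    rw [h2 hz]; simp
  have hC : Cnd lam A B T (m+1) ∧ eval lam q ≠ 0 := by
    by_contra hn
    exact hU ⟨hq, fun h => by by_contra h'; exact hn ⟨h, h'⟩⟩
  have ha : m + 1 ≤ (A \ T).card := by
    rcases hcond with h | h | h
    · exact absurd h hC.1.1
    · exact absurd h hC.2
    · exact h
  by_cases hb : (B \ T).card ≤ m+1
  · obtain ⟨z, hz, hz0, hz1⟩ := exists_zB H hb
    obtain ⟨β, q', rfl, hq'⟩ := sub_line (A := A) (B := B) (T := T) hq hz hz0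
    have hz2 : ∀ K, L (xm T * (β • z + q') * K) = L (xm T * q' * K) := by
      intro K
      rw [show xm T * (β • z + q') * K = xm T * q' * K + β • (xm T * z * K) by
        rw [smul_eq_C_mul, smul_eq_C_mul]; ring, map_add, map_smul, hz1]
      simp
    have hqq : L (xm T * lin c₀ ^ k * ((β • z + q') * (β • z + q'))) =
        L (xm T * lin c₀ ^ k * (q' * q')) := by
      rw [show xm T * lin c₀ ^ k * ((β • z + q') * (β • z + q')) =
        xm T * (β • z + q') * (lin c₀ ^ k * (β • z + q')) by ring, hz2,
        show xm T * q' * (lin c₀ ^ k * (β • z + q')) = xm T * (β • z + q') * (lin c₀ ^ k * q')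
          by ring, hz2]
      congr 1; ring
    obtain ⟨h1, h2⟩ := WHR_mem H hW hP m k hmk q' hq' (by
      intro g
      have := h0 g
      rw [show xm T * lin c₀ ^ (k+1) * (β • z + q') * g = xm T * (β • z + q') * (lin c₀ ^ (k+1) * g)
        by ring, hz2] at this
      rw [← this]; congr 1; ring)
    rw [hqq]
    refine ⟨h1, fun hz => ⟨0, fun g => ?_⟩⟩
    rw [hz2, h2 hz]; simp
  · have ha' : (A \ T).card = m + 1 := by
      have := hC.1.2.resolve_right hb
      omega
    obtain ⟨z, hz, hz0, hz1, hz2⟩ := exists_zA H hmk ha'.le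
    obtain ⟨β, q', rfl, hq'⟩ := sub_line (A := A) (B := B) (T := T) hq hz hz0
    have hq0 := hq'.2 hC.1
    have hcT := H.card_T hC.1.1
    have hsg := H.sign_T hC.1.1
    obtain ⟨h1, h2⟩ := WHR_mem H hW hP m k hmk q' hq' (by
      intro g
      have := h0 g
      rw [show xm T * lin c₀ ^ (k+1) * (β • z + q') * g = xm T * lin c₀ ^ (k+1) * q' * g +
        β • (xm T * lin c₀ ^ k * (z * (lin c₀ * g))) by
          rw [smul_eq_C_mul, smul_eq_C_mul]; ring, map_add, map_smul, hz2, add_comm m 1,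
          ev_mul m lam (lin_hom c₀), H.lin_c0] at this
      simpa using this)
    have hqq : L (xm T * lin c₀ ^ k * ((β • z + q') * (β • z + q'))) =
        L (xm T * lin c₀ ^ k * (q' * q')) +
          β ^ 2 * (κ * eval lam (xm T) * eval lam z ^ 2 * eval lam (lin c₀) ^ k) := by
      rw [show xm T * lin c₀ ^ k * ((β • z + q') * (β • z + q')) =
        xm T * lin c₀ ^ k * (q' * q') + β • (xm T * lin c₀ ^ k * (z * (β • z + (2:ℝ) • q'))) by
          simp only [smul_eq_C_mul, map_ofNat]; ring, map_add, map_smul, hz2, map_add, map_smul,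
          map_smul, ev_hom lam hq'.1, ev_hom lam hz, hq0]
      simp only [smul_eq_mul]; ring
    have hnn : 0 ≤ (-1) ^ (m+1) * (β ^ 2 * (κ * eval lam (xm T) * eval lam z ^ 2 *
        eval lam (lin c₀) ^ k)) := by
      rcases Nat.eq_zero_or_pos k with hk | hk
      · subst hk
        have e : (B \ T).card + 1 = (m + 1) + 2 := by omega
        rw [e, pow_add] at hsg
        have := mul_nonneg (mul_nonneg hsg.le (sq_nonneg β)) (sq_nonneg (eval lam z))
        calc (0:ℝ) ≤ _ := this
          _ = _ := by ring
      · rw [H.lin_c0, zero_pow hk.ne']; simp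
    rw [hqq]
    refine ⟨by rw [mul_add]; exact add_nonneg h1 hnn, fun hzz => ?_⟩
    have hz' : L (xm T * lin c₀ ^ k * (q' * q')) = 0 := by
      have : (-1) ^ (m+1) * L (xm T * lin c₀ ^ k * (q' * q')) = 0 := by
        have e := congrArg (fun x => (-1:ℝ) ^ (m+1) * x) hzz
        simp only [mul_add, mul_zero] at e
        linarith
      exact (mul_eq_zero.1 this).resolve_left (pow_ne_zero _ (by norm_num))
    refine ⟨β * (κ * eval lam z), fun g => ?_⟩
    rw [show xm T * (β • z + q') * g = xm T * q' * g + β • (xm T * z * g) by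
      rw [smul_eq_C_mul, smul_eq_C_mul]; ring, map_add, h2 hz', map_smul, hz1, smul_eq_mul]
    ring

end Wall2
end JKM

namespace JKM
open Module

section Wall3
variable {ι : Type} [Fintype ι] [DecidableEq ι]
variable {E : Type} [AddCommGroup E] [Module ℝ E] [FiniteDimensional ℝ E]

lemma eval_neg_hom {q : MvPolynomial ι ℝ} {m : ℕ} (h : q.IsHomogeneous m) (lam : ι → ℝ) :
    eval (-lam) q = (-1) ^ m * eval lam q := by
  rw [eval_eq, eval_eq, Finset.mul_sum]
  refine Finset.sum_congr rfl fun d hd => ?_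
  have h1 := h (mem_support_iff.1 hd)
  rw [Finsupp.weight_apply] at h1
  simp only [Pi.one_apply, smul_eq_mul, mul_one, Finsupp.sum] at h1
  have : ∀ i ∈ d.support, (-lam) i ^ d i = (-1) ^ d i * lam i ^ d i := by
    intro i _
    rw [Pi.neg_apply, neg_pow]
  rw [Finset.prod_congr rfl this, Finset.prod_mul_distrib, Finset.prod_pow_eq_pow_sum, h1]
  ring

lemma eval_neg_hom_iff {q : MvPolynomial ι ℝ} {m : ℕ} (h : q.IsHomogeneous m) (lam : ι → ℝ) :
    eval (-lam) q = 0 ↔ eval lam q = 0 := by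
  rw [eval_neg_hom h, mul_eq_zero, or_iff_right (pow_ne_zero _ (by norm_num))]

lemma UU_neg (lam : ι → ℝ) (A B T : Finset ι) (m : ℕ) :
    UU (-lam) B A T m = UU lam A B T m := by
  ext q
  rw [mem_UU, mem_UU]
  refine and_congr_right fun hq => ?_
  rw [eval_neg_hom_iff hq, Cnd, Cnd, Ne, eval_neg_hom_iff (xm_hom T), or_comm]

variable {V : ι → Dual ℝ E} {c₀ η η' : ι → ℝ} {L L' : MvPolynomial ι ℝ →ₗ[ℝ] ℝ} {lam : ι → ℝ}
    {A B : Finset ι} {κ κ' : ℝ}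

lemma PR_trans (H : Side V c₀ η L lam A B κ) {ε : ℝ}
    (hL : ∀ q, L' q = L q + ε * ev (finrank ℝ E) lam q) {T : Finset ι}
    (h : PR (finrank ℝ E) c₀ L lam A B T) : PR (finrank ℝ E) c₀ L' (-lam) B A T := by
  have key : ∀ m k, 2 * m + k + T.card = finrank ℝ E → ∀ e : ℝ,
      negIdx (e • QF L' (xm T * lin c₀ ^ k)) (UU (-lam) B A T m) =
      negIdx (e • QF L (xm T * lin c₀ ^ k)) (UU lam A B T m) := by
    intro m k hmk e
    rw [UU_neg]
    refine negIdx_congr _ _ _ fun x hx => ?_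
    rw [smul_QF_apply, smul_QF_apply, hL]
    suffices ev (finrank ℝ E) lam (xm T * lin c₀ ^ k * (x * x)) = 0 by rw [this, mul_zero, add_zero]
    have hh : (xm T * lin c₀ ^ k * (x * x)).IsHomogeneous (finrank ℝ E) := by
      have := ((xm_hom T).mul (pow_lin_hom c₀ k)).mul (hx.1.mul hx.1)
      rwa [show T.card + k + (m + m) = finrank ℝ E by omega] at this
    rw [ev_hom lam hh, map_mul, map_mul, map_mul, map_pow, H.lin_c0]
    rcases Nat.eq_zero_or_pos k with hk | hk
    · by_cases hT : eval lam (xm T) = 0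
      · rw [hT]; ring
      · rw [hx.2 ⟨hT, ?_⟩]; ring
        have := H.card_T hT
        omega
    · rw [zero_pow hk.ne']; ring
  intro m k hmk
  rw [key (m+1) k (by omega), key m (k+2) (by omega)]
  exact h m k hmk

theorem wall_cross (H : Side V c₀ η L lam A B κ) (H' : Side V c₀ η' L' (-lam) B A κ') {ε : ℝ}
    (hL : ∀ q, L' q = L q + ε * ev (finrank ℝ E) lam q)
    (h : ∀ᶠ s : ℝ in nhdsWithin 0 (Set.Ioi 0), ∀ T, HRI (finrank ℝ E) (c₀ + s • η) L T) :
    ∀ᶠ s : ℝ in nhdsWithin 0 (Set.Ioi 0), ∀ T, HRI (finrank ℝ E) (c₀ + s • η') L' T := by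
  have key : ∀ r (T : Finset ι), Fintype.card ι - T.card = r →
      WHR (finrank ℝ E) c₀ L lam A T ∧ WHR (finrank ℝ E) c₀ L' (-lam) B T ∧
      ∀ᶠ s : ℝ in nhdsWithin 0 (Set.Ioi 0), HRI (finrank ℝ E) (c₀ + s • η') L' T := by
    intro r
    induction r using Nat.strong_induction_on with
    | _ r ih =>
    intro T hT
    have hc : ∀ w ∉ T, WHR (finrank ℝ E) c₀ L lam A (insert w T) ∧
        WHR (finrank ℝ E) c₀ L' (-lam) B (insert w T) := by
      intro w hw
      have h1 := Finset.card_insert_of_notMem hw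
      have h2 := Finset.card_le_univ (insert w T)
      have := ih (Fintype.card ι - (insert w T).card) (by omega) _ rfl
      exact ⟨this.1, this.2.1⟩
    have hW := WHL_of_WHR H T fun w hw => (hc w hw).1
    have hW' := WHL_of_WHR H' T fun w hw => (hc w hw).2
    have hP := PR_of_HRI H hW (h.mono fun s hs => hs T)
    have hP' := PR_trans H hL hP
    exact ⟨WHR_of_PR H hW hP, WHR_of_PR H' hW' hP', HRI_of_PR H' hW' hP'⟩
  rw [Filter.eventually_all]
  exact fun T => (key _ T rfl).2.2

theorem interval_thm {c : ι → ℝ} {I : Set ℝ} (hI : IsPreconnected I)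
    (hV : ∀ s ∈ I, IsVol V (c + s • η) L) {s₀ : ℝ} (hs₀ : s₀ ∈ I)
    (h : ∀ T, HRI (finrank ℝ E) (c + s₀ • η) L T) :
    ∀ s ∈ I, ∀ T, HRI (finrank ℝ E) (c + s • η) L T := by
  have key : ∀ r (T : Finset ι), Fintype.card ι - T.card = r →
      ∀ s ∈ I, HRI (finrank ℝ E) (c + s • η) L T ∧ HR (finrank ℝ E) (c + s • η) L T := by
    intro r
    induction r using Nat.strong_induction_on with
    | _ r ih =>
    intro T hT
    have hHL : ∀ s ∈ I, HL (finrank ℝ E) (c + s • η) L T := by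
      intro s hs
      refine HL_of_HR (hV s hs) T fun w hw => ?_
      have h1 := Finset.card_insert_of_notMem hw
      have h2 := Finset.card_le_univ (insert w T)
      exact (ih (Fintype.card ι - (insert w T).card) (by omega) _ rfl s hs).2
    have hconst : ∀ m k, 2 * m + k + T.card = finrank ℝ E → ∀ ε : ℝ, ∀ s ∈ I,
        negIdx (ε • QF L (xm T * lin (c + s • η) ^ k)) (Em ι m) =
        negIdx (ε • QF L (xm T * lin (c + s₀ • η) ^ k)) (Em ι m) := by
      intro m k hmk ε s hs
      refine hI.constant (f := fun s : ℝ => negIdx (ε • QF L (xm T * lin (c + s • η) ^ k)) (Em ι m))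
        ?_ hs hs₀
      intro s₁ hs₁
      have hn := negIdx_const (fun s : ℝ => ε • QF L (xm T * lin (c + s • η) ^ k)) (by
        intro x y
        simp only [smul_QF_apply]
        have := cont_L L c η k (xm T * (x * y))
        refine continuous_const.mul (this.congr fun s => ?_)
        congr 1; ring) (fun s => smul_QF_symm ε _) s₁ (Em ι m)
      have hn' : ∀ᶠ s in nhds s₁,
          negIdx (ε • QF L (xm T * lin (c + s • η) ^ k)) (Em ι m) =
          negIdx (ε • QF L (xm T * lin (c + s₁ • η) ^ k)) (Em ι m) := by
        filter_upwards [hn] with s hs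
        refine hs ?_
        intro x hx h0 y hy
        by_cases hε : ε = 0
        · simp [hε]
        have := hHL s₁ hs₁ m k hmk x hx (by
          refine (hV s₁ hs₁).deg |> fun hd => DegP.all hd (n := m)
            (((xm_hom T).mul (pow_lin_hom (c + s₁ • η) k)).mul hx) (by omega) ?_
          intro g hg
          have := h0 g hg
          rw [smul_QF_apply] at this
          rw [mul_assoc]
          exact (mul_eq_zero.1 this).resolve_left hε)
        rw [smul_QF_apply, show xm T * lin (c + s • η) ^ k * (x * y) =
          xm T * x * (lin (c + s • η) ^ k * y) by ring, this, mul_zero]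
      refine ContinuousAt.continuousWithinAt ?_
      rw [ContinuousAt, nhds_discrete ℕ, Filter.tendsto_pure]
      exact hn'
    intro s hs
    have hI : HRI (finrank ℝ E) (c + s • η) L T := by
      intro m k hmk
      rw [hconst (m+1) k (by omega) _ s hs, hconst m (k+2) (by omega) _ s hs]
      exact h T m k hmk
    exact ⟨hI, HR_of_HRI (hV s hs) T (hHL s hs) hI⟩
  exact fun s hs T => (key _ T rfl s hs).1

/-- from HRI for all `T` to HL for all `T` -/
theorem HL_all {c : ι → ℝ} (hV : IsVol V c L) (h : ∀ T, HRI (finrank ℝ E) c L T) :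
    ∀ T, HL (finrank ℝ E) c L T := by
  have key : ∀ r (T : Finset ι), Fintype.card ι - T.card = r →
      HL (finrank ℝ E) c L T ∧ HR (finrank ℝ E) c L T := by
    intro r
    induction r using Nat.strong_induction_on with
    | _ r ih =>
    intro T hT
    have hHL : HL (finrank ℝ E) c L T := by
      refine HL_of_HR hV T fun w hw => ?_
      have h1 := Finset.card_insert_of_notMem hw
      have h2 := Finset.card_le_univ (insert w T)
      exact (ih (Fintype.card ι - (insert w T).card) (by omega) _ rfl).2
    exact ⟨hHL, HR_of_HRI hV T hHL (h T)⟩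
  exact fun T => (key _ T rfl).1

end Wall3
end JKM

namespace JKM
open Module

section Geom
variable {ι : Type} [Fintype ι] [DecidableEq ι]
variable {E : Type} [AddCommGroup E] [Module ℝ E] [FiniteDimensional ℝ E]
variable {V : ι → Dual ℝ E} {c : ι → ℝ}

def IsVert (V : ι → Dual ℝ E) (c : ι → ℝ) (x : E) : Prop :=
  InP V c x ∧ (act V c x).card = finrank ℝ E

lemma li_of_dual {κ : Type} [DecidableEq κ] {W : κ → Dual ℝ E} {T : Finset κ}
    (h : ∀ i ∈ T, ∃ u, W i u ≠ 0 ∧ ∀ j ∈ T, j ≠ i → W j u = 0) :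
    LinearIndepOn ℝ W (T : Set κ) := by
  rw [linearIndepOn_finset_iff]
  intro g hg i hi
  obtain ⟨u, hu, hj⟩ := h i hi
  have := congrArg (fun f => f u) hg
  simp only [LinearMap.sum_apply, LinearMap.smul_apply, smul_eq_mul, LinearMap.zero_apply] at this
  rw [Finset.sum_eq_single i (fun j hj' hji => by rw [hj j hj' hji, mul_zero])
    (fun h => absurd hi h)] at this
  exact (mul_eq_zero.1 this).resolve_right hu

lemma li_card_le {T : Finset ι} (h : LinearIndepOn ℝ V (T : Set ι)) : T.card ≤ finrank ℝ E := by
  have h' : LinearIndependent ℝ (fun i : (T : Set ι) => V i) := h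
  have := h'.fintype_card_le_finrank
  rw [Subspace.dual_finrank_eq] at this
  simpa using this

lemma exists_ker {T : Finset ι} (h : T.card < finrank ℝ E) :
    ∃ u : E, u ≠ 0 ∧ ∀ i ∈ T, V i u = 0 := by
  let f : E →ₗ[ℝ] (T → ℝ) := LinearMap.pi fun i => V i
  have : LinearMap.ker f ≠ ⊥ := LinearMap.ker_ne_bot_of_finrank_lt (by simpa using h)
  obtain ⟨u, hu, hu0⟩ := Submodule.exists_mem_ne_zero_of_ne_bot this
  refine ⟨u, hu0, fun i hi => ?_⟩
  exact congrFun (LinearMap.mem_ker.1 hu) ⟨i, hi⟩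

lemma eq_zero_of_full {T : Finset ι} (h : LinearIndepOn ℝ V (T : Set ι))
    (hT : T.card = finrank ℝ E) {x : E} (hx : ∀ i ∈ T, V i x = 0) : x = 0 := by
  let f : E →ₗ[ℝ] (T → ℝ) := LinearMap.pi fun i => V i
  have hs : Function.Surjective f := by
    intro b
    obtain ⟨u, hu⟩ := exists_sol h (fun i => if hi : i ∈ T then b ⟨i, hi⟩ else 0)
    refine ⟨u, funext fun i => ?_⟩
    have := hu i.1 i.2
    simpa [f] using this
  have hi : Function.Injective f :=
    (LinearMap.injective_iff_surjective_of_finrank_eq_finrank (by simp [hT])).2 hs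
  apply hi
  rw [map_zero]
  exact funext fun i => hx i.1 i.2

lemma eq_of_full {T : Finset ι} (h : LinearIndepOn ℝ V (T : Set ι))
    (hT : T.card = finrank ℝ E) {x y : E} (hx : ∀ i ∈ T, V i x = V i y) : x = y := by
  rw [← sub_eq_zero]
  exact eq_zero_of_full h hT fun i hi => by rw [map_sub, hx i hi, sub_self]

lemma dual_expand {T : Finset ι} (h : LinearIndepOn ℝ V (T : Set ι))
    (hT : T.card = finrank ℝ E) {u : ι → E} (hu : ∀ i ∈ T, ∀ j ∈ T, V j (u i) = if j = i then 1 else 0)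
    (y : Dual ℝ E) : y = ∑ i ∈ T, y (u i) • V i := by
  ext x
  have : x = ∑ i ∈ T, V i x • u i := by
    refine eq_of_full h hT fun j hj => ?_
    rw [map_sum, Finset.sum_eq_single j]
    · rw [map_smul, hu j hj j hj]; simp
    · intro i hi hij
      rw [map_smul, hu i hi j hj, if_neg hij.symm, smul_zero]
    · intro h; exact absurd hj h
  conv_lhs => rw [this]
  simp only [map_sum, map_smul, LinearMap.sum_apply, LinearMap.smul_apply, smul_eq_mul]
  exact Finset.sum_congr rfl fun i _ => mul_comm _ _

lemma vertex_lemma (hS : Simple V c) (hC : Cone V) (y : Dual ℝ E) : ∀ x, InP V c x →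
    ∃ z, IsVert V c z ∧ act V c x ⊆ act V c z ∧ y z ≤ y x := by
  have key : ∀ r x, InP V c x → Fintype.card ι - (act V c x).card = r →
      ∃ z, IsVert V c z ∧ act V c x ⊆ act V c z ∧ y z ≤ y x := by
    intro r
    induction r using Nat.strong_induction_on with
    | _ r ih =>
    intro x hx hr
    have hle := li_card_le (hS x hx)
    rcases hle.eq_or_lt with h | h
    · exact ⟨x, ⟨hx, h⟩, Finset.Subset.refl _, le_rfl⟩
    obtain ⟨u, hu0, hu, hy⟩ : ∃ u : E, u ≠ 0 ∧ (∀ i ∈ act V c x, V i u = 0) ∧ y u ≤ 0 := by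
      obtain ⟨u, hu0, hu⟩ := exists_ker (V := V) h
      rcases le_total (y u) 0 with h | h
      · exact ⟨u, hu0, hu, h⟩
      · exact ⟨-u, neg_ne_zero.2 hu0, fun i hi => by rw [map_neg, hu i hi, neg_zero],
          by rw [map_neg]; linarith⟩
    have hex : (Finset.univ.filter fun i => 0 < V i u).Nonempty := by
      by_contra hn
      rw [Finset.not_nonempty_iff_eq_empty, Finset.filter_eq_empty_iff] at hn
      exact hu0 (hC u fun i => not_lt.1 (hn (Finset.mem_univ i)))
    obtain ⟨i, hi, hmin⟩ := Finset.exists_min_image _ (fun i => (c i - V i x) / V i u) hex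
    have hi' : 0 < V i u := (Finset.mem_filter.1 hi).2
    set s := (c i - V i x) / V i u with hs
    have hs0 : 0 ≤ s := div_nonneg (sub_nonneg.2 (hx i)) hi'.le
    have hxs : InP V c (x + s • u) := by
      intro j
      rw [map_add, map_smul, smul_eq_mul]
      rcases le_or_gt (V j u) 0 with hj | hj
      · nlinarith [hx j]
      · have := hmin j (Finset.mem_filter.2 ⟨Finset.mem_univ j, hj⟩)
        rw [le_div_iff₀ hj] at this
        linarith
    have hsub : act V c x ⊆ act V c (x + s • u) := by
      intro j hj
      rw [mem_act, map_add, map_smul, hu j hj, mem_act.1 hj]; simp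
    have hnew : i ∈ act V c (x + s • u) := by
      rw [mem_act, map_add, map_smul, smul_eq_mul, hs, div_mul_cancel₀ _ hi'.ne']; ring
    have hnot : i ∉ act V c x := fun h => by rw [hu i h] at hi'; exact lt_irrefl _ hi'
    have hcard : (act V c x).card < (act V c (x + s • u)).card :=
      Finset.card_lt_card ⟨hsub, fun h => hnot (h hnew)⟩
    have h2 := Finset.card_le_univ (act V c (x + s • u))
    obtain ⟨z, hz, hz1, hz2⟩ := ih _ (by omega) _ hxs rfl
    refine ⟨z, hz, hsub.trans hz1, hz2.trans ?_⟩
    rw [map_add, map_smul, smul_eq_mul]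
    nlinarith
  exact fun x hx => key _ x hx rfl

lemma vertex_lemma' (hS : Simple V c) (hC : Cone V) (y : Dual ℝ E) (x : E) (hx : InP V c x) :
    ∃ z, IsVert V c z ∧ act V c x ⊆ act V c z ∧ y x ≤ y z := by
  obtain ⟨z, h1, h2, h3⟩ := vertex_lemma hS hC (-y) x hx
  refine ⟨z, h1, h2, ?_⟩
  simpa using h3

lemma segment_exact {x x' : E} {τ : Finset ι} (hx : InP V c x) (h : act V c x = τ)
    (hx' : InP V c x') (h' : τ ⊆ act V c x') {s : ℝ} (hs0 : 0 ≤ s) (hs1 : s < 1) :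
    InP V c ((1 - s) • x + s • x') ∧ act V c ((1 - s) • x + s • x') = τ := by
  refine ⟨fun i => ?_, ?_⟩
  · rw [map_add, map_smul, map_smul, smul_eq_mul, smul_eq_mul]
    nlinarith [hx i, hx' i]
  · ext i
    rw [mem_act, map_add, map_smul, map_smul, smul_eq_mul, smul_eq_mul]
    constructor
    · intro e
      rw [← h, mem_act]
      have h1 := hx i
      have h2 := hx' i
      by_contra hn
      have : V i x < c i := lt_of_le_of_ne h1 hn
      nlinarith
    · intro hi
      have e1 := mem_act.1 (h' hi)
      rw [← h, mem_act] at hi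
      rw [e1, hi]; ring

lemma exact_height {x x' : E} {τ : Finset ι} (y : Dual ℝ E) (hx : InP V c x) (h : act V c x = τ)
    (hx' : InP V c x') (h' : τ ⊆ act V c x') {m : ℝ} (hm : (y x' < m ∧ m < y x) ∨
      (y x < m ∧ m < y x')) :
    ∃ z, InP V c z ∧ act V c z = τ ∧ y z = m := by
  have hne : y x' - y x ≠ 0 := by
    rcases hm with hm | hm
    · exact (sub_neg.2 (hm.1.trans hm.2)).ne
    · exact (sub_pos.2 (hm.1.trans hm.2)).ne'
  have hs : 0 ≤ (m - y x) / (y x' - y x) ∧ (m - y x) / (y x' - y x) < 1 := by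
    rcases hm with hm | hm
    · rw [← neg_div_neg_eq]
      refine ⟨div_nonneg (by linarith) (by linarith), ?_⟩
      rw [div_lt_one (by linarith)]; linarith
    · refine ⟨div_nonneg (by linarith) (by linarith), ?_⟩
      rw [div_lt_one (by linarith)]; linarith
  obtain ⟨h1, h2⟩ := segment_exact hx h hx' h' hs.1 hs.2
  refine ⟨_, h1, h2, ?_⟩
  rw [map_add, map_smul, map_smul, smul_eq_mul, smul_eq_mul]
  have : (m - y x) / (y x' - y x) * (y x' - y x) = m - y x := div_mul_cancel₀ _ hne
  linarith

lemma exact_below (hS : Simple V c) (y : Dual ℝ E) {x' : E} {τ : Finset ι} (hx' : InP V c x')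
    (h' : τ ⊆ act V c x') {t : ℝ} (ht : y x' < t) :
    ∃ z, InP V c z ∧ act V c z = τ ∧ y z < t := by
  obtain ⟨x, hx, h⟩ := face_exact hS ⟨x', hx', h'⟩
  by_cases hlt : y x < t
  · exact ⟨x, hx, h, hlt⟩
  · obtain ⟨z, h1, h2, h3⟩ := exact_height y hx h hx' h' (m := (y x' + t) / 2)
      (Or.inl ⟨by linarith, by linarith⟩)
    exact ⟨z, h1, h2, by linarith⟩

lemma exact_cross (hS : Simple V c) (y : Dual ℝ E) {x₁ x₂ : E} {τ : Finset ι} (hx₁ : InP V c x₁)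
    (h₁ : τ ⊆ act V c x₁) (hx₂ : InP V c x₂) (h₂ : τ ⊆ act V c x₂) {t : ℝ} (ht : y x₁ < t)
    (ht' : t < y x₂) : ∃ z, InP V c z ∧ act V c z = τ ∧ y z = t := by
  obtain ⟨x, hx, h⟩ := face_exact hS ⟨x₁, hx₁, h₁⟩
  rcases lt_trichotomy (y x) t with hlt | heq | hgt
  · exact exact_height y hx h hx₂ h₂ (Or.inr ⟨hlt, ht'⟩)
  · exact ⟨x, hx, h, heq⟩
  · exact exact_height y hx h hx₁ h₁ (Or.inl ⟨ht, hgt⟩)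

lemma vert_finite (hS : Simple V c) : {x | IsVert V c x}.Finite := by
  apply Set.Finite.of_finite_image (f := fun x => act V c x) (Set.toFinite _)
  intro x hx x' hx' h
  have h : act V c x = act V c x' := h
  refine eq_of_full (hS x hx.1) hx.2 fun i hi => ?_
  rw [mem_act.1 hi]
  rw [h] at hi
  rw [mem_act.1 hi]

/-- a generic linear functional, with dual vectors chosen at each vertex -/
structure Gen (V : ι → Dual ℝ E) (c : ι → ℝ) (y : Dual ℝ E) (Y : E → ι → ℝ) : Prop where
  expand : ∀ x, IsVert V c x → y = ∑ i ∈ act V c x, Y x i • V i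
  ne : ∀ x, IsVert V c x → ∀ i ∈ act V c x, Y x i ≠ 0
  inj : ∀ x x', IsVert V c x → IsVert V c x' → y x = y x' → x = x'

lemma exists_gen (hS : Simple V c) : ∃ y Y, Gen V c y Y := by
  have hu : ∀ x, ∃ u : ι → E, IsVert V c x → ∀ i ∈ act V c x, ∀ j ∈ act V c x,
      V j (u i) = if j = i then 1 else 0 := by
    intro x
    by_cases hx : IsVert V c x
    · have : ∀ i, ∃ u, ∀ j ∈ act V c x, V j u = if j = i then 1 else 0 := fun i =>
        exists_sol (hS x hx.1) (fun j => if j = i then 1 else 0)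
      choose u hu using this
      exact ⟨u, fun _ i _ j hj => hu i j hj⟩
    · exact ⟨0, fun h => absurd h hx⟩
  choose u hu using hu
  have : Finite {x | IsVert V c x} := vert_finite hS
  let I := {p : {x | IsVert V c x} × ι // p.2 ∈ act V c p.1.1} ⊕
    {p : {x | IsVert V c x} × {x | IsVert V c x} // p.1 ≠ p.2}
  let v : I → E := fun i => match i with
    | Sum.inl p => u p.1.1.1 p.1.2
    | Sum.inr p => p.1.1.1 - p.1.2.1
  obtain ⟨y, hy⟩ := Module.exists_dual_forall_apply_ne_zero (K := ℝ) v (by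
    rintro (⟨⟨⟨x, hx⟩, i⟩, hi⟩ | ⟨⟨⟨x, hx⟩, ⟨x', hx'⟩⟩, hne⟩)
    · simp only [v]
      intro h0
      have := hu x hx i hi i hi
      rw [h0] at this
      simp at this
    · simp only [v]
      rw [sub_ne_zero]
      intro h; exact hne (Subtype.ext h))
  refine ⟨y, fun x i => y (u x i), fun x hx => dual_expand (hS x hx.1) hx.2 (hu x hx) y,
    fun x hx i hi => hy (Sum.inl ⟨⟨⟨x, hx⟩, i⟩, hi⟩), fun x x' hx hx' h => ?_⟩
  by_contra hne
  have := hy (Sum.inr ⟨⟨⟨x, hx⟩, ⟨x', hx'⟩⟩, fun h => hne (congrArg Subtype.val h)⟩)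
  simp only [v, map_sub] at this
  exact this (sub_eq_zero.2 h)

def Bl (V : ι → Dual ℝ E) (c : ι → ℝ) (y : Dual ℝ E) (t : ℝ) (τ : Finset ι) : Prop :=
  ∃ x, InP V c x ∧ τ ⊆ act V c x ∧ y x < t

def Ab (V : ι → Dual ℝ E) (c : ι → ℝ) (y : Dual ℝ E) (t : ℝ) (τ : Finset ι) : Prop :=
  ∃ x, InP V c x ∧ τ ⊆ act V c x ∧ t < y x

lemma Ab_iff {y : Dual ℝ E} {t : ℝ} {τ : Finset ι} : Ab V c y t τ ↔ Bl V c (-y) (-t) τ := by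
  simp [Ab, Bl]

lemma Bl_of (hS : Simple V c) {y : Dual ℝ E} {x₀ : E} (hx₀ : InP V c x₀) {Y : ι → ℝ}
    (hY : y = ∑ i ∈ act V c x₀, Y i • V i) {τ : Finset ι} (hτ : τ ⊆ act V c x₀) {i : ι}
    (hi : i ∈ act V c x₀) (hiτ : i ∉ τ) (hp : 0 < Y i) : Bl V c y (y x₀) τ := by
  obtain ⟨u, hu⟩ := exists_sol (hS x₀ hx₀) (fun j => if j = i then -1 else 0)
  have hu' : ∀ j ∈ act V c x₀, V j u = if j = i then -1 else 0 := hu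
  have hm := move_off hx₀ u (fun j hj => by rw [hu' j hj]; split_ifs <;> norm_num)
  obtain ⟨s, ⟨h1, h2⟩, hs⟩ := (hm.and self_mem_nhdsWithin).exists
  have hs : 0 < s := hs
  refine ⟨x₀ + s • u, h1, fun j hj => ?_, ?_⟩
  · rw [h2]
    refine ⟨hτ hj, ?_⟩
    rw [hu' j (hτ hj), if_neg]
    rintro rfl; exact hiτ hj
  · have hyu : y u = - Y i := by
      rw [hY, LinearMap.sum_apply, Finset.sum_eq_single i]
      · rw [LinearMap.smul_apply, hu' i hi]; simp
      · intro j hj hji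
        rw [LinearMap.smul_apply, hu' j hj, if_neg hji, smul_zero]
      · intro h; exact absurd hi h
    rw [map_add, map_smul, hyu, smul_eq_mul]
    nlinarith

lemma not_Bl {y : Dual ℝ E} {x₀ : E} {Y : ι → ℝ}
    (hY : y = ∑ i ∈ act V c x₀, Y i • V i) {τ : Finset ι} (h : Bl V c y (y x₀) τ) :
    ∃ i ∈ act V c x₀, 0 < Y i ∧ i ∉ τ := by
  by_contra hn
  push Not at hn
  obtain ⟨x, hx, hτ, hlt⟩ := h
  have e : ∀ z, y z = ∑ i ∈ act V c x₀, Y i * V i z := by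
    intro z
    rw [hY]
    simp
  rw [e, e] at hlt
  refine absurd hlt (not_lt.2 (Finset.sum_le_sum fun i hi => ?_))
  rw [mem_act.1 hi]
  rcases le_or_gt (Y i) 0 with h | h
  · have := hx i
    nlinarith
  · rw [mem_act.1 (hτ (hn i hi h))]

lemma Ab_of (hS : Simple V c) {y : Dual ℝ E} {x₀ : E} (hx₀ : InP V c x₀) {Y : ι → ℝ}
    (hY : y = ∑ i ∈ act V c x₀, Y i • V i) {τ : Finset ι} (hτ : τ ⊆ act V c x₀) {i : ι}
    (hi : i ∈ act V c x₀) (hiτ : i ∉ τ) (hp : Y i < 0) : Ab V c y (y x₀) τ := by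
  rw [Ab_iff]
  exact Bl_of (Y := -Y) hS hx₀ (by rw [hY, ← Finset.sum_neg_distrib]; exact Finset.sum_congr rfl fun i _ => (neg_smul (Y i) (V i)).symm) hτ hi hiτ (by simpa using hp)

lemma not_Ab {y : Dual ℝ E} {x₀ : E} {Y : ι → ℝ}
    (hY : y = ∑ i ∈ act V c x₀, Y i • V i) {τ : Finset ι} (h : Ab V c y (y x₀) τ) :
    ∃ i ∈ act V c x₀, Y i < 0 ∧ i ∉ τ := by
  rw [Ab_iff] at h
  obtain ⟨i, h1, h2, h3⟩ := not_Bl (Y := -Y) (y := -y) (by rw [hY, ← Finset.sum_neg_distrib]; exact Finset.sum_congr rfl fun i _ => (neg_smul (Y i) (V i)).symm) h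
  exact ⟨i, h1, by simpa using h2, h3⟩

end Geom
end JKM

namespace JKM
open Module

section Flip
variable {ι : Type} [Fintype ι] [DecidableEq ι]
variable {E : Type} [AddCommGroup E] [Module ℝ E] [FiniteDimensional ℝ E]

structure LP (V : ι → Dual ℝ E) (D : Finset ι → Prop) (L : MvPolynomial ι ℝ →ₗ[ℝ] ℝ) : Prop where
  deg : ∀ n q, IsHomogeneous q n → n ≠ finrank ℝ E → L q = 0
  nonface : ∀ τ, ¬ D τ → ∀ q, L (xm τ * q) = 0
  theta : ∀ u q, L (lin (fun i => V i u) * q) = 0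
  pos : ∀ τ, D τ → τ.card = finrank ℝ E → 0 < L (xm τ)

/-- combinatorial data of a bistellar flip -/
structure Flip (V : ι → Dual ℝ E) (D₁ D₂ : Finset ι → Prop) (lam : ι → ℝ) (A B : Finset ι) :
    Prop where
  mono₁ : ∀ σ τ, D₁ τ → σ ⊆ τ → D₁ σ
  mono₂ : ∀ σ τ, D₂ τ → σ ⊆ τ → D₂ σ
  disj : Disjoint A B
  card : A.card + B.card = finrank ℝ E + 1
  posA : ∀ i ∈ A, 0 < lam i
  negB : ∀ i ∈ B, lam i < 0
  zero : ∀ i, i ∉ A → i ∉ B → lam i = 0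
  ne : A.Nonempty
  dep : ∀ u, ∑ i, V i u * lam i = 0
  rel : ∀ m : ι → ℝ, (∀ j, j ∉ A → j ∉ B → m j = 0) → (∀ u, ∑ j, V j u * m j = 0) →
    ∃ r, ∀ j, m j = r * lam j
  B₁ : ¬ D₁ B
  A₂ : ¬ D₂ A
  d₁₂ : ∀ τ, D₁ τ → ¬ D₂ τ → τ ⊆ A ∪ B
  d₂₁ : ∀ τ, D₂ τ → ¬ D₁ τ → τ ⊆ A ∪ B
  a₁₂ : ∀ τ, D₁ τ → ¬ D₂ τ → A ⊆ τ
  f₁ : ∀ i ∈ B, D₁ ((A ∪ B).erase i)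
  f₂ : ∀ i ∈ A, D₂ ((A ∪ B).erase i)

lemma xm_sdiff {S T : Finset ι} (h : S ⊆ T) : xm T = xm S * xm (T \ S) := by
  rw [xm, xm, xm, ← Finset.prod_union Finset.disjoint_sdiff, Finset.union_sdiff_of_subset h]

lemma sign_prod {lam : ι → ℝ} {s : Finset ι} (h : ∀ i ∈ s, lam i < 0) :
    0 < (-1) ^ s.card * ∏ i ∈ s, lam i := by
  have : (-1) ^ s.card * ∏ i ∈ s, lam i = ∏ i ∈ s, (-lam i) := by
    rw [Finset.prod_neg]
  rw [this]
  exact Finset.prod_pos fun i hi => by linarith [h i hi]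

lemma ev_xm_zero (n : ℕ) {lam : ι → ℝ} {τ : Finset ι} (h : ∃ i ∈ τ, lam i = 0)
    (q : MvPolynomial ι ℝ) : ev n lam (xm τ * q) = 0 := by
  rcases lt_or_ge n τ.card with h' | h'
  · exact ev_mul_lt lam (xm_hom τ) h' q
  · obtain ⟨k, rfl⟩ := Nat.exists_eq_add_of_le h'
    rw [ev_mul k lam (xm_hom τ), eval_xm]
    obtain ⟨i, hi, h0⟩ := h
    rw [Finset.prod_eq_zero hi h0, zero_mul]

variable {V : ι → Dual ℝ E} {D₁ D₂ : Finset ι → Prop} {lam : ι → ℝ} {A B : Finset ι}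
  {L : MvPolynomial ι ℝ →ₗ[ℝ] ℝ}

lemma Flip.kappa (F : Flip V D₁ D₂ lam A B) (h : LP V D₁ L) : ∃ κ : ℝ,
    0 < (-1) ^ (B.card + 1) * κ ∧ ∀ q, L (xm A * q) = κ * ev (finrank ℝ E) lam (xm A * q) := by
  rcases B.eq_empty_or_nonempty with rfl | ⟨i₀, hi₀⟩
  · refine ⟨-1, by norm_num, fun q => ?_⟩
    have h0 := h.nonface ∅ F.B₁ (xm A * q)
    have hc := F.card
    simp only [Finset.card_empty, add_zero] at hc
    rw [ev_mul_lt lam (xm_hom A) (by omega), mul_zero]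
    simpa [xm] using h0
  · have hBc : 0 < B.card := Finset.card_pos.2 ⟨i₀, hi₀⟩
    have hc := F.card
    obtain ⟨n, hn⟩ : ∃ n, A.card + n = finrank ℝ E := ⟨B.card - 1, by omega⟩
    obtain ⟨a, ha⟩ := F.ne
    obtain ⟨κ, hκ⟩ := eq_ev (lam := lam) (F.posA a ha).ne' n
      (L.comp (LinearMap.mulLeft ℝ (xm A))) (DegP.mul h.deg (xm_hom A) hn) (by
        intro a b q
        simp only [LinearMap.comp_apply, LinearMap.mulLeft_apply]
        obtain ⟨r, hr⟩ := F.rel (fun j => L (xm A * (X j * q))) (by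
          intro j hA hB
          have : ¬ D₁ (insert j A) := by
            intro hD
            have h2 := F.d₁₂ _ hD (fun h2 => F.A₂ (F.mono₂ _ _ h2 (Finset.subset_insert _ _)))
            have := h2 (Finset.mem_insert_self j A)
            rw [Finset.mem_union] at this
            tauto
          have h3 := h.nonface _ this q
          rw [xm_insert hA] at h3
          rw [← h3]; congr 1; ring) (by
          intro u
          have := h.theta u (xm A * q)
          rw [L_lin] at this
          rw [← this]
          refine Finset.sum_congr rfl fun j _ => ?_
          congr 2; ring)
        have ha := hr a
        have hb := hr b
        rw [ha, hb]; ring)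
    have hpA : 0 < ∏ i ∈ A, lam i := Finset.prod_pos F.posA
    have key : ∀ q, L (xm A * q) = (κ / ∏ i ∈ A, lam i) * ev (finrank ℝ E) lam (xm A * q) := by
      intro q
      have := hκ q
      simp only [LinearMap.comp_apply, LinearMap.mulLeft_apply] at this
      rw [this, ← hn, ev_mul n lam (xm_hom A), eval_xm]
      field_simp
    refine ⟨_, ?_, key⟩
    have hAB : A ⊆ (A ∪ B).erase i₀ := by
      intro j hj
      refine Finset.mem_erase.2 ⟨?_, Finset.mem_union_left _ hj⟩
      rintro rfl
      exact Finset.disjoint_left.1 F.disj hj hi₀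
    have hcu : ((A ∪ B).erase i₀).card = finrank ℝ E := by
      rw [Finset.card_erase_of_mem (Finset.mem_union_right _ hi₀), Finset.card_union_of_disjoint F.disj]
      omega
    have hp := h.pos _ (F.f₁ i₀ hi₀) hcu
    have hsd : (A ∪ B).erase i₀ \ A = B.erase i₀ := by
      ext j
      have := fun (h : j ∈ A) => Finset.disjoint_left.1 F.disj h
      simp only [Finset.mem_sdiff, Finset.mem_erase, Finset.mem_union]
      tauto
    rw [xm_sdiff hAB, key, ← hn, ev_mul n lam (xm_hom A), hsd, eval_xm, ev_hom lam, eval_xm] at hp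
    swap
    · have := xm_hom (B.erase i₀)
      rwa [Finset.card_erase_of_mem hi₀, show B.card - 1 = n by omega] at this
    have hs := sign_prod (lam := lam) (s := B.erase i₀) (fun i hi => F.negB i (Finset.mem_of_mem_erase hi))
    rw [Finset.card_erase_of_mem hi₀, show B.card - 1 = n by omega] at hs
    rw [show B.card + 1 = n + 2 by omega]
    set P := ∏ i ∈ A, lam i
    set Q := ∏ i ∈ B.erase i₀, lam i
    set k := κ / P
    have hk : 0 < k * Q := by
      by_contra hn
      nlinarith
    have h2 : ((-1 : ℝ) ^ n) * (-1) ^ n = 1 := by rw [← mul_pow]; norm_num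
    have : (0 : ℝ) < ((-1) ^ n * Q) * ((-1) ^ (n+2) * k) := by
      calc (0:ℝ) < k * Q := hk
        _ = ((-1) ^ n * (-1) ^ n) * (k * Q) := by rw [h2, one_mul]
        _ = _ := by ring
    exact (pos_iff_pos_of_mul_pos this).1 hs

lemma Flip.L₂ (F : Flip V D₁ D₂ lam A B) (h : LP V D₁ L) {κ : ℝ}
    (hs : 0 < (-1) ^ (B.card + 1) * κ)
    (hA : ∀ q, L (xm A * q) = κ * ev (finrank ℝ E) lam (xm A * q)) :
    LP V D₂ (L + (-κ) • ev (finrank ℝ E) lam) := by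
  have hcard : (A ∪ B).card = finrank ℝ E + 1 := by
    rw [Finset.card_union_of_disjoint F.disj, F.card]
  constructor
  · intro n q hq hn
    simp [h.deg n q hq hn, ev_hom_ne lam hq hn]
  · intro τ hτ q
    by_cases h1 : D₁ τ
    · have := F.a₁₂ τ h1 hτ
      rw [xm_sdiff this, mul_assoc, LinearMap.add_apply, LinearMap.smul_apply, hA, smul_eq_mul]
      ring
    · have h0 : ev (finrank ℝ E) lam (xm τ * q) = 0 := by
        by_cases hsub : τ ⊆ A ∪ B
        · have : τ = A ∪ B := by
            by_contra hne
            obtain ⟨i, hi, hiτ⟩ := Finset.exists_of_ssubset (Finset.ssubset_iff_subset_ne.2 ⟨hsub, hne⟩)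
            have hsub' : τ ⊆ (A ∪ B).erase i := fun j hj =>
              Finset.mem_erase.2 ⟨fun e => hiτ (e ▸ hj), hsub hj⟩
            rcases Finset.mem_union.1 hi with hi | hi
            · exact hτ (F.mono₂ _ _ (F.f₂ i hi) hsub')
            · exact h1 (F.mono₁ _ _ (F.f₁ i hi) hsub')
          exact ev_mul_lt lam (xm_hom τ) (by rw [this, hcard]; omega) q
        · obtain ⟨i, hi, hn⟩ := Finset.not_subset.1 hsub
          rw [Finset.mem_union, not_or] at hn
          exact ev_xm_zero _ ⟨i, hi, F.zero i hn.1 hn.2⟩ q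
      simp [h0, h.nonface τ h1 q]
  · intro u q
    have h0 : ev (finrank ℝ E) lam (lin (fun i => V i u) * q) = 0 := by
      rcases Nat.eq_zero_or_pos (finrank ℝ E) with h0 | h0
      · rw [h0]; exact ev_mul_lt lam (lin_hom _) (by norm_num) q
      · obtain ⟨k, hk⟩ := Nat.exists_eq_add_of_le h0
        rw [hk, show Nat.succ 0 + k = 1 + k by rfl, ev_mul k lam (lin_hom _), eval_lin]
        have := F.dep u
        rw [show ∑ i, lam i * V i u = 0 by rw [← this]; exact Finset.sum_congr rfl fun i _ => mul_comm _ _,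
          zero_mul]
    simp [h0, h.theta u q]
  · intro τ hτ hc
    rw [LinearMap.add_apply, LinearMap.smul_apply, smul_eq_mul,
      ev_hom lam (by rw [← hc]; exact xm_hom τ), eval_xm]
    by_cases hsub : τ ⊆ A ∪ B
    · have hne : τ ≠ A ∪ B := fun e => by rw [e] at hc; omega
      obtain ⟨i, hi, hiτ⟩ := Finset.exists_of_ssubset (Finset.ssubset_iff_subset_ne.2 ⟨hsub, hne⟩)
      have hsub' : τ ⊆ (A ∪ B).erase i := fun j hj =>
        Finset.mem_erase.2 ⟨fun e => hiτ (e ▸ hj), hsub hj⟩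
      have heq : τ = (A ∪ B).erase i :=
        Finset.eq_of_subset_of_card_le hsub' (by rw [Finset.card_erase_of_mem hi]; omega)
      have hiA : i ∈ A := by
        by_contra hiA
        refine F.A₂ (F.mono₂ _ _ hτ fun j hj => ?_)
        rw [heq]
        exact Finset.mem_erase.2 ⟨fun e => hiA (e ▸ hj), Finset.mem_union_left _ hj⟩
      have hBτ : B ⊆ τ := by
        intro j hj
        rw [heq]
        exact Finset.mem_erase.2 ⟨fun e => Finset.disjoint_left.1 F.disj hiA (e ▸ hj),
          Finset.mem_union_right _ hj⟩
      have h1 : L (xm τ) = 0 := by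
        have := h.nonface τ (fun h1 => F.B₁ (F.mono₁ _ _ h1 hBτ)) 1
        rwa [mul_one] at this
      have hp : ∏ i ∈ τ, lam i = (∏ i ∈ B, lam i) * ∏ i ∈ τ \ B, lam i := by
        rw [← Finset.prod_union Finset.disjoint_sdiff, Finset.union_sdiff_of_subset hBτ]
      have hq : 0 < ∏ i ∈ τ \ B, lam i := by
        refine Finset.prod_pos fun j hj => F.posA j ?_
        rw [Finset.mem_sdiff] at hj
        have := hsub hj.1
        rw [Finset.mem_union] at this
        tauto
      have hb := sign_prod F.negB
      rw [h1, hp, zero_add]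
      have h2 : ((-1 : ℝ) ^ B.card) * (-1) ^ B.card = 1 := by rw [← mul_pow]; norm_num
      have : -κ * ((∏ i ∈ B, lam i) * ∏ i ∈ τ \ B, lam i) =
        ((-1) ^ (B.card + 1) * κ) * ((-1) ^ B.card * ∏ i ∈ B, lam i) * ∏ i ∈ τ \ B, lam i := by
        rw [pow_succ]
        linear_combination (-κ * ((∏ i ∈ B, lam i) * ∏ i ∈ τ \ B, lam i)) * (-h2)
      rw [this]
      positivity
    · have h1 : D₁ τ := by
        by_contra h1
        exact hsub (F.d₂₁ τ hτ h1)
      obtain ⟨i, hi, hn⟩ := Finset.not_subset.1 hsub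
      rw [Finset.mem_union, not_or] at hn
      rw [Finset.prod_eq_zero hi (F.zero i hn.1 hn.2)]
      simpa using h.pos τ h1 hc

lemma Flip.LB₂ (F : Flip V D₁ D₂ lam A B) (h : LP V D₁ L) (κ : ℝ) (q : MvPolynomial ι ℝ) :
    (L + (-κ) • ev (finrank ℝ E) lam) (xm B * q) =
      (-(-1) ^ (finrank ℝ E) * κ) * ev (finrank ℝ E) (-lam) (xm B * q) := by
  have h0 := h.nonface B F.B₁ q
  have : ev (finrank ℝ E) (-lam) (xm B * q) = (-1) ^ (finrank ℝ E) * ev (finrank ℝ E) lam (xm B * q) := by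
    rw [ev_apply, ev_apply, eval_neg_hom (homogeneousComponent_isHomogeneous _ _)]
  rw [this, LinearMap.add_apply, h0, LinearMap.smul_apply, smul_eq_mul]
  have h2 : ((-1 : ℝ) ^ (finrank ℝ E)) * (-1) ^ (finrank ℝ E) = 1 := by rw [← mul_pow]; norm_num
  linear_combination (κ * ev (finrank ℝ E) lam (xm B * q)) * h2

end Flip
end JKM

namespace JKM
open Module

section Sweep
variable {ι : Type} [Fintype ι] [DecidableEq ι]
variable {E : Type} [AddCommGroup E] [Module ℝ E] [FiniteDimensional ℝ E]

def Vp (V : ι → Dual ℝ E) (y : Dual ℝ E) : Option ι → Dual ℝ E := fun o => o.elim y V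
def cp (c : ι → ℝ) (t : ℝ) : Option ι → ℝ := fun o => o.elim t c

variable {V : ι → Dual ℝ E} {c : ι → ℝ} {y : Dual ℝ E}

@[simp] lemma Vp_none : Vp V y none = y := rfl
@[simp] lemma Vp_some (i : ι) : Vp V y (some i) = V i := rfl
omit [Fintype ι] [DecidableEq ι] in
@[simp] lemma cp_none (t : ℝ) : cp c t none = t := rfl
omit [Fintype ι] [DecidableEq ι] in
@[simp] lemma cp_some (t : ℝ) (i : ι) : cp c t (some i) = c i := rfl

lemma cp_add (t s r : ℝ) : cp c t + s • Pi.single none r = cp c (t + s * r) := by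
  ext o
  cases o <;> simp

lemma InP_p {t : ℝ} {x : E} : InP (Vp V y) (cp c t) x ↔ y x ≤ t ∧ InP V c x := by
  constructor
  · intro h; exact ⟨h none, fun i => h (some i)⟩
  · rintro ⟨h1, h2⟩ (_ | i)
    · exact h1
    · exact h2 i

lemma none_mem_act {t : ℝ} {x : E} : none ∈ act (Vp V y) (cp c t) x ↔ y x = t := mem_act

lemma some_mem_act {t : ℝ} {x : E} {i : ι} : some i ∈ act (Vp V y) (cp c t) x ↔ i ∈ act V c x := by
  rw [mem_act, mem_act]; rfl

lemma sub_act {t : ℝ} {x : E} {T : Finset (Option ι)} : T ⊆ act (Vp V y) (cp c t) x ↔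
    (none ∈ T → y x = t) ∧ T.eraseNone ⊆ act V c x := by
  constructor
  · intro h
    exact ⟨fun hn => none_mem_act.1 (h hn), fun i hi => some_mem_act.1 (h (Finset.mem_eraseNone.1 hi))⟩
  · rintro ⟨h1, h2⟩ (_ | i) hi
    · exact none_mem_act.2 (h1 hi)
    · exact some_mem_act.2 (h2 (Finset.mem_eraseNone.2 hi))

lemma LIp {T : Finset (Option ι)} (h : LinearIndepOn ℝ V (T.eraseNone : Set ι))
    (hn : none ∈ T → ∃ w, y w ≠ 0 ∧ ∀ i ∈ T.eraseNone, V i w = 0) :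
    LinearIndepOn ℝ (Vp V y) (T : Set (Option ι)) := by
  apply li_of_dual
  rintro (_ | i) hi
  · obtain ⟨w, h1, h2⟩ := hn hi
    refine ⟨w, h1, ?_⟩
    rintro (_ | j) hj hne
    · exact absurd rfl hne
    · exact h2 j (Finset.mem_eraseNone.2 hj)
  · obtain ⟨u, hu⟩ := exists_sol h (fun j => if j = i then 1 else 0)
    by_cases hT : none ∈ T
    · obtain ⟨w, h1, h2⟩ := hn hT
      refine ⟨u - (y u / y w) • w, ?_, ?_⟩
      · rw [Vp_some, map_sub, map_smul, h2 i (Finset.mem_eraseNone.2 hi),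
          hu i (Finset.mem_coe.2 (Finset.mem_eraseNone.2 hi))]
        simp
      · rintro (_ | j) hj hne
        · rw [Vp_none, map_sub, map_smul, smul_eq_mul]; field_simp; ring
        · rw [Vp_some, map_sub, map_smul, h2 j (Finset.mem_eraseNone.2 hj),
            hu j (Finset.mem_coe.2 (Finset.mem_eraseNone.2 hj))]
          have : j ≠ i := fun e => hne (by rw [e])
          simp [this]
    · refine ⟨u, ?_, ?_⟩
      · rw [Vp_some, hu i (Finset.mem_coe.2 (Finset.mem_eraseNone.2 hi))]; simp
      · rintro (_ | j) hj hne
        · exact absurd hj hT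
        · rw [Vp_some, hu j (Finset.mem_coe.2 (Finset.mem_eraseNone.2 hj))]
          have : j ≠ i := fun e => hne (by rw [e])
          simp [this]

/-- noncritical value -/
def NC (V : ι → Dual ℝ E) (c : ι → ℝ) (y : Dual ℝ E) (t : ℝ) : Prop := ∀ v, IsVert V c v → y v ≠ t

lemma simple_p (hS : Simple V c) (hC : Cone V) {t : ℝ} (ht : NC V c y t) :
    Simple (Vp V y) (cp c t) := by
  intro x hx
  rw [InP_p] at hx
  apply LIp
  · refine (hS x hx.2).mono ?_
    intro i hi
    exact some_mem_act.1 (Finset.mem_eraseNone.1 (Finset.mem_coe.1 hi))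
  · intro hn
    obtain ⟨z, h1, h2, h3⟩ := vertex_lemma hS hC y x hx.2
    refine ⟨z - x, ?_, ?_⟩
    · rw [map_sub, none_mem_act.1 hn]
      exact sub_ne_zero.2 (ht z h1)
    · intro i hi
      have hi' := some_mem_act.1 (Finset.mem_eraseNone.1 hi)
      rw [map_sub, mem_act.1 hi', mem_act.1 (h2 hi'), sub_self]

lemma cone_p (hC : Cone V) : Cone (Vp V y) := fun x hx => hC x fun i => hx (some i)

lemma Bl_vert (hS : Simple V c) (hC : Cone V) {t : ℝ} {τ : Finset ι} :
    Bl V c y t τ ↔ ∃ v, IsVert V c v ∧ τ ⊆ act V c v ∧ y v < t := by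
  constructor
  · rintro ⟨x, h1, h2, h3⟩
    obtain ⟨z, h4, h5, h6⟩ := vertex_lemma hS hC y x h1
    exact ⟨z, h4, h2.trans h5, h6.trans_lt h3⟩
  · rintro ⟨v, h1, h2, h3⟩
    exact ⟨v, h1.1, h2, h3⟩

lemma Ab_vert (hS : Simple V c) (hC : Cone V) {t : ℝ} {τ : Finset ι} :
    Ab V c y t τ ↔ ∃ v, IsVert V c v ∧ τ ⊆ act V c v ∧ t < y v := by
  constructor
  · rintro ⟨x, h1, h2, h3⟩
    obtain ⟨z, h4, h5, h6⟩ := vertex_lemma' hS hC y x h1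
    exact ⟨z, h4, h2.trans h5, h3.trans_le h6⟩
  · rintro ⟨v, h1, h2, h3⟩
    exact ⟨v, h1.1, h2, h3⟩

lemma Fc_p (hS : Simple V c) (hC : Cone V) {t : ℝ} (ht : NC V c y t) (T : Finset (Option ι)) :
    Fc (Vp V y) (cp c t) T ↔ Bl V c y t T.eraseNone ∧ (none ∈ T → Ab V c y t T.eraseNone) := by
  constructor
  · rintro ⟨x, hx, hT⟩
    rw [InP_p] at hx
    rw [sub_act] at hT
    obtain ⟨z, h4, h5, h6⟩ := vertex_lemma hS hC y x hx.2
    obtain ⟨z', h4', h5', h6'⟩ := vertex_lemma' hS hC y x hx.2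
    refine ⟨⟨z, h4.1, hT.2.trans h5, lt_of_le_of_ne (h6.trans hx.1) (ht z h4)⟩, fun hn => ?_⟩
    refine ⟨z', h4'.1, hT.2.trans h5', lt_of_le_of_ne ?_ (ht z' h4').symm⟩
    rw [← hT.1 hn]; exact h6'
  · rintro ⟨⟨x, h1, h2, h3⟩, h⟩
    by_cases hn : none ∈ T
    · obtain ⟨x', h1', h2', h3'⟩ := h hn
      obtain ⟨z, hz1, hz2, hz3⟩ := exact_cross hS y h1 h2 h1' h2' h3 h3'
      exact ⟨z, InP_p.2 ⟨hz3.le, hz1⟩, sub_act.2 ⟨fun _ => hz3, hz2 ▸ subset_rfl⟩⟩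
    · exact ⟨x, InP_p.2 ⟨h3.le, h1⟩, sub_act.2 ⟨fun h => absurd h hn, h2⟩⟩

lemma vol_of_LP (hS : Simple V c) (hC : Cone V) {t : ℝ} (ht : NC V c y t)
    {L : MvPolynomial (Option ι) ℝ →ₗ[ℝ] ℝ} (h : LP (Vp V y) (Fc (Vp V y) (cp c t)) L) :
    IsVol (Vp V y) (cp c t) L :=
  ⟨simple_p hS hC ht, cone_p hC, h.deg, h.nonface, h.theta, h.pos⟩

lemma vol_move (hS : Simple V c) (hC : Cone V) {t t' : ℝ}
    (h : ∀ v, IsVert V c v → (y v < t ∧ y v < t') ∨ (t < y v ∧ t' < y v))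
    {L : MvPolynomial (Option ι) ℝ →ₗ[ℝ] ℝ} (hL : IsVol (Vp V y) (cp c t) L) :
    IsVol (Vp V y) (cp c t') L := by
  have h1 : NC V c y t := fun v hv e => by rcases h v hv with h | h <;> linarith [h.1]
  have h2 : NC V c y t' := fun v hv e => by rcases h v hv with h | h <;> linarith [h.2]
  have hb : ∀ τ, Bl V c y t τ ↔ Bl V c y t' τ := by
    intro τ
    rw [Bl_vert hS hC, Bl_vert hS hC]
    refine exists_congr fun v => and_congr_right fun hv => and_congr_right fun _ => ?_
    rcases h v hv with h | h
    · exact ⟨fun _ => h.2, fun _ => h.1⟩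
    · exact ⟨fun h' => absurd h' h.1.le.not_gt, fun h' => absurd h' h.2.le.not_gt⟩
  have ha : ∀ τ, Ab V c y t τ ↔ Ab V c y t' τ := by
    intro τ
    rw [Ab_vert hS hC, Ab_vert hS hC]
    refine exists_congr fun v => and_congr_right fun hv => and_congr_right fun _ => ?_
    rcases h v hv with h | h
    · exact ⟨fun h' => absurd h' h.1.le.not_gt, fun h' => absurd h' h.2.le.not_gt⟩
    · exact ⟨fun _ => h.2, fun _ => h.1⟩
  have hf : Fc (Vp V y) (cp c t) = Fc (Vp V y) (cp c t') := by
    funext T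
    rw [eq_iff_iff, Fc_p hS hC h1, Fc_p hS hC h2, hb, ha]
  refine vol_of_LP hS hC h2 ?_
  rw [← hf]
  exact ⟨hL.deg, hL.nonface, hL.theta, hL.pos⟩

end Sweep
end JKM

namespace JKM
open Module

section Cross
variable {ι : Type} [Fintype ι] [DecidableEq ι]
variable {E : Type} [AddCommGroup E] [Module ℝ E] [FiniteDimensional ℝ E]
variable {V : ι → Dual ℝ E} {c : ι → ℝ} {y : Dual ℝ E}
variable {Y : ι → ℝ} {x₀ : E}

noncomputable def lamp (V : ι → Dual ℝ E) (c : ι → ℝ) (Y : ι → ℝ) (x₀ : E) : Option ι → ℝ :=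
  fun o => o.elim 1 fun i => if i ∈ act V c x₀ then - Y i else 0
noncomputable def Ap (V : ι → Dual ℝ E) (c : ι → ℝ) (Y : ι → ℝ) (x₀ : E) : Finset (Option ι) :=
  Finset.insertNone ((act V c x₀).filter fun i => Y i < 0)
noncomputable def Bp (V : ι → Dual ℝ E) (c : ι → ℝ) (Y : ι → ℝ) (x₀ : E) : Finset (Option ι) :=
  ((act V c x₀).filter fun i => 0 < Y i).map Function.Embedding.some

/-- wall data -/
structure WD (V : ι → Dual ℝ E) (c : ι → ℝ) (y : Dual ℝ E) (Y : ι → ℝ) (x₀ : E) (t₁ t₂ : ℝ) : Prop where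
  simple : Simple V c
  cone : Cone V
  vert : IsVert V c x₀
  exp : y = ∑ i ∈ act V c x₀, Y i • V i
  ne : ∀ i ∈ act V c x₀, Y i ≠ 0
  lt₁ : t₁ < y x₀
  lt₂ : y x₀ < t₂
  crit : ∀ v, IsVert V c v → y v < t₁ ∨ v = x₀ ∨ t₂ < y v

variable {t₁ t₂ : ℝ} (H : WD V c y Y x₀ t₁ t₂)
include H

lemma WD.nc {t : ℝ} (h1 : t₁ ≤ t) (h2 : t ≤ t₂) (h : t ≠ y x₀) : NC V c y t := by
  intro v hv e
  rcases H.crit v hv with h' | h' | h'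
  · linarith
  · exact h (by rw [← e, h'])
  · linarith

lemma WD.bl₁ (τ : Finset ι) : Bl V c y t₁ τ ↔ Bl V c y (y x₀) τ := by
  rw [Bl_vert H.simple H.cone, Bl_vert H.simple H.cone]
  refine exists_congr fun v => and_congr_right fun hv => and_congr_right fun _ => ?_
  have := H.lt₁
  rcases H.crit v hv with h' | h' | h'
  · exact ⟨fun _ => by linarith, fun _ => h'⟩
  · subst h'; exact ⟨fun _ => by linarith, fun _ => by linarith⟩
  · have := H.lt₂; exact ⟨fun _ => by linarith, fun _ => by linarith⟩

lemma WD.ab₂ (τ : Finset ι) : Ab V c y t₂ τ ↔ Ab V c y (y x₀) τ := by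
  rw [Ab_vert H.simple H.cone, Ab_vert H.simple H.cone]
  refine exists_congr fun v => and_congr_right fun hv => and_congr_right fun _ => ?_
  have := H.lt₂
  have := H.lt₁
  rcases H.crit v hv with h' | h' | h'
  · exact ⟨fun _ => by linarith, fun _ => by linarith⟩
  · subst h'; exact ⟨fun _ => by linarith, fun _ => by linarith⟩
  · exact ⟨fun _ => by linarith, fun _ => by linarith⟩

lemma WD.bl₂ (τ : Finset ι) : Bl V c y t₂ τ ↔ Bl V c y (y x₀) τ ∨ τ ⊆ act V c x₀ := by
  have := H.lt₂
  constructor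
  · rw [Bl_vert H.simple H.cone]
    rintro ⟨v, h1, h2, h3⟩
    rcases H.crit v h1 with h' | h' | h'
    · exact Or.inl ⟨v, h1.1, h2, h'.trans H.lt₁⟩
    · subst h'; exact Or.inr h2
    · linarith
  · rintro (⟨x, h1, h2, h3⟩ | h)
    · exact ⟨x, h1, h2, by linarith⟩
    · exact ⟨x₀, H.vert.1, h, H.lt₂⟩

lemma WD.ab₁ (τ : Finset ι) : Ab V c y t₁ τ ↔ Ab V c y (y x₀) τ ∨ τ ⊆ act V c x₀ := by
  have := H.lt₁
  constructor
  · rw [Ab_vert H.simple H.cone]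
    rintro ⟨v, h1, h2, h3⟩
    rcases H.crit v h1 with h' | h' | h'
    · linarith
    · subst h'; exact Or.inr h2
    · exact Or.inl ⟨v, h1.1, h2, H.lt₂.trans h'⟩
  · rintro (⟨x, h1, h2, h3⟩ | h)
    · exact ⟨x, h1, h2, by linarith⟩
    · exact ⟨x₀, H.vert.1, h, H.lt₁⟩

lemma WD.fc₁ (T : Finset (Option ι)) : Fc (Vp V y) (cp c t₁) T ↔ Bl V c y (y x₀) T.eraseNone ∧
    (none ∈ T → Ab V c y (y x₀) T.eraseNone ∨ T.eraseNone ⊆ act V c x₀) := by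
  rw [Fc_p H.simple H.cone (H.nc le_rfl (H.lt₁.trans H.lt₂).le H.lt₁.ne), H.bl₁, H.ab₁]

lemma WD.fc₂ (T : Finset (Option ι)) : Fc (Vp V y) (cp c t₂) T ↔
    (Bl V c y (y x₀) T.eraseNone ∨ T.eraseNone ⊆ act V c x₀) ∧
    (none ∈ T → Ab V c y (y x₀) T.eraseNone) := by
  rw [Fc_p H.simple H.cone (H.nc (H.lt₁.trans H.lt₂).le le_rfl H.lt₂.ne'), H.bl₂, H.ab₂]

lemma WD.B_sub {T : Finset (Option ι)} (h1 : ¬ Bl V c y (y x₀) T.eraseNone)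
    (h2 : T.eraseNone ⊆ act V c x₀) : Bp V c Y x₀ ⊆ T := by
  intro o ho
  rw [Bp, Finset.mem_map] at ho
  obtain ⟨i, hi, rfl⟩ := ho
  rw [Finset.mem_filter] at hi
  by_contra hn
  exact h1 (Bl_of H.simple H.vert.1 H.exp h2 hi.1 (fun h => hn (Finset.mem_eraseNone.1 h)) hi.2)

lemma WD.A_sub {T : Finset (Option ι)} (h0 : none ∈ T) (h1 : ¬ Ab V c y (y x₀) T.eraseNone)
    (h2 : T.eraseNone ⊆ act V c x₀) : Ap V c Y x₀ ⊆ T := by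
  intro o ho
  rcases o with _ | i
  · exact h0
  · rw [Ap, Finset.some_mem_insertNone, Finset.mem_filter] at ho
    by_contra hn
    exact h1 (Ab_of H.simple H.vert.1 H.exp h2 ho.1 (fun h => hn (Finset.mem_eraseNone.1 h)) ho.2)

lemma WD.some_mem {i : ι} : some i ∈ Ap V c Y x₀ ∪ Bp V c Y x₀ ↔ i ∈ act V c x₀ := by
  rw [Finset.mem_union, Ap, Bp, Finset.some_mem_insertNone]
  simp only [Finset.mem_filter, Finset.mem_map, Function.Embedding.some_apply, Option.some.injEq,
    exists_eq_right]
  constructor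
  · rintro (h | h)
    · exact h.1
    · exact h.1
  · intro h
    rcases (H.ne i h).lt_or_gt with h' | h'
    · exact Or.inl ⟨h, h'⟩
    · exact Or.inr ⟨h, h'⟩

omit H in
lemma none_mem_A : none ∈ Ap V c Y x₀ := Finset.none_mem_insertNone

lemma WD.sub_C {T : Finset (Option ι)} (h : T.eraseNone ⊆ act V c x₀) : T ⊆ Ap V c Y x₀ ∪ Bp V c Y x₀ := by
  rintro (_ | i) hi
  · exact Finset.mem_union_left _ none_mem_A
  · exact H.some_mem.2 (h (Finset.mem_eraseNone.2 hi))

lemma WD.erase_sub (o : Option ι) :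
    ((Ap V c Y x₀ ∪ Bp V c Y x₀).erase o).eraseNone ⊆ act V c x₀ := by
  intro i hi
  rw [Finset.mem_eraseNone] at hi
  exact H.some_mem.1 (Finset.mem_of_mem_erase hi)

lemma WD.flip : Flip (Vp V y) (Fc (Vp V y) (cp c t₁)) (Fc (Vp V y) (cp c t₂))
    (lamp V c Y x₀) (Ap V c Y x₀) (Bp V c Y x₀) where
  mono₁ := fun _ _ h hs => h.mono hs
  mono₂ := fun _ _ h hs => h.mono hs
  disj := by
    rw [Finset.disjoint_left]
    rintro (_ | i) h1 h2
    · rw [Bp, Finset.mem_map] at h2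
      obtain ⟨i, _, h⟩ := h2
      simp at h
    · rw [Ap, Finset.some_mem_insertNone, Finset.mem_filter] at h1
      simp only [Bp, Finset.mem_filter, Finset.mem_map, Function.Embedding.some_apply,
        Option.some.injEq, exists_eq_right] at h2
      linarith [h1.2, h2.2]
  card := by
    rw [Ap, Bp, Finset.card_insertNone, Finset.card_map, ← H.vert.2]
    have : (act V c x₀).filter (fun i => 0 < Y i) = (act V c x₀).filter (fun i => ¬ Y i < 0) := by
      refine Finset.filter_congr fun i hi => ?_
      have := H.ne i hi
      constructor
      · intro h; linarith
      · intro h; exact lt_of_le_of_ne (not_lt.1 h) this.symm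
    rw [this]
    have := Finset.card_filter_add_card_filter_not (s := act V c x₀) (fun i => Y i < 0)
    omega
  posA := by
    rintro (_ | i) hi
    · simp [lamp]
    · rw [Ap, Finset.some_mem_insertNone, Finset.mem_filter] at hi
      simp [lamp, hi.1, hi.2]
  negB := by
    intro o ho
    rw [Bp, Finset.mem_map] at ho
    obtain ⟨i, hi, rfl⟩ := ho
    rw [Finset.mem_filter] at hi
    simp [lamp, hi.1, hi.2]
  zero := by
    rintro (_ | i) h1 h2
    · exact absurd none_mem_A h1
    · have : i ∉ act V c x₀ := by
        rw [← H.some_mem, Finset.mem_union]; tauto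
      simp [lamp, this]
  ne := ⟨none, none_mem_A⟩
  dep := by
    intro u
    rw [Fintype.sum_option]
    have h := congrArg (fun f => f u) H.exp
    simp only [LinearMap.sum_apply, LinearMap.smul_apply, smul_eq_mul] at h
    simp only [Vp_none, Vp_some, lamp, Option.elim]
    rw [h]
    simp only [mul_ite, mul_zero, Finset.sum_ite_mem, Finset.univ_inter, mul_one]
    rw [← Finset.sum_add_distrib]
    exact Finset.sum_eq_zero fun i _ => by ring
  rel := by
    intro m hm h
    have hm' : ∀ i ∉ act V c x₀, m (some i) = 0 := by
      intro i hi
      rw [← H.some_mem, Finset.mem_union, not_or] at hi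
      exact hm _ hi.1 hi.2
    have hli := H.simple x₀ H.vert.1
    rw [linearIndepOn_finset_iff] at hli
    have h0 := hli (fun i => m none * Y i + m (some i)) (by
      ext u
      have hu := h u
      rw [Fintype.sum_option] at hu
      have h := congrArg (fun f => f u) H.exp
      simp only [LinearMap.sum_apply, LinearMap.smul_apply, smul_eq_mul] at h
      simp only [Vp_none, Vp_some] at hu
      rw [h, ← Finset.sum_subset (Finset.subset_univ (act V c x₀)) (fun i _ hi => by
        rw [hm' i hi, mul_zero]), Finset.sum_mul, ← Finset.sum_add_distrib] at hu
      simp only [LinearMap.sum_apply, LinearMap.smul_apply, smul_eq_mul, LinearMap.zero_apply]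
      rw [← hu]
      exact Finset.sum_congr rfl fun i _ => by ring)
    refine ⟨m none, ?_⟩
    rintro (_ | i)
    · simp [lamp]
    · by_cases hi : i ∈ act V c x₀
      · have := h0 i hi
        simp only [lamp, Option.elim, hi, if_true]
        linarith
      · simp [lamp, hi, hm' i hi]
  B₁ := by
    rw [H.fc₁]
    rintro ⟨h, -⟩
    obtain ⟨i, h1, h2, h3⟩ := not_Bl H.exp h
    exact h3 (Finset.mem_eraseNone.2 (Finset.mem_map.2 ⟨i, Finset.mem_filter.2 ⟨h1, h2⟩, rfl⟩))
  A₂ := by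
    rw [H.fc₂]
    rintro ⟨-, h⟩
    obtain ⟨i, h1, h2, h3⟩ := not_Ab H.exp (h none_mem_A)
    exact h3 (Finset.mem_eraseNone.2 (Finset.some_mem_insertNone.2 (Finset.mem_filter.2 ⟨h1, h2⟩)))
  d₁₂ := by
    intro τ h1 h2
    rw [H.fc₁] at h1
    rw [H.fc₂] at h2
    refine H.sub_C ?_
    tauto
  d₂₁ := by
    intro τ h2 h1
    rw [H.fc₁] at h1
    rw [H.fc₂] at h2
    refine H.sub_C ?_
    tauto
  a₁₂ := by
    intro τ h1 h2
    rw [H.fc₁] at h1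
    rw [H.fc₂] at h2
    refine H.A_sub ?_ ?_ ?_ <;> tauto
  f₁ := by
    intro o ho
    rw [H.fc₁]
    refine ⟨?_, fun _ => Or.inr (H.erase_sub o)⟩
    rw [Bp, Finset.mem_map] at ho
    obtain ⟨i, hi, rfl⟩ := ho
    rw [Finset.mem_filter] at hi
    exact Bl_of H.simple H.vert.1 H.exp (H.erase_sub _) hi.1 (by
      rw [Finset.mem_eraseNone]; exact Finset.notMem_erase _ _) hi.2
  f₂ := by
    intro o ho
    rw [H.fc₂]
    refine ⟨Or.inr (H.erase_sub o), fun hn => ?_⟩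
    rcases o with _ | i
    · exact absurd hn (Finset.notMem_erase _ _)
    · rw [Ap, Finset.some_mem_insertNone, Finset.mem_filter] at ho
      exact Ab_of H.simple H.vert.1 H.exp (H.erase_sub _) ho.1 (by
        rw [Finset.mem_eraseNone]; exact Finset.notMem_erase _ _) ho.2

lemma WD.nondeg (T : Finset (Option ι)) (h1 : Bl V c y (y x₀) T.eraseNone)
    (h2 : none ∈ T → Ab V c y (y x₀) T.eraseNone) :
    (LinearIndepOn ℝ (Vp V y) (T : Set (Option ι)) ∧
    ∃ x, (∀ i ∈ T, Vp V y i x = cp c (y x₀) i) ∧ ∀ i ∉ T, Vp V y i x < cp c (y x₀) i) := by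
  obtain ⟨x, hx, hs, hlt⟩ := h1
  have hli : LinearIndepOn ℝ V (T.eraseNone : Set ι) :=
    (H.simple x hx).mono (Finset.coe_subset.2 hs)
  have aux : ∀ z, InP V c z → act V c z = T.eraseNone → (none ∈ T → y z = y x₀) →
      (none ∉ T → y z < y x₀) → ∃ x, (∀ i ∈ T, Vp V y i x = cp c (y x₀) i) ∧
        ∀ i ∉ T, Vp V y i x < cp c (y x₀) i := by
    intro z hz ha h1 h2
    refine ⟨z, ?_, ?_⟩
    · rintro (_ | i) hi
      · exact h1 hi
      · have := Finset.mem_eraseNone.2 hi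
        rw [← ha] at this
        have h3 := mem_act.1 this
        exact h3
    · rintro (_ | i) hi
      · exact h2 hi
      · refine lt_of_le_of_ne (hz i) fun e => hi ?_
        rw [← Finset.mem_eraseNone, ← ha]
        exact mem_act.2 e
  by_cases hn : none ∈ T
  · obtain ⟨x', hx', hs', hlt'⟩ := h2 hn
    obtain ⟨z, hz1, hz2, hz3⟩ := exact_cross H.simple y hx hs hx' hs' hlt hlt'
    refine ⟨LIp hli fun _ => ⟨x' - x, ?_, ?_⟩, aux z hz1 hz2 (fun _ => hz3) (fun h => absurd hn h)⟩
    · rw [map_sub]; linarith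
    · intro i hi
      rw [map_sub, mem_act.1 (hs hi), mem_act.1 (hs' hi), sub_self]
  · obtain ⟨z, hz1, hz2, hz3⟩ := exact_below H.simple y hx hs hlt
    exact ⟨LIp hli fun h => absurd h hn, aux z hz1 hz2 (fun h => absurd h hn) fun _ => hz3⟩

lemma WD.sum_lam (t : ℝ) : ∑ i, lamp V c Y x₀ i * cp c t i = t - y x₀ := by
  rw [Fintype.sum_option]
  simp only [lamp, Option.elim, cp_none, cp_some, ite_mul, zero_mul, one_mul, Finset.sum_ite_mem,
    Finset.univ_inter]
  have h := congrArg (fun f => f x₀) H.exp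
  simp only [LinearMap.sum_apply, LinearMap.smul_apply, smul_eq_mul] at h
  rw [h, sub_eq_add_neg, ← Finset.sum_neg_distrib]
  congr 1
  exact Finset.sum_congr rfl fun i hi => by rw [mem_act.1 hi]; ring

end Cross
end JKM

namespace JKM
open Module

section Step
variable {ι : Type} [Fintype ι] [DecidableEq ι]
variable {E : Type} [AddCommGroup E] [Module ℝ E] [FiniteDimensional ℝ E]
variable {V : ι → Dual ℝ E} {c : ι → ℝ} {y : Dual ℝ E}
variable {Y : ι → ℝ} {x₀ : E} {t₁ t₂ : ℝ}

lemma IsVol.lp {V : ι → Dual ℝ E} {c : ι → ℝ} {L : MvPolynomial ι ℝ →ₗ[ℝ] ℝ} (h : IsVol V c L) :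
    LP V (Fc V c) L := ⟨h.deg, h.nonface, h.theta, h.pos⟩

lemma WD.sum_single (r : ℝ) : 
    ∑ i, lamp V c Y x₀ i * (Pi.single none r : Option ι → ℝ) i = r := by
  rw [Fintype.sum_option]; simp [lamp]

lemma WD.step (H : WD V c y Y x₀ t₁ t₂) {L : MvPolynomial (Option ι) ℝ →ₗ[ℝ] ℝ}
    (hL : IsVol (Vp V y) (cp c t₁) L) (hI : ∀ T, HRI (finrank ℝ E) (cp c t₁) L T) :
    ∃ L', IsVol (Vp V y) (cp c t₂) L' ∧ ∀ T, HRI (finrank ℝ E) (cp c t₂) L' T := by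
  have F := H.flip
  obtain ⟨κ, hκ, hA⟩ := F.kappa hL.lp
  have hL₂ := F.L₂ hL.lp hκ hA
  have hV₂ := vol_of_LP H.simple H.cone (H.nc (H.lt₁.trans H.lt₂).le le_rfl H.lt₂.ne') hL₂
  set L' := L + (-κ) • ev (finrank ℝ E) (lamp V c Y x₀) with hL'
  have hall₁ : ∀ t, t₁ ≤ t → t < y x₀ → IsVol (Vp V y) (cp c t) L := by
    intro t h1 h2
    refine vol_move H.simple H.cone (fun v hv => ?_) hL
    rcases H.crit v hv with h | h | h
    · left; constructor <;> linarith
    · subst h; right; constructor <;> linarith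
    · right; have := H.lt₂; constructor <;> linarith
  have hall₂ : ∀ t, y x₀ < t → t ≤ t₂ → IsVol (Vp V y) (cp c t) L' := by
    intro t h1 h2
    refine vol_move H.simple H.cone (fun v hv => ?_) hV₂
    rcases H.crit v hv with h | h | h
    · left; have := H.lt₁; constructor <;> linarith
    · subst h; left; constructor <;> linarith
    · right; constructor <;> linarith
  have hcI : ∀ s r : ℝ, cp c 0 + s • (Pi.single none r : Option ι → ℝ) = cp c (s * r) := by
    intro s r; rw [cp_add, zero_add]
  have hI₁ : ∀ t, t₁ ≤ t → t < y x₀ → ∀ T, HRI (finrank ℝ E) (cp c t) L T := by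
    have := interval_thm (V := Vp V y) (c := cp c 0) (η := Pi.single none 1) (L := L)
      (I := Set.Ico t₁ (y x₀)) isPreconnected_Ico
      (fun s hs => by rw [hcI, mul_one]; exact hall₁ s hs.1 hs.2) (s₀ := t₁) ⟨le_rfl, H.lt₁⟩
      (by rw [hcI, mul_one]; exact hI)
    intro t h1 h2
    have h := this t ⟨h1, h2⟩
    rwa [hcI, mul_one] at h
  have ev₁ : ∀ᶠ s : ℝ in nhdsWithin 0 (Set.Ioi 0), t₁ ≤ y x₀ + s * (-1) ∧ y x₀ + s * (-1) < y x₀ := by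
    filter_upwards [Ioo_mem_nhdsGT (sub_pos.2 H.lt₁)] with s hs
    obtain ⟨h1, h2⟩ := hs
    constructor <;> linarith
  have ev₂ : ∀ᶠ s : ℝ in nhdsWithin 0 (Set.Ioi 0), y x₀ < y x₀ + s * 1 ∧ y x₀ + s * 1 ≤ t₂ := by
    filter_upwards [Ioo_mem_nhdsGT (sub_pos.2 H.lt₂)] with s hs
    obtain ⟨h1, h2⟩ := hs
    constructor <;> linarith
  have S₁ : Side (Vp V y) (cp c (y x₀)) (Pi.single none (-1)) L (lamp V c Y x₀) (Ap V c Y x₀)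
      (Bp V c Y x₀) κ :=
    { vol := by
        filter_upwards [ev₁] with s hs
        rw [cp_add]; exact hall₁ _ hs.1 hs.2
      disj := F.disj
      card := F.card
      posA := F.posA
      negB := F.negB
      zero := F.zero
      LB := hL.nonface _ F.B₁
      LA := hA
      sgn := hκ
      c0 := by rw [H.sum_lam, sub_self]
      eta := by rw [WD.sum_single]; norm_num
      nondeg := by
        intro T
        by_cases hT : Fc (Vp V y) (cp c t₁) T
        · right
          rw [H.fc₁] at hT
          by_cases hn : none ∈ T → Ab V c y (y x₀) T.eraseNone
          · exact Or.inr (H.nondeg T hT.1 hn)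
          · left
            refine H.A_sub ?_ ?_ ?_ <;> tauto
        · exact Or.inl (hL.nonface T hT) }
  have S₂ : Side (Vp V y) (cp c (y x₀)) (Pi.single none 1) L' (-lamp V c Y x₀) (Bp V c Y x₀)
      (Ap V c Y x₀) (-(-1) ^ (finrank ℝ E) * κ) :=
    { vol := by
        filter_upwards [ev₂] with s hs
        rw [cp_add]; exact hall₂ _ hs.1 hs.2
      disj := F.disj.symm
      card := by rw [add_comm]; exact F.card
      posA := fun i hi => by have := F.negB i hi; simpa using this
      negB := fun i hi => by have := F.posA i hi; simpa using this
      zero := fun i h1 h2 => by simp [F.zero i h2 h1]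
      LB := hL₂.nonface _ F.A₂
      LA := F.LB₂ hL.lp κ
      sgn := by
        have hc := F.card
        have h2 : ∀ n : ℕ, ((-1 : ℝ) ^ n) * (-1) ^ n = 1 := fun n => by rw [← mul_pow]; norm_num
        have e1 : ((-1 : ℝ) ^ ((Ap V c Y x₀).card)) * (-1) ^ (Bp V c Y x₀).card = -(-1) ^ (finrank ℝ E) := by
          rw [← pow_add, hc, pow_succ]; ring
        have : (-1 : ℝ) ^ ((Ap V c Y x₀).card + 1) * (-(-1) ^ (finrank ℝ E) * κ) =
            (-1) ^ ((Bp V c Y x₀).card + 1) * κ := by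
          rw [← e1, pow_succ, pow_succ]
          linear_combination (-κ * (-1) ^ (Bp V c Y x₀).card) * h2 (Ap V c Y x₀).card
        rw [this]; exact hκ
      c0 := by
        simp only [Pi.neg_apply, neg_mul, Finset.sum_neg_distrib]
        rw [H.sum_lam, sub_self, neg_zero]
      eta := by
        simp only [Pi.neg_apply, neg_mul, Finset.sum_neg_distrib]
        rw [WD.sum_single]; norm_num
      nondeg := by
        intro T
        by_cases hT : Fc (Vp V y) (cp c t₂) T
        · right
          rw [H.fc₂] at hT
          by_cases hn : Bl V c y (y x₀) T.eraseNone
          · exact Or.inr (H.nondeg T hn hT.2)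
          · left
            refine H.B_sub ?_ ?_ <;> tauto
        · exact Or.inl (hL₂.nonface T hT) }
  have hw := wall_cross S₁ S₂ (ε := -κ) (fun q => rfl) (by
    filter_upwards [ev₁] with s hs
    rw [cp_add]
    exact hI₁ _ hs.1 hs.2)
  obtain ⟨s, hs1, hs2⟩ := (hw.and ev₂).exists
  rw [cp_add] at hs1
  have := interval_thm (V := Vp V y) (c := cp c 0) (η := Pi.single none 1) (L := L')
      (I := Set.Ioc (y x₀) t₂) isPreconnected_Ioc
      (fun s hs => by rw [hcI, mul_one]; exact hall₂ s hs.1 hs.2) (s₀ := y x₀ + s * 1) hs2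
      (by rw [hcI, mul_one]; exact hs1) t₂ ⟨H.lt₂, le_rfl⟩
  rw [hcI, mul_one] at this
  exact ⟨L', hV₂, this⟩

lemma HRI_zero (d : ℕ) (c : ι → ℝ) (T : Finset ι) : HRI d c 0 T := by
  intro m k _
  refine negIdx_transfer _ _ _ _ 0 (fun x _ => by simp) (fun x _ => ?_)
  rw [smul_QF_apply, smul_QF_apply]; simp

lemma sweep {Y : E → ι → ℝ} (hS : Simple V c) (hC : Cone V) (hG : Gen V c y Y) :
    ∀ (N : ℕ) (t : ℝ), NC V c y t → ((vert_finite hS).toFinset.filter fun v => y v < t).card = N →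
    ∃ L, IsVol (Vp V y) (cp c t) L ∧ ∀ T, HRI (finrank ℝ E) (cp c t) L T := by
  intro N
  induction N using Nat.strong_induction_on with
  | _ N ih =>
  intro t ht hN
  set K := (vert_finite hS).toFinset.filter fun v => y v < t with hK
  have memK : ∀ v, v ∈ K ↔ IsVert V c v ∧ y v < t := by
    intro v; rw [hK, Finset.mem_filter, Set.Finite.mem_toFinset]; rfl
  rcases K.eq_empty_or_nonempty with h0 | hne
  · refine ⟨0, vol_of_LP hS hC ht ⟨by simp, by simp, by simp, ?_⟩, HRI_zero _ _⟩
    intro τ hτ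
    rw [Fc_p hS hC ht, Bl_vert hS hC] at hτ
    obtain ⟨⟨v, h1, h2, h3⟩, -⟩ := hτ
    have : v ∈ K := (memK v).2 ⟨h1, h3⟩
    rw [h0] at this; simp at this
  · obtain ⟨x₀, hx₀, hmax⟩ := K.exists_max_image (fun v => y v) hne
    have hx₀' := (memK x₀).1 hx₀
    -- a value below
    obtain ⟨t₁, h1, h2⟩ : ∃ t₁ < y x₀, ∀ v, IsVert V c v → y v < y x₀ → y v < t₁ := by
      have hf := (vert_finite hS)
      have : ∀ᶠ s in nhdsWithin (y x₀) (Set.Iio (y x₀)), ∀ v ∈ hf.toFinset, y v < y x₀ → y v < s := by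
        rw [Finset.eventually_all]
        intro v _
        by_cases hv : y v < y x₀
        · filter_upwards [Ioo_mem_nhdsLT hv] with s hs _
          exact hs.1
        · exact Filter.Eventually.of_forall fun s h => absurd h hv
      obtain ⟨s, hs1, hs2⟩ := (this.and self_mem_nhdsWithin).exists
      exact ⟨s, hs2, fun v hv => hs1 v (hf.mem_toFinset.2 hv)⟩
    have H : WD V c y (Y x₀) x₀ t₁ t :=
      { simple := hS
        cone := hC
        vert := hx₀'.1
        exp := hG.expand x₀ hx₀'.1
        ne := hG.ne x₀ hx₀'.1
        lt₁ := h1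
        lt₂ := hx₀'.2
        crit := by
          intro v hv
          rcases lt_trichotomy (y v) (y x₀) with h | h | h
          · exact Or.inl (h2 v hv h)
          · exact Or.inr (Or.inl (hG.inj v x₀ hv hx₀'.1 h))
          · refine Or.inr (Or.inr ?_)
            by_contra hn
            have := hmax v ((memK v).2 ⟨hv, lt_of_le_of_ne (not_lt.1 hn) (ht v hv)⟩)
            linarith }
    obtain ⟨L, hL, hI⟩ := ih _ (by
      rw [← hN]
      refine Finset.card_lt_card (Finset.ssubset_iff_subset_ne.2 ⟨?_, ?_⟩)
      · intro v hv
        rw [Finset.mem_filter, Set.Finite.mem_toFinset] at hv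
        exact (memK v).2 ⟨hv.1, hv.2.trans (h1.trans hx₀'.2)⟩
      · intro e
        rw [← e, Finset.mem_filter] at hx₀
        linarith [hx₀.2]) t₁ (H.nc le_rfl (h1.trans hx₀'.2).le h1.ne) rfl
    exact H.step hL hI

end Step
end JKM

namespace JKM
open Module

section Final
variable {ι : Type} [Fintype ι] [DecidableEq ι]
variable {E : Type} [AddCommGroup E] [Module ℝ E] [FiniteDimensional ℝ E]
variable {V : ι → Dual ℝ E} {c : ι → ℝ}

noncomputable def rho : MvPolynomial (Option ι) ℝ →ₐ[ℝ] MvPolynomial ι ℝ :=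
  aeval fun o => o.elim 0 X

omit [Fintype ι] [DecidableEq ι] in
lemma rho_rename (q : MvPolynomial ι ℝ) : rho (rename some q) = q := by
  simp only [rho, aeval_rename]
  have : (fun o : Option ι => o.elim (0 : MvPolynomial ι ℝ) X) ∘ some = X := rfl
  rw [this]; simp

omit [Fintype ι] [DecidableEq ι] in
lemma rho_spec (q : MvPolynomial (Option ι) ℝ) : ∃ r, q = rename some (rho q) + X none * r := by
  induction q using MvPolynomial.induction_on with
  | C a => exact ⟨0, by simp [rho, algebraMap_eq]⟩
  | add p q hp hq =>
    obtain ⟨r, hr⟩ := hp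
    obtain ⟨s, hs⟩ := hq
    refine ⟨r + s, ?_⟩
    rw [map_add, map_add]
    linear_combination hr + hs
  | mul_X p o hp =>
    obtain ⟨r, hr⟩ := hp
    rcases o with _ | i
    · refine ⟨p, ?_⟩
      simp [rho]; ring
    · refine ⟨r * X (some i), ?_⟩
      rw [map_mul, map_mul]
      have : rename some (rho (X (some i) : MvPolynomial (Option ι) ℝ)) = X (some i) := by
        simp [rho]
      rw [this]
      linear_combination X (some i) * hr

omit [Fintype ι] [DecidableEq ι] in
lemma rho_hom {q : MvPolynomial (Option ι) ℝ} {m : ℕ} (h : q.IsHomogeneous m) :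
    (rho q).IsHomogeneous m := by
  have := h.aeval (R := ℝ) (n := 1) (fun o : Option ι => o.elim (0 : MvPolynomial ι ℝ) X) (by
    rintro (_ | i)
    · exact isHomogeneous_zero _ _ _
    · exact isHomogeneous_X _ _)
  rwa [one_mul] at this

lemma rename_xm (τ : Finset ι) : rename some (xm τ) = xm (τ.map Function.Embedding.some) := by
  simp [xm]

lemma rho_lin (t : ℝ) : rho (lin (cp c t)) = lin c := by
  simp [rho, lin, Fintype.sum_option]

theorem exists_vol (hS : Simple V c) (hC : Cone V) :
    ∃ L, IsVol V c L ∧ ∀ T, HL (finrank ℝ E) c L T := by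
  obtain ⟨y, Y, hG⟩ := exists_gen hS
  obtain ⟨t, ht⟩ : ∃ t, ∀ v, IsVert V c v → y v < t := by
    obtain ⟨b, hb⟩ := ((vert_finite hS).image y).bddAbove
    refine ⟨b + 1, fun v hv => ?_⟩
    have := hb (Set.mem_image_of_mem y hv)
    linarith
  have hnc : NC V c y t := fun v hv => (ht v hv).ne
  obtain ⟨L, hL, hI⟩ := sweep hS hC hG _ t hnc rfl
  have hnone : ∀ q, L (X none * q) = 0 := by
    intro q
    have := hL.nonface {none} (by
      rw [Fc_p hS hC hnc]
      rintro ⟨-, h⟩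
      have := h (Finset.mem_singleton_self _)
      rw [Ab_vert hS hC] at this
      obtain ⟨v, h1, h2, h3⟩ := this
      exact absurd (ht v h1) h3.le.not_gt) q
    simpa [xm] using this
  let L' : MvPolynomial ι ℝ →ₗ[ℝ] ℝ := L.comp (rename some).toLinearMap
  have hL' : ∀ q, L' q = L (rename some q) := fun q => rfl
  have hLρ : ∀ q, L q = L' (rho q) := by
    intro q
    obtain ⟨r, hr⟩ := rho_spec q
    conv_lhs => rw [hr, map_add, hnone, add_zero]
    rfl
  have hFc : ∀ τ : Finset ι, Fc (Vp V y) (cp c t) (τ.map Function.Embedding.some) ↔ Fc V c τ := by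
    intro τ
    rw [Fc_p hS hC hnc]
    have e1 : (τ.map Function.Embedding.some).eraseNone = τ := Finset.eraseNone_map_some τ
    have e2 : none ∉ τ.map Function.Embedding.some := by simp
    rw [e1]
    constructor
    · rintro ⟨⟨x, h1, h2, h3⟩, -⟩; exact ⟨x, h1, h2⟩
    · rintro ⟨x, h1, h2⟩
      refine ⟨?_, fun h => absurd h e2⟩
      obtain ⟨z, h4, h5, h6⟩ := vertex_lemma hS hC y x h1
      exact ⟨z, h4.1, h2.trans h5, ht z h4⟩
  have hV : IsVol V c L' :=
    { simple := hS
      cone := hC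
      deg := by
        intro n q hq hn
        exact hL.deg n _ (hq.rename_isHomogeneous) hn
      nonface := by
        intro τ hτ q
        rw [hL', map_mul, rename_xm]
        exact hL.nonface _ (fun h => hτ ((hFc τ).1 h)) _
      theta := by
        intro u q
        have h := hL.theta u (rename some q)
        have : lin (fun i => Vp V y i u) = y u • X none + rename some (lin fun i => V i u) := by
          simp [lin, Fintype.sum_option]
        rw [this, add_mul, map_add, smul_mul_assoc, map_smul, hnone, smul_zero, zero_add] at h
        rw [hL', map_mul]; exact h
      pos := by
        intro τ hτ hc
        rw [hL', rename_xm]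
        exact hL.pos _ ((hFc τ).2 hτ) (by rw [Finset.card_map]; exact hc) }
  refine ⟨L', hV, HL_all hV ?_⟩
  intro T m k hmk
  have key : ∀ (a : ℝ) k q, (a • QF L (xm (T.map Function.Embedding.some) * lin (cp c t) ^ k)) q q =
      (a • QF L' (xm T * lin c ^ k)) (rho q) (rho q) := by
    intro a k q
    rw [smul_QF_apply, smul_QF_apply, hLρ, map_mul rho, map_mul rho, map_pow rho, map_mul rho, rho_lin, ← rename_xm,
      rho_rename]
  refine le_trans (negIdx_transfer _ ((-1 : ℝ) ^ (m+1) • QF L (xm (T.map Function.Embedding.some) *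
      lin (cp c t) ^ k)) _ (Em (Option ι) (m+1)) (rename some).toLinearMap
      (fun x hx => IsHomogeneous.rename_isHomogeneous hx) (fun x _ => ?_))
    (le_trans (hI (T.map Function.Embedding.some) m k (by rw [Finset.card_map]; exact hmk)) 
      (negIdx_transfer _ _ _ _ rho.toLinearMap (fun x hx => rho_hom hx) (fun x _ => key _ _ _)))
  rw [key]
  simp only [AlgHom.toLinearMap_apply, rho_rename]

end Final
end JKM

namespace JKM
open Module

section ShellAlg
variable {ι κ J : Type} [Fintype ι] [DecidableEq ι] [Fintype κ] [DecidableEq κ] [Fintype J]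
  [DecidableEq J]

/-- nonface ideal -/
noncomputable def NI (Γ : Finset ι → Prop) : Ideal (MvPolynomial ι ℝ) :=
  Ideal.span {p | ∃ τ, ¬ Γ τ ∧ p = xm τ}

lemma xm_mem_NI {Γ : Finset ι → Prop} {τ : Finset ι} (h : ¬ Γ τ) : xm τ ∈ NI Γ :=
  Ideal.subset_span ⟨τ, h, rfl⟩

structure Shell (Γ : Finset ι → Prop) (fac R : κ → Finset ι) (h : κ → ℝ) : Prop where
  fac_face : ∀ a τ, τ ⊆ fac a → Γ τ
  R_sub : ∀ a, R a ⊆ fac a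
  s1 : ∀ τ, Γ τ → ∃ a, R a ⊆ τ ∧ τ ⊆ fac a
  s2 : ∀ a b, R a ⊆ fac b → b = a ∨ h a < h b
  s3 : ∀ a b, fac a \ R a ⊆ fac b → b = a ∨ h b < h a

def LS (fac : κ → Finset ι) (M : J → ι → ℝ) : Prop :=
  ∀ a, ∃ t : ι → J → ℝ,
    (∀ i ∈ fac a, ∀ i' ∈ fac a, ∑ j, t i j * M j i' = if i = i' then 1 else 0) ∧
    (∀ j j', ∑ i ∈ fac a, M j i * t i j' = if j = j' then 1 else 0)

noncomputable def Phi (R : κ → Finset ι) (M : J → ι → ℝ) :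
    (κ → MvPolynomial J ℝ) →ₗ[ℝ] MvPolynomial ι ℝ :=
  ∑ a, (LinearMap.mulRight ℝ (xm (R a))).comp
    ((aeval fun j => lin (M j)).toLinearMap.comp (LinearMap.proj a))

omit [DecidableEq κ] [Fintype J] [DecidableEq J] in
lemma Phi_apply (R : κ → Finset ι) (M : J → ι → ℝ) (P : κ → MvPolynomial J ℝ) :
    Phi R M P = ∑ a, aeval (fun j => lin (M j)) (P a) * xm (R a) := by
  simp [Phi, LinearMap.sum_apply]

noncomputable def Gr (R : κ → Finset ι) (J : Type) (n : ℕ) : Submodule ℝ (κ → MvPolynomial J ℝ) :=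
  Submodule.pi Set.univ fun a => if (R a).card ≤ n then Em J (n - (R a).card) else ⊥

noncomputable def UU' (Γ : Finset ι → Prop) (R : κ → Finset ι) (M : J → ι → ℝ) (n : ℕ) :
    Submodule ℝ (MvPolynomial ι ℝ) :=
  (Gr R J n).map (Phi R M) ⊔ (NI Γ).restrictScalars ℝ

variable {Γ : Finset ι → Prop} {fac R : κ → Finset ι} {h : κ → ℝ} {M : J → ι → ℝ}

omit [Fintype ι] [DecidableEq ι] [Fintype κ] [DecidableEq κ] [DecidableEq J] [Fintype J] in
lemma mem_Gr {n : ℕ} {P : κ → MvPolynomial J ℝ} : P ∈ Gr R J n ↔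
    ∀ a, P a ∈ (if (R a).card ≤ n then Em J (n - (R a).card) else ⊥) := by
  simp [Gr, Submodule.mem_pi]

omit [Fintype ι] [DecidableEq ι] [Fintype κ] [DecidableEq κ] [DecidableEq J] [Fintype J] in
lemma Gr_mulX {n : ℕ} {P : κ → MvPolynomial J ℝ} (hP : P ∈ Gr R J n) (j : J) :
    (fun a => X j * P a) ∈ Gr R J (n + 1) := by
  rw [mem_Gr] at hP ⊢
  intro a
  have := hP a
  split_ifs at this with h1
  · rw [if_pos (by omega)]
    have h2 : (X j * P a).IsHomogeneous (1 + (n - (R a).card)) :=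
      (isHomogeneous_X ℝ j).mul this
    rwa [show 1 + (n - (R a).card) = n + 1 - (R a).card by omega] at h2
  · rw [(Submodule.mem_bot ℝ).1 this, mul_zero]
    exact Submodule.zero_mem _

lemma Phi_mulX (P : κ → MvPolynomial J ℝ) (j : J) :
    Phi R M (fun a => X j * P a) = lin (M j) * Phi R M P := by
  rw [Phi_apply, Phi_apply, Finset.mul_sum]
  refine Finset.sum_congr rfl fun a _ => ?_
  rw [map_mul, aeval_X, mul_assoc]

lemma U_mul {n : ℕ} {q : MvPolynomial ι ℝ} (hq : q ∈ UU' Γ R M n) (j : J) :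
    lin (M j) * q ∈ UU' Γ R M (n + 1) := by
  obtain ⟨_, ⟨P, hP, rfl⟩, r, hr, rfl⟩ := Submodule.mem_sup.1 hq
  rw [mul_add]
  refine Submodule.add_mem_sup ⟨_, Gr_mulX hP j, Phi_mulX P j⟩ ?_
  exact Ideal.mul_mem_left _ _ hr

lemma xm_eq (τ : Finset ι) : xm τ = monomial (∑ i ∈ τ, Finsupp.single i 1) (1 : ℝ) := by
  rw [xm]
  induction τ using Finset.induction_on with
  | empty => simp
  | insert a s ha ih =>
    rw [Finset.prod_insert ha, ih, Finset.sum_insert ha, X, monomial_mul, one_mul]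

lemma ind_apply (τ : Finset ι) (i : ι) :
    (∑ i ∈ τ, Finsupp.single i 1 : ι →₀ ℕ) i = if i ∈ τ then 1 else 0 := by
  rw [Finsupp.finset_sum_apply]
  simp [Finsupp.single_apply]

lemma ind_le {τ : Finset ι} {m : ι →₀ ℕ} (hτ : τ ⊆ m.support) :
    (∑ i ∈ τ, Finsupp.single i 1 : ι →₀ ℕ) ≤ m := by
  intro i
  rw [ind_apply]
  split_ifs with h
  · have := Finsupp.mem_support_iff.1 (hτ h); omega
  · omega

lemma monomial_split {τ : Finset ι} {m : ι →₀ ℕ} (hτ : τ ⊆ m.support) :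
    (monomial m (1 : ℝ)) = xm τ * monomial (m - ∑ i ∈ τ, Finsupp.single i 1) 1 := by
  rw [xm_eq, monomial_mul, one_mul, add_tsub_cancel_of_le (ind_le hτ)]

lemma monomial_mem_NI {m : ι →₀ ℕ} (hm : ¬ Γ m.support) : monomial m (1 : ℝ) ∈ NI Γ := by
  rw [monomial_split subset_rfl]
  exact Ideal.mul_mem_right _ _ (xm_mem_NI hm)

lemma hom_of_monomials {U : Submodule ℝ (MvPolynomial ι ℝ)} {n : ℕ}
    (hU : ∀ m : ι →₀ ℕ, m.degree = n → monomial m 1 ∈ U) {q : MvPolynomial ι ℝ}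
    (hq : q.IsHomogeneous n) : q ∈ U := by
  rw [q.as_sum]
  refine Submodule.sum_mem _ fun m hm => ?_
  have h1 : m.degree = n := by
    have := hq (mem_support_iff.1 hm)
    rw [Finsupp.degree_eq_weight_one]; exact this
  have h2 : monomial m (coeff m q) = coeff m q • monomial m (1 : ℝ) := by
    rw [smul_monomial, smul_eq_mul, mul_one]
  rw [h2]
  exact U.smul_mem _ (hU m h1)

lemma Phi_single (a : κ) (P : MvPolynomial J ℝ) :
    Phi R M (Pi.single a P) = aeval (fun j => lin (M j)) P * xm (R a) := by
  rw [Phi_apply, Finset.sum_eq_single a]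
  · simp
  · intro b _ hb; simp [Pi.single_eq_of_ne hb]
  · simp

theorem shell_span (H : Shell Γ fac R h) (hM : LS fac M) (n : ℕ) :
    ∀ q : MvPolynomial ι ℝ, q.IsHomogeneous n → q ∈ UU' Γ R M n := by
  induction n with
  | zero =>
    intro q hq
    refine hom_of_monomials (fun m hm => ?_) hq
    have hm0 : m = 0 := (Finsupp.degree_eq_zero_iff m).1 hm
    subst hm0
    by_cases hG : Γ ∅
    · obtain ⟨a, ha, -⟩ := H.s1 ∅ hG
      have ha : R a = ∅ := Finset.subset_empty.1 ha
      refine Submodule.mem_sup_left ⟨Pi.single a 1, ?_, ?_⟩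
      · rw [SetLike.mem_coe, mem_Gr]
        intro b
        by_cases hb : b = a
        · subst hb
          rw [Pi.single_eq_same, if_pos (by simp [ha])]
          rw [ha]; exact isHomogeneous_one _ _
        · rw [Pi.single_eq_of_ne hb]; exact Submodule.zero_mem _
      · rw [Phi_single, ha]; simp [xm]
    · exact Submodule.mem_sup_right (monomial_mem_NI (by simpa using hG))
  | succ n ih =>
    have key : ∀ r (a : κ), (Finset.univ.filter fun b => h a < h b).card = r → ∀ m : ι →₀ ℕ,
        m.degree = n + 1 → R a ⊆ m.support → m.support ⊆ fac a → monomial m 1 ∈ UU' Γ R M (n+1) := by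
      intro r
      induction r using Nat.strong_induction_on with
      | _ r ihr =>
      intro a hr m hm h1 h2
      by_cases h0 : m = ∑ i ∈ R a, Finsupp.single i 1
      · refine Submodule.mem_sup_left ⟨Pi.single a 1, ?_, ?_⟩
        · rw [SetLike.mem_coe, mem_Gr]
          intro b
          by_cases hb : b = a
          · subst hb
            have hc : (R b).card = n + 1 := by
              rw [h0] at hm
              simpa using hm
            rw [Pi.single_eq_same, if_pos hc.le, hc, Nat.sub_self]
            exact isHomogeneous_one _ _
          · rw [Pi.single_eq_of_ne hb]; exact Submodule.zero_mem _
        · rw [Phi_single, map_one, one_mul, xm_eq, ← h0]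
      · obtain ⟨i, hi⟩ : ∃ i, (∑ i ∈ R a, Finsupp.single i 1 : ι →₀ ℕ) i < m i := by
          by_contra hn
          push Not at hn
          exact h0 (le_antisymm hn (ind_le h1))
        rw [ind_apply] at hi
        have hi0 : 0 < m i := by omega
        have hifac : i ∈ fac a := h2 (Finsupp.mem_support_iff.2 hi0.ne')
        set m'' := m - Finsupp.single i 1 with hm''
        have hmm : m = m'' + Finsupp.single i 1 := by
          rw [hm'', tsub_add_cancel_of_le]
          rw [Finsupp.single_le_iff]; omega
        have hdeg : m''.degree = n := by
          rw [hmm, map_add, Finsupp.degree_single] at hm; omega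
        have hR : R a ⊆ m''.support := by
          intro j hj
          rw [Finsupp.mem_support_iff, hm'', Finsupp.tsub_apply, Finsupp.single_apply]
          have := Finsupp.mem_support_iff.1 (h1 hj)
          split_ifs with hij
          · subst hij; rw [if_pos hj] at hi; omega
          · omega
        have hU : monomial m'' (1 : ℝ) ∈ UU' Γ R M n := ih _ (by
          apply isHomogeneous_monomial; exact hdeg)
        obtain ⟨t, ht, -⟩ := hM a
        have e1 : (∑ j, t i j • (lin (M j) * monomial m'' (1 : ℝ))) =
            ∑ l, (∑ j, t i j * M j l) • (X l * monomial m'' (1 : ℝ)) := by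
          simp only [lin, Finset.sum_mul, Finset.smul_sum, Finset.sum_smul, smul_mul_assoc, smul_smul]
          rw [Finset.sum_comm]
        have e2 : monomial m (1 : ℝ) = (∑ j, t i j • (lin (M j) * monomial m'' (1 : ℝ))) -
            ∑ l ∈ Finset.univ.erase i, (∑ j, t i j * M j l) • (X l * monomial m'' (1 : ℝ)) := by
          rw [e1, ← Finset.add_sum_erase _ _ (Finset.mem_univ i), add_sub_cancel_right,
            ht i hifac i hifac, if_pos rfl, one_smul, X, monomial_mul, one_mul, add_comm, ← hmm]
        rw [e2]
        refine Submodule.sub_mem _ (Submodule.sum_mem _ fun j _ => Submodule.smul_mem _ _ (U_mul hU j))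
          (Submodule.sum_mem _ fun l hl => ?_)
        by_cases hlf : l ∈ fac a
        · rw [ht i hifac l hlf, if_neg (Finset.ne_of_mem_erase hl).symm, zero_smul]
          exact Submodule.zero_mem _
        · apply Submodule.smul_mem
          rw [X, monomial_mul, one_mul]
          set m₂ := Finsupp.single l 1 + m'' with hm₂
          by_cases hG : Γ m₂.support
          · obtain ⟨b, hb1, hb2⟩ := H.s1 _ hG
            have hsub : m''.support ⊆ m₂.support := by
              intro j hj
              rw [Finsupp.mem_support_iff] at hj ⊢
              rw [hm₂, Finsupp.add_apply]; omega
            have hl2 : l ∈ m₂.support := by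
              rw [Finsupp.mem_support_iff, hm₂, Finsupp.add_apply, Finsupp.single_eq_same]; omega
            rcases H.s2 a b (hR.trans (hsub.trans hb2)) with e | hlt
            · subst e; exact absurd (hb2 hl2) hlf
            · refine ihr _ ?_ b rfl m₂ (by rw [hm₂, map_add, Finsupp.degree_single, hdeg, add_comm]) hb1 hb2
              rw [← hr]
              refine Finset.card_lt_card (Finset.ssubset_iff_subset_ne.2 ⟨?_, ?_⟩)
              · intro x hx
                rw [Finset.mem_filter] at hx ⊢
                exact ⟨hx.1, hlt.trans hx.2⟩
              · intro e
                have : b ∈ Finset.univ.filter fun x => h a < h x := by simp [hlt]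
                rw [← e] at this
                simp at this
          · exact Submodule.mem_sup_right (monomial_mem_NI hG)
    intro q hq
    refine hom_of_monomials (fun m hm => ?_) hq
    by_cases hG : Γ m.support
    · obtain ⟨a, h1, h2⟩ := H.s1 _ hG
      exact key _ a rfl m hm h1 h2
    · exact Submodule.mem_sup_right (monomial_mem_NI hG)

theorem shell_free (H : Shell Γ fac R h) (hM : LS fac M) {P : κ → MvPolynomial J ℝ}
    (hP : Phi R M P ∈ NI Γ) : P = 0 := by
  by_contra hne
  have : (Finset.univ.filter fun a => P a ≠ 0).Nonempty := by
    obtain ⟨a, ha⟩ := Function.ne_iff.1 hne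
    exact ⟨a, by simpa using ha⟩
  obtain ⟨a, ha, hmin⟩ := Finset.exists_min_image _ h this
  rw [Finset.mem_filter] at ha
  obtain ⟨t, ht1, ht2⟩ := hM a
  let χ : MvPolynomial ι ℝ →ₐ[ℝ] MvPolynomial J ℝ :=
    aeval fun i => if i ∈ fac a then lin (t i) else 0
  have hχxm : ∀ τ : Finset ι, ¬ τ ⊆ fac a → χ (xm τ) = 0 := by
    intro τ hτ
    obtain ⟨i, hi, hn⟩ := Finset.not_subset.1 hτ
    rw [xm, map_prod]
    refine Finset.prod_eq_zero hi ?_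
    simp [χ, hn]
  have hχI : ∀ q ∈ NI Γ, χ q = 0 := by
    intro q hq
    have : NI Γ ≤ RingHom.ker χ := by
      rw [NI, Ideal.span_le]
      rintro _ ⟨τ, hτ, rfl⟩
      exact hχxm τ fun hs => hτ (H.fac_face a τ hs)
    exact this hq
  have hχM : ∀ j, χ (lin (M j)) = X j := by
    intro j
    have e : χ (lin (M j)) = ∑ i ∈ fac a, M j i • lin (t i) := by
      simp [χ, lin, Finset.smul_sum]
    rw [e]
    simp only [lin, Finset.smul_sum, smul_smul]
    rw [Finset.sum_comm]
    simp only [← Finset.sum_smul, ht2]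
    simp
  have hχP : ∀ p : MvPolynomial J ℝ, χ (aeval (fun j => lin (M j)) p) = p := by
    intro p
    have : χ.comp (aeval fun j => lin (M j)) = AlgHom.id ℝ _ := by
      ext j
      simp [hχM]
    exact congrArg (fun f => f p) this
  have h0 := hχI _ hP
  rw [Phi_apply, map_sum, Finset.sum_eq_single a] at h0
  · rw [map_mul, hχP] at h0
    rcases mul_eq_zero.1 h0 with h1 | h1
    · exact ha.2 h1
    · rw [xm, map_prod, Finset.prod_eq_zero_iff] at h1
      obtain ⟨i, hi, h1⟩ := h1
      have hif := H.R_sub a hi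
      have h2 : lin (t i) = 0 := by simpa [χ, hif] using h1
      have h3 := ht1 i hif i hif
      have h4 : ∀ j, t i j = 0 := by
        intro j
        have := congrArg (coeff (Finsupp.single j 1)) h2
        simpa [lin, coeff_sum, coeff_X', Finsupp.single_left_inj] using this
      simp [h4] at h3
  · intro b _ hb
    rw [map_mul, hχP]
    by_cases hPb : P b = 0
    · rw [hPb, zero_mul]
    · rw [hχxm, mul_zero]
      intro hs
      have h1 := hmin b (by simp [hPb])
      rcases H.s2 b a hs with e | e
      · exact hb e.symm
      · linarith
  · simp

/-- triangularity with respect to a functional -/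
theorem shell_tri (H : Shell Γ fac R h) (Λ : MvPolynomial ι ℝ →ₗ[ℝ] ℝ)
    (hΛ : ∀ q ∈ NI Γ, Λ q = 0) (hp : ∀ a, Λ (xm (fac a)) ≠ 0) (z : κ → ℝ)
    (h0 : ∀ g, Λ ((∑ a, z a • xm (R a)) * g) = 0) : z = 0 := by
  by_contra hne
  have : (Finset.univ.filter fun a => z a ≠ 0).Nonempty := by
    obtain ⟨a, ha⟩ := Function.ne_iff.1 hne
    exact ⟨a, by simpa using ha⟩
  obtain ⟨a, ha, hmin⟩ := Finset.exists_min_image _ h this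
  rw [Finset.mem_filter] at ha
  have h1 := h0 (xm (fac a \ R a))
  rw [Finset.sum_mul, map_sum, Finset.sum_eq_single a] at h1
  · rw [smul_mul_assoc, map_smul, ← xm_sdiff (H.R_sub a), smul_eq_mul] at h1
    rcases mul_eq_zero.1 h1 with h1 | h1
    · exact ha.2 h1
    · exact hp a h1
  · intro b _ hb
    by_cases hzb : z b = 0
    · rw [hzb, zero_smul, zero_mul, map_zero]
    · apply hΛ
      rw [smul_mul_assoc, smul_eq_C_mul]
      apply Ideal.mul_mem_left
      have e : xm (R b) * xm (fac a \ R a) = xm (R b ∪ (fac a \ R a)) * xm (R b ∩ (fac a \ R a)) := by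
        rw [xm, xm, xm, xm, Finset.prod_union_inter]
      rw [e]
      apply Ideal.mul_mem_right
      apply xm_mem_NI
      intro hG
      obtain ⟨f, -, hf⟩ := H.s1 _ hG
      have h2 := hmin b (by simp [hzb])
      rcases H.s2 b f (Finset.subset_union_left.trans hf) with e | e
      · rcases H.s3 a f (Finset.subset_union_right.trans hf) with e' | e'
        · exact hb (e.symm.trans e')
        · rw [e] at e'; linarith
      · rcases H.s3 a f (Finset.subset_union_right.trans hf) with e' | e'
        · rw [e'] at e; linarith
        · linarith
  · simp

end ShellAlg
end JKM

namespace JKM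
open Module

section GeomShell
variable {ι : Type} [Fintype ι] [DecidableEq ι]
variable {E : Type} [AddCommGroup E] [Module ℝ E] [FiniteDimensional ℝ E]
variable {V : ι → Dual ℝ E} {c : ι → ℝ}
variable {C : Type} [Fintype C] [DecidableEq C]

/-- the link of `F` restricted to colours in `S` -/
def LkS (V : ι → Dual ℝ E) (c : ι → ℝ) (col : ι → C) (S : Finset C) (F τ : Finset ι) : Prop :=
  Fc V c (τ ∪ F) ∧ ∀ i ∈ τ, col i ∈ S

/-- faces with colour set exactly the complement of `S` -/
def IsTop (V : ι → Dual ℝ E) (c : ι → ℝ) (col : ι → C) (S : Finset C) (F : Finset ι) : Prop :=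
  Fc V c F ∧ F.image col = Sᶜ

omit [FiniteDimensional ℝ E] in
lemma Fc_sub {x : E} (hx : InP V c x) {τ : Finset ι} (h : τ ⊆ act V c x) : Fc V c τ :=
  ⟨x, hx, h⟩

omit [FiniteDimensional ℝ E] in
lemma col_sdiff {col : ι → C} {S : Finset C} {F : Finset ι}
    (hcol : ∀ τ, Fc V c τ → Set.InjOn col (τ : Set ι)) (hF : F.image col = Sᶜ) {x : E}
    (hx : InP V c x) (hFx : F ⊆ act V c x) {i : ι} (hi : i ∈ act V c x) :
    i ∉ F ↔ col i ∈ S := by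
  constructor
  · intro hn
    by_contra hc
    have : col i ∈ F.image col := by rw [hF]; simpa using hc
    obtain ⟨f, hf, he⟩ := Finset.mem_image.1 this
    have := hcol _ (Fc_sub hx subset_rfl) (hFx hf) hi he
    exact hn (this ▸ hf)
  · intro hc hn
    have : col i ∈ F.image col := Finset.mem_image_of_mem _ hn
    rw [hF] at this
    simp at this; exact this hc

theorem exists_shell (hS : Simple V c) (hC : Cone V) {y : Dual ℝ E} {Y : E → ι → ℝ}
    (hG : Gen V c y Y) {col : ι → C} {S : Finset C} {F : Finset ι}
    (hcol : ∀ τ, Fc V c τ → Set.InjOn col (τ : Set ι)) (hF : IsTop V c col S F) :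
    ∃ (κ : Type) (_ : Fintype κ) (_ : DecidableEq κ) (pt : κ → E) (R : κ → Finset ι) (h : κ → ℝ),
      (∀ a, IsVert V c (pt a) ∧ F ⊆ act V c (pt a)) ∧
      Shell (LkS V c col S F) (fun a => act V c (pt a) \ F) R h := by
  classical
  have hfin : Set.Finite {x | IsVert V c x ∧ F ⊆ act V c x} :=
    (vert_finite hS).subset fun x hx => hx.1
  refine ⟨{x // IsVert V c x ∧ F ⊆ act V c x}, hfin.fintype, inferInstance, Subtype.val,
    fun x => (act V c x.1).filter (fun i => 0 < Y x.1 i) \ F, fun x => y x.1, fun a => a.2, ?_⟩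
  refine ⟨?_, ?_, ?_, ?_, ?_⟩
  · rintro ⟨x, hx, hFx⟩ τ hτ
    refine ⟨Fc_sub hx.1 (Finset.union_subset (hτ.trans Finset.sdiff_subset) hFx), fun i hi => ?_⟩
    have := Finset.mem_sdiff.1 (hτ hi)
    exact (col_sdiff hcol hF.2 hx.1 hFx this.1).1 this.2
  · rintro ⟨x, hx, hFx⟩
    exact Finset.sdiff_subset_sdiff (Finset.filter_subset _ _) subset_rfl
  · rintro τ ⟨⟨x, hx, hτ⟩, hcS⟩
    obtain ⟨z, hz, hxz, -⟩ := vertex_lemma hS hC y x hx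
    have hfin' : Set.Finite {x | IsVert V c x ∧ τ ∪ F ⊆ act V c x} :=
      (vert_finite hS).subset fun x hx => hx.1
    obtain ⟨w, ⟨hw, hwτ⟩, hmin⟩ := Set.exists_min_image _ (fun x => y x) hfin' ⟨z, hz, hτ.trans hxz⟩
    refine ⟨⟨w, hw, Finset.subset_union_right.trans hwτ⟩, ?_, ?_⟩
    · intro i hi
      obtain ⟨hi1, hi2⟩ := Finset.mem_sdiff.1 hi
      obtain ⟨hi1, hi3⟩ := Finset.mem_filter.1 hi1
      by_contra hiτ
      have hB := Bl_of hS hw.1 (hG.expand w hw) hwτ hi1 (by simp [hiτ, hi2]) hi3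
      obtain ⟨v, hv, hvτ, hlt⟩ := (Bl_vert hS hC).1 hB
      have := hmin v ⟨hv, hvτ⟩
      linarith
    · intro i hi
      refine Finset.mem_sdiff.2 ⟨hwτ (Finset.mem_union_left _ hi), ?_⟩
      exact (col_sdiff hcol hF.2 hw.1 (Finset.subset_union_right.trans hwτ)
        (hwτ (Finset.mem_union_left _ hi))).2 (hcS i hi)
  · rintro ⟨a, ha, hFa⟩ ⟨b, hb, hFb⟩ hab
    rcases lt_trichotomy (y a) (y b) with h | h | h
    · exact Or.inr h
    · left; exact Subtype.ext (hG.inj _ _ hb ha h.symm)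
    · exfalso
      obtain ⟨i, hi, hpos, hn⟩ := not_Bl (hG.expand a ha) (τ := act V c b) ⟨b, hb.1, subset_rfl, h⟩
      have hiF : i ∉ F := fun hh => hn (hFb hh)
      have := hab (Finset.mem_sdiff.2 ⟨Finset.mem_filter.2 ⟨hi, hpos⟩, hiF⟩)
      exact hn (Finset.mem_sdiff.1 this).1
  · rintro ⟨a, ha, hFa⟩ ⟨b, hb, hFb⟩ hab
    rcases lt_trichotomy (y b) (y a) with h | h | h
    · exact Or.inr h
    · left; exact Subtype.ext (hG.inj _ _ hb ha h)
    · exfalso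
      obtain ⟨i, hi, hpos, hn⟩ := not_Ab (hG.expand a ha) (τ := act V c b) ⟨b, hb.1, subset_rfl, h⟩
      have hiF : i ∉ F := fun hh => hn (hFb hh)
      have := hab (Finset.mem_sdiff.2 ⟨Finset.mem_sdiff.2 ⟨hi, hiF⟩, fun hh => by
        have := (Finset.mem_filter.1 (Finset.mem_sdiff.1 hh).1).2
        linarith⟩)
      exact hn (Finset.mem_sdiff.1 this).1

/-- every face with colours in `S` extends to a vertex; and tops exist below vertices. -/
lemma vert_top {col : ι → C} (S : Finset C) (hcol : ∀ τ, Fc V c τ → Set.InjOn col (τ : Set ι))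
    (hcard : Fintype.card C = finrank ℝ E) {x : E} (hx : IsVert V c x) :
    IsTop V c col S ((act V c x).filter fun i => col i ∉ S) := by
  refine ⟨Fc_sub hx.1 (Finset.filter_subset _ _), ?_⟩
  have himg : (act V c x).image col = Finset.univ := by
    rw [← Finset.card_eq_iff_eq_univ, Finset.card_image_of_injOn (hcol _ (Fc_sub hx.1 subset_rfl)),
      hx.2, hcard]
  ext j
  rw [Finset.mem_image, Finset.mem_compl]
  constructor
  · rintro ⟨i, hi, rfl⟩; exact (Finset.mem_filter.1 hi).2
  · intro hj
    have : j ∈ (act V c x).image col := by rw [himg]; simp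
    obtain ⟨i, hi, rfl⟩ := Finset.mem_image.1 this
    exact ⟨i, Finset.mem_filter.2 ⟨hi, hj⟩, rfl⟩

end GeomShell
end JKM

namespace JKM
open Module

section Generic
variable {σ : Type}

/-- polynomial functions -/
def PF (φ : (σ → ℝ) → ℝ) : Prop := ∃ g : MvPolynomial σ ℝ, ∀ w, φ w = eval w g

lemma PF.const (a : ℝ) : PF (fun _ : σ → ℝ => a) := ⟨C a, fun w => by simp⟩

lemma PF.coord (i : σ) : PF (fun w : σ → ℝ => w i) := ⟨X i, fun w => by simp⟩

lemma PF.add {φ ψ : (σ → ℝ) → ℝ} (h1 : PF φ) (h2 : PF ψ) : PF (fun w => φ w + ψ w) := by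
  obtain ⟨g, hg⟩ := h1
  obtain ⟨g', hg'⟩ := h2
  exact ⟨g + g', fun w => by simp [hg, hg']⟩

lemma PF.mul {φ ψ : (σ → ℝ) → ℝ} (h1 : PF φ) (h2 : PF ψ) : PF (fun w => φ w * ψ w) := by
  obtain ⟨g, hg⟩ := h1
  obtain ⟨g', hg'⟩ := h2
  exact ⟨g * g', fun w => by simp [hg, hg']⟩

lemma PF.sum {α : Type} (s : Finset α) {φ : α → (σ → ℝ) → ℝ} (h : ∀ a ∈ s, PF (φ a)) :
    PF (fun w => ∑ a ∈ s, φ a w) := by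
  classical
  induction s using Finset.induction_on with
  | empty => simpa using PF.const 0
  | insert a s ha ih =>
    simp only [Finset.sum_insert ha]
    exact (h a (by simp)).add (ih fun b hb => h b (by simp [hb]))

theorem generic_inj {N M : Type} [AddCommGroup N] [Module ℝ N] [FiniteDimensional ℝ N]
    [AddCommGroup M] [Module ℝ M] (Φ : (σ → ℝ) → N →ₗ[ℝ] M)
    (hpf : ∀ n (f : M →ₗ[ℝ] ℝ), PF (fun w => f (Φ w n))) (w₀ : σ → ℝ)
    (h0 : ∀ n, Φ w₀ n = 0 → n = 0) :
    ∃ g : MvPolynomial σ ℝ, eval w₀ g ≠ 0 ∧ ∀ w, eval w g ≠ 0 → ∀ n, Φ w n = 0 → n = 0 := by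
  classical
  obtain ⟨Ψ, hΨ⟩ := LinearMap.exists_leftInverse_of_injective (Φ w₀) (LinearMap.ker_eq_bot'.2 h0)
  let b := finBasis ℝ N
  have hp : ∀ i j, PF (fun w => LinearMap.toMatrix b b (Ψ ∘ₗ Φ w) i j) := by
    intro i j
    have := hpf (b j) ((b.coord i) ∘ₗ Ψ)
    simpa [LinearMap.toMatrix_apply] using this
  choose g hg using hp
  have hdet : ∀ w, eval w (Matrix.det (Matrix.of g)) = LinearMap.det (Ψ ∘ₗ Φ w) := by
    intro w
    rw [RingHom.map_det, ← LinearMap.det_toMatrix b]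
    congr 1
    ext i j
    simp [hg]
  refine ⟨Matrix.det (Matrix.of g), ?_, ?_⟩
  · rw [hdet, hΨ]; simp
  · intro w hw n hn
    rw [hdet] at hw
    have : LinearMap.ker (Ψ ∘ₗ Φ w) = ⊥ := by
      by_contra hk
      exact hw (LinearMap.det_eq_zero_iff_ker_ne_bot.2 hk)
    exact LinearMap.ker_eq_bot'.1 this n (by simp [hn])

lemma exists_common {α : Type} [Finite α] (g : α → MvPolynomial σ ℝ) (hg : ∀ a, g a ≠ 0) :
    ∃ w, ∀ a, eval w (g a) ≠ 0 := by
  classical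
  have := Fintype.ofFinite α
  have h : ∏ a, g a ≠ 0 := Finset.prod_ne_zero_iff.2 fun a _ => hg a
  by_contra hn
  push Not at hn
  apply h
  apply MvPolynomial.funext
  intro w
  obtain ⟨a, ha⟩ := hn w
  rw [map_prod, map_zero]
  exact Finset.prod_eq_zero (Finset.mem_univ a) ha

end Generic

section LinkGen
variable {σ ι κ J : Type} [Fintype ι] [DecidableEq ι] [Fintype κ] [DecidableEq κ] [Fintype J]
  [DecidableEq J]

/-- ideal generated by linear forms -/
noncomputable def TI (M : J → ι → ℝ) : Ideal (MvPolynomial ι ℝ) :=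
  Ideal.span (Set.range fun j => lin (M j))

omit [DecidableEq ι] [Fintype J] [DecidableEq J] in
lemma lin_mem_TI (M : J → ι → ℝ) (j : J) : lin (M j) ∈ TI M := Ideal.subset_span ⟨j, rfl⟩

omit [DecidableEq ι] [Fintype J] in
lemma aeval_sub_mem (M : J → ι → ℝ) (P : MvPolynomial J ℝ) :
    aeval (fun j => lin (M j)) P - C (coeff 0 P) ∈ TI M := by
  induction P using MvPolynomial.induction_on with
  | C a =>
    rw [aeval_C, algebraMap_eq, coeff_C, if_pos rfl, sub_self]
    exact Ideal.zero_mem _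
  | add p q hp hq =>
    rw [map_add, coeff_add, map_add, add_sub_add_comm]
    exact Ideal.add_mem _ hp hq
  | mul_X p j _ =>
    rw [map_mul, aeval_X]
    have : coeff 0 (p * X j) = 0 := by simp [coeff_mul_X']
    rw [this, map_zero, sub_zero]
    exact Ideal.mul_mem_left _ _ (lin_mem_TI M j)

omit [DecidableEq ι] [Fintype J] in
lemma aeval_mem_TI (M : J → ι → ℝ) {P : MvPolynomial J ℝ} (hP : coeff 0 P = 0) :
    aeval (fun j => lin (M j)) P ∈ TI M := by
  have := aeval_sub_mem M P
  rwa [hP, map_zero, sub_zero] at this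

lemma coeff_zero_of_hom {P : MvPolynomial J ℝ} {n : ℕ} (hP : P.IsHomogeneous n) (hn : n ≠ 0) :
    coeff 0 P = 0 := by
  by_contra h
  have := hP h
  simp at this
  exact hn this.symm

lemma eq_C_of_hom_zero {P : MvPolynomial J ℝ} (hP : P.IsHomogeneous 0) :
    P = C (coeff 0 P) := by
  rw [← totalDegree_eq_zero_iff_eq_C]
  exact Nat.le_zero.1 hP.totalDegree_le

lemma PF_aeval (θ : (σ → ℝ) → J → ι → ℝ) (hθ : ∀ j i, PF (fun w => θ w j i))
    (f : MvPolynomial ι ℝ →ₗ[ℝ] ℝ) (P : MvPolynomial J ℝ) :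
    ∀ r, PF (fun w => f (aeval (fun j => lin (θ w j)) P * r)) := by
  induction P using MvPolynomial.induction_on with
  | C a =>
    intro r
    simpa using PF.const (f ((C a : MvPolynomial ι ℝ) * r))
  | add p q hp hq =>
    intro r
    simpa [add_mul] using (hp r).add (hq r)
  | mul_X p j hp =>
    intro r
    have e : (fun w => f (aeval (fun j => lin (θ w j)) (p * X j) * r)) =
        fun w => ∑ i, θ w j i * f (aeval (fun j => lin (θ w j)) p * (X i * r)) := by
      funext w
      rw [map_mul (aeval fun j => lin (θ w j)), aeval_X, mul_assoc, mul_left_comm, L_lin]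
      refine Finset.sum_congr rfl fun i _ => ?_
      rw [mul_left_comm]
    rw [e]
    exact PF.sum _ fun i _ => (hθ j i).mul (hp _)

variable {Γ : Finset ι → Prop} {fac R : κ → Finset ι} {h : κ → ℝ} {M : J → ι → ℝ}

lemma shell_span_all (H : Shell Γ fac R h) (hM : LS fac M) (q : MvPolynomial ι ℝ) :
    ∃ Q, q - Phi R M Q ∈ NI Γ := by
  have : q ∈ LinearMap.range (Phi R M) ⊔ (NI Γ).restrictScalars ℝ := by
    rw [← sum_homogeneousComponent q]
    refine Submodule.sum_mem _ fun n _ => ?_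
    have h1 := shell_span H hM n _ (homogeneousComponent_isHomogeneous n q)
    obtain ⟨_, ⟨P, hP, rfl⟩, r, hr, e⟩ := Submodule.mem_sup.1 h1
    rw [← e]
    exact Submodule.add_mem_sup ⟨P, rfl⟩ hr
  obtain ⟨_, ⟨Q, rfl⟩, r, hr, e⟩ := Submodule.mem_sup.1 this
  exact ⟨Q, by rw [← e, add_sub_cancel_left]; exact hr⟩

/-- elements of the ideal `NI + TI` in terms of the free basis -/
lemma mem_sum_iff (H : Shell Γ fac R h) (hM : LS fac M) {J' : Type} [Fintype J'] (e : J' → J)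
    {q : MvPolynomial ι ℝ}
    (hq : q ∈ NI Γ ⊔ TI (fun j => M (e j))) :
    ∃ Q : J' → κ → MvPolynomial J ℝ, q - Phi R M (∑ j, fun a => X (e j) * Q j a) ∈ NI Γ := by
  obtain ⟨r, hr, t, ht, rfl⟩ := Submodule.mem_sup.1 hq
  obtain ⟨u, hu⟩ := (Ideal.mem_span_range_iff_exists_fun).1 ht
  choose Q hQ using fun j => shell_span_all H hM (u j)
  refine ⟨Q, ?_⟩
  have : r + t - Phi R M (∑ j, fun a => X (e j) * Q j a) =
      r + ∑ j, lin (M (e j)) * (u j - Phi R M (Q j)) := by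
    rw [map_sum, ← hu]
    simp only [Phi_mulX, mul_sub, Finset.sum_sub_distrib]
    simp only [mul_comm (u _)]
    ring
  rw [this]
  exact Ideal.add_mem _ hr (Ideal.sum_mem _ fun j _ => Ideal.mul_mem_left _ _ (hQ j))

noncomputable def Az (R : κ → Finset ι) (m : ℕ) (a : κ) : Submodule ℝ ℝ :=
  if (R a).card = m then ⊤ else ⊥

noncomputable def Gp (R : κ → Finset ι) (J : Type) (m : ℕ) (a : κ) :
    Submodule ℝ (MvPolynomial J ℝ) :=
  if (R a).card ≤ m then Em J (m + 1 - (R a).card) else ⊥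

noncomputable instance (R : κ → Finset ι) (m : ℕ) (a : κ) : FiniteDimensional ℝ (Gp R J m a) := by
  by_cases hc : (R a).card ≤ m
  · have : Gp R J m a = Em J (m + 1 - (R a).card) := if_pos hc
    rw [this]; infer_instance
  · have : Gp R J m a = ⊥ := if_neg hc
    rw [this]; infer_instance

noncomputable def PhiN (R : κ → Finset ι) (m : ℕ) (M : J → ι → ℝ) (om : ι → ℝ) :
    ((Π a, Az R m a) × (Π a, Gp R J m a)) →ₗ[ℝ] MvPolynomial ι ℝ where
  toFun x := lin om * (∑ a, (x.1 a : ℝ) • xm (R a)) + Phi R M (fun a => (x.2 a : MvPolynomial J ℝ))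
  map_add' x y := by
    have : (fun a => ((x + y).2 a : MvPolynomial J ℝ)) = (fun a => (x.2 a : MvPolynomial J ℝ)) +
      fun a => (y.2 a : MvPolynomial J ℝ) := by ext1 a; simp
    rw [this, map_add]
    simp only [Prod.fst_add, Pi.add_apply, Submodule.coe_add, add_smul, Finset.sum_add_distrib]
    ring
  map_smul' r x := by
    have : (fun a => ((r • x).2 a : MvPolynomial J ℝ)) = r • (fun a => (x.2 a : MvPolynomial J ℝ)) := by
      ext1 a; simp
    rw [this, map_smul]
    simp only [Prod.smul_fst, Pi.smul_apply, Submodule.coe_smul, smul_assoc, RingHom.id_apply]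
    rw [← Finset.smul_sum, mul_smul_comm, smul_add]

theorem link_generic (H : Shell Γ fac R h) (m : ℕ)
    (θ : (σ → ℝ) → J → ι → ℝ) (om : (σ → ℝ) → ι → ℝ)
    (hθ : ∀ j i, PF (fun w => θ w j i)) (hom : ∀ i, PF (fun w => om w i)) (w₀ : σ → ℝ)
    (hLS : LS fac (θ w₀)) (Λ : MvPolynomial ι ℝ →ₗ[ℝ] ℝ)
    (hΛ : ∀ q ∈ NI Γ, Λ q = 0) (hΛθ : ∀ j q, Λ (lin (θ w₀ j) * q) = 0)
    (hp : ∀ a, Λ (xm (fac a)) ≠ 0)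
    (hHL : ∀ q : MvPolynomial ι ℝ, q.IsHomogeneous m → (∀ g, Λ (lin (om w₀) * q * g) = 0) →
      ∀ g, Λ (q * g) = 0) :
    ∃ g : MvPolynomial σ ℝ, eval w₀ g ≠ 0 ∧ ∀ w, eval w g ≠ 0 → LS fac (θ w) →
      ∀ b : MvPolynomial ι ℝ, b.IsHomogeneous m → lin (om w) * b ∈ NI Γ ⊔ TI (θ w) →
        b ∈ NI Γ ⊔ TI (θ w) := by
  have hB : ∀ z : Π a, Az R m a, (∑ a, (z a : ℝ) • xm (R a)).IsHomogeneous m := by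
    intro z
    refine Submodule.sum_mem (homogeneousSubmodule ι ℝ m) fun a _ => ?_
    have := (z a).2
    unfold Az at this
    split_ifs at this with hc
    · apply Submodule.smul_mem
      have := xm_hom (R a)
      rwa [hc] at this
    · rw [(Submodule.mem_bot ℝ).1 this, zero_smul]; exact Submodule.zero_mem _
  have hG : ∀ (a : κ) (P : Gp R J m a), coeff 0 (P : MvPolynomial J ℝ) = 0 := by
    intro a P
    have hP := P.2
    unfold Gp at hP
    split_ifs at hP with hc
    · exact coeff_zero_of_hom hP (by omega)
    · rw [(Submodule.mem_bot ℝ).1 hP]; simp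
  have hGT : ∀ (M : J → ι → ℝ) (P : Π a, Gp R J m a),
      Phi R M (fun a => (P a : MvPolynomial J ℝ)) ∈ TI M := by
    intro M P
    rw [Phi_apply]
    exact Ideal.sum_mem _ fun a _ => Ideal.mul_mem_right _ _ (aeval_mem_TI M (hG a _))
  obtain ⟨g, hg0, hg⟩ := generic_inj (N := (Π a, Az R m a) × (Π a, Gp R J m a))
    (M := MvPolynomial ι ℝ ⧸ ((NI Γ).restrictScalars ℝ))
    (fun w => (Submodule.mkQ _) ∘ₗ PhiN R m (θ w) (om w)) (by
      rintro ⟨z, P⟩ f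
      have e : (fun w => f (((NI Γ).restrictScalars ℝ).mkQ (PhiN R m (θ w) (om w) (z, P)))) =
        fun w => (∑ i, om w i * (f ∘ₗ ((NI Γ).restrictScalars ℝ).mkQ) (X i * ∑ a, (z a : ℝ) • xm (R a))) +
          ∑ a, (f ∘ₗ ((NI Γ).restrictScalars ℝ).mkQ)
            (aeval (fun j => lin (θ w j)) (P a : MvPolynomial J ℝ) * xm (R a)) := by
        funext w
        rw [← L_lin, ← map_sum (f ∘ₗ ((NI Γ).restrictScalars ℝ).mkQ), ← Phi_apply, ← map_add]
        rfl
      simp only [LinearMap.comp_apply] at e ⊢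
      rw [e]
      refine PF.add (PF.sum _ fun i _ => (hom i).mul (PF.const _)) (PF.sum _ fun a _ => ?_)
      exact PF_aeval θ hθ (f ∘ₗ ((NI Γ).restrictScalars ℝ).mkQ) _ _) w₀ (by
      rintro ⟨z, P⟩ h0
      have h1 : PhiN R m (θ w₀) (om w₀) (z, P) ∈ NI Γ := by
        simpa [Submodule.Quotient.mk_eq_zero] using h0
      have h2 : ∀ g, Λ (Phi R (θ w₀) (fun a => (P a : MvPolynomial J ℝ)) * g) = 0 := by
        intro g
        obtain ⟨u, hu⟩ := (Ideal.mem_span_range_iff_exists_fun).1 (hGT (θ w₀) P)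
        rw [← hu, Finset.sum_mul, map_sum]
        refine Finset.sum_eq_zero fun j _ => ?_
        rw [mul_comm (u j), mul_assoc, hΛθ]
      have h3 := hHL _ (hB z) (by
        intro g
        have := hΛ _ (Ideal.mul_mem_right g _ h1)
        change Λ ((_ + _) * g) = 0 at this
        rwa [add_mul, map_add, h2, add_zero] at this)
      have h4 := shell_tri H Λ hΛ hp (fun a => (z a : ℝ)) h3
      have h5 : ∀ a, (z a : ℝ) = 0 := fun a => congrFun h4 a
      have h6 : Phi R (θ w₀) (fun a => (P a : MvPolynomial J ℝ)) ∈ NI Γ := by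
        change lin (om w₀) * (∑ a, (z a : ℝ) • xm (R a)) + _ ∈ NI Γ at h1
        simpa [h5] using h1
      have h7 := shell_free H hLS h6
      refine Prod.ext ?_ ?_
      · funext a; exact Subtype.ext (h5 a)
      · funext a; exact Subtype.ext (congrFun h7 a))
  refine ⟨g, hg0, fun w hw hM b hb hbI => ?_⟩
  obtain ⟨_, ⟨Q, hQ, rfl⟩, r, hr, eb⟩ := Submodule.mem_sup.1 (shell_span H hM m b hb)
  rw [SetLike.mem_coe, mem_Gr] at hQ
  let z : Π a, Az R m a := fun a => ⟨if (R a).card = m then coeff 0 (Q a) else 0, by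
    unfold Az; split_ifs <;> simp⟩
  have hz : ∀ a, (z a : ℝ) = coeff 0 (Q a) := by
    intro a
    simp only [z]
    split_ifs with hc
    · rfl
    · have := hQ a
      split_ifs at this with hc'
      · exact (coeff_zero_of_hom this (by omega)).symm
      · rw [(Submodule.mem_bot ℝ).1 this]; simp
  have hdiff : Phi R (θ w) Q - (∑ a, (z a : ℝ) • xm (R a)) ∈ TI (θ w) := by
    rw [Phi_apply, ← Finset.sum_sub_distrib]
    refine Ideal.sum_mem _ fun a _ => ?_
    rw [hz, smul_eq_C_mul, ← sub_mul]
    exact Ideal.mul_mem_right _ _ (aeval_sub_mem _ _)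
  have hbB : b - (∑ a, (z a : ℝ) • xm (R a)) ∈ NI Γ ⊔ TI (θ w) := by
    rw [← eb, add_sub_right_comm, add_comm]
    exact Submodule.add_mem_sup hr hdiff
  have hωB : lin (om w) * (∑ a, (z a : ℝ) • xm (R a)) ∈ NI Γ ⊔ TI (θ w) := by
    have := Ideal.sub_mem _ hbI (Ideal.mul_mem_left _ (lin (om w)) hbB)
    rwa [← mul_sub, sub_sub_cancel] at this
  have hhom : (lin (om w) * (∑ a, (z a : ℝ) • xm (R a))).IsHomogeneous (m + 1) := by
    rw [add_comm]; exact (lin_hom _).mul (hB z)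
  obtain ⟨_, ⟨Q', hQ', rfl⟩, r', hr', e'⟩ := Submodule.mem_sup.1 (shell_span H hM (m+1) _ hhom)
  rw [SetLike.mem_coe, mem_Gr] at hQ'
  obtain ⟨Qj, hQj⟩ := mem_sum_iff H hM id hωB
  have hQ'0 : ∀ a, coeff 0 (Q' a) = 0 := by
    have h1 : Phi R (θ w) (Q' - ∑ j, fun a => X j * Qj j a) ∈ NI Γ := by
      have := Ideal.sub_mem _ hQj hr'
      rw [← e'] at this
      rw [map_sub]
      simpa [add_sub_right_comm] using this
    have h2 := sub_eq_zero.1 (shell_free H hM h1)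
    intro a
    rw [h2, Finset.sum_apply, coeff_sum]
    refine Finset.sum_eq_zero fun j _ => ?_
    simp [coeff_X_mul']
  have hQ'G : ∀ a, Q' a ∈ Gp R J m a := by
    intro a
    have := hQ' a
    unfold Gp
    split_ifs at this with h1
    · split_ifs with h2
      · exact this
      · have hc : m + 1 - (R a).card = 0 := by omega
        rw [hc] at this
        rw [Submodule.mem_bot, eq_C_of_hom_zero this, hQ'0, map_zero]
    · rw [(Submodule.mem_bot ℝ).1 this]; exact Submodule.zero_mem _
  have h0 := hg w hw (z, fun a => ⟨- Q' a, Submodule.neg_mem _ (hQ'G a)⟩) (by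
    rw [LinearMap.comp_apply, Submodule.mkQ_apply, Submodule.Quotient.mk_eq_zero]
    change lin (om w) * (∑ a, (z a : ℝ) • xm (R a)) + Phi R (θ w) (- Q') ∈ NI Γ
    rw [← e', map_neg, add_neg_cancel_comm]
    exact hr')
  have hz0 : z = 0 := congrArg Prod.fst h0
  have : (∑ a, (z a : ℝ) • xm (R a)) = 0 := by simp [hz0]
  rwa [this, sub_zero] at hbB

end LinkGen
end JKM

namespace JKM
open Module

section Glue
variable {ι κ J J₁ J₂ C : Type} [Fintype ι] [DecidableEq ι] [Fintype κ] [DecidableEq κ] [Fintype J]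
  [DecidableEq J] [Fintype J₁] [DecidableEq J₁] [Fintype J₂] [DecidableEq J₂] [Fintype C] [DecidableEq C]
variable {Γ : Finset ι → Prop} {fac R : κ → Finset ι} {h : κ → ℝ}

noncomputable def eps (J₁ J₂ : Type) : MvPolynomial (J₁ ⊕ J₂) ℝ →ₐ[ℝ] MvPolynomial (J₁ ⊕ J₂) ℝ :=
  aeval (Sum.elim (fun _ => 0) (fun j => X (Sum.inr j)))

lemma sub_eps (Q : MvPolynomial (J₁ ⊕ J₂) ℝ) :
    Q - eps J₁ J₂ Q ∈ Ideal.span (Set.range fun j : J₁ => (X (Sum.inl j) : MvPolynomial (J₁ ⊕ J₂) ℝ)) := by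
  induction Q using MvPolynomial.induction_on with
  | C a =>
    rw [eps, aeval_C, algebraMap_eq, sub_self]
    exact Ideal.zero_mem _
  | add p q hp hq =>
    rw [map_add, add_sub_add_comm]; exact Ideal.add_mem _ hp hq
  | mul_X p j hp =>
    have e : eps J₁ J₂ (X j) = Sum.elim (fun _ => 0) (fun j => X (Sum.inr j)) j := by
      rw [eps, aeval_X]
    rw [map_mul, e]
    rcases j with j | j
    · simp only [Sum.elim_inl, mul_zero, sub_zero]
      exact Ideal.mul_mem_left _ _ (Ideal.subset_span ⟨j, rfl⟩)
    · simp only [Sum.elim_inr]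
      rw [← sub_mul]
      exact Ideal.mul_mem_right _ _ hp

theorem prod_cancel (H : Shell Γ fac R h) (M : J₁ ⊕ J₂ → ι → ℝ) (hM : LS fac M)
    {b : MvPolynomial ι ℝ}
    (hb : (∏ j : J₂, lin (M (Sum.inr j))) * b ∈ NI Γ ⊔ TI (fun j => M (Sum.inl j))) :
    b ∈ NI Γ ⊔ TI (fun j => M (Sum.inl j)) := by
  obtain ⟨Q, hQ⟩ := shell_span_all H hM b
  obtain ⟨Qj, hQj⟩ := mem_sum_iff H hM (Sum.inl : J₁ → J₁ ⊕ J₂) hb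
  have e1 : Phi R M (fun a => (∏ j : J₂, X (Sum.inr j)) * Q a) =
      (∏ j : J₂, lin (M (Sum.inr j))) * Phi R M Q := by
    rw [Phi_apply, Phi_apply, Finset.mul_sum]
    refine Finset.sum_congr rfl fun a _ => ?_
    rw [map_mul, map_prod, mul_assoc]
    simp only [aeval_X]
  have h1 : Phi R M ((fun a => (∏ j : J₂, X (Sum.inr j)) * Q a) -
      ∑ j : J₁, fun a => X (Sum.inl j) * Qj j a) ∈ NI Γ := by
    have := Ideal.sub_mem _ hQj (Ideal.mul_mem_left _ (∏ j : J₂, lin (M (Sum.inr j))) hQ)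
    rw [map_sub, e1]
    rw [mul_sub] at this
    convert this using 1
    ring
  have h2 := sub_eq_zero.1 (shell_free H hM h1)
  have h3 : ∀ a, eps J₁ J₂ (Q a) = 0 := by
    intro a
    have := congrArg (eps J₁ J₂) (congrFun h2 a)
    rw [map_mul, map_prod, Finset.sum_apply, map_sum] at this
    have e0 : ∑ j, eps J₁ J₂ (X (Sum.inl j) * Qj j a) = 0 := by
      refine Finset.sum_eq_zero fun j _ => ?_
      rw [map_mul, eps, aeval_X, Sum.elim_inl, zero_mul]
    rw [e0] at this
    rcases mul_eq_zero.1 this with h4 | h4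
    · obtain ⟨j, _, hj⟩ := Finset.prod_eq_zero_iff.1 h4
      rw [eps, aeval_X, Sum.elim_inr] at hj
      exact absurd hj (X_ne_zero _)
    · exact h4
  have h5 : Phi R M Q ∈ TI (fun j => M (Sum.inl j)) := by
    rw [Phi_apply]
    refine Ideal.sum_mem _ fun a _ => Ideal.mul_mem_right _ _ ?_
    have h6 := sub_eps (Q a)
    rw [h3, sub_zero] at h6
    obtain ⟨u, hu⟩ := (Ideal.mem_span_range_iff_exists_fun).1 h6
    rw [← hu, map_sum]
    refine Ideal.sum_mem _ fun j _ => ?_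
    rw [map_mul, aeval_X]
    exact Ideal.mul_mem_left _ _ (lin_mem_TI (fun j => M (Sum.inl j)) j)
  have := Submodule.add_mem_sup hQ h5
  rwa [sub_add_cancel] at this

/-- kill the variables with colour outside `S` -/
noncomputable def zet (col : ι → C) (S : Finset C) : MvPolynomial ι ℝ →ₐ[ℝ] MvPolynomial ι ℝ :=
  aeval fun i => if col i ∈ S then X i else 0

variable {col : ι → C} {S : Finset C}

lemma zet_X (i : ι) : zet col S (X i) = if col i ∈ S then X i else 0 := by rw [zet, aeval_X]

lemma zet_xm_pos {τ : Finset ι} (hτ : ∀ i ∈ τ, col i ∈ S) : zet col S (xm τ) = xm τ := by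
  rw [xm, map_prod]
  exact Finset.prod_congr rfl fun i hi => by rw [zet_X, if_pos (hτ i hi)]

lemma zet_xm_neg {τ : Finset ι} (hτ : ¬ ∀ i ∈ τ, col i ∈ S) : zet col S (xm τ) = 0 := by
  push Not at hτ
  obtain ⟨i, hi, hn⟩ := hτ
  rw [xm, map_prod]
  exact Finset.prod_eq_zero hi (by rw [zet_X, if_neg hn])

def res (col : ι → C) (S : Finset C) (e : ι → ℝ) : ι → ℝ := fun i => if col i ∈ S then e i else 0

lemma zet_lin (e : ι → ℝ) : zet col S (lin e) = lin (res col S e) := by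
  rw [lin, lin, map_sum]
  refine Finset.sum_congr rfl fun i _ => ?_
  rw [map_smul, zet_X, res]
  split_ifs <;> simp

lemma zet_hom {q : MvPolynomial ι ℝ} {m : ℕ} (hq : q.IsHomogeneous m) :
    (zet col S q).IsHomogeneous m := by
  have h := hq.aeval (g := fun i => if col i ∈ S then (X i : MvPolynomial ι ℝ) else 0) (n := 1) (by
    intro i
    split_ifs
    · exact isHomogeneous_X _ _
    · exact isHomogeneous_zero _ _ _)
  rwa [one_mul] at h

lemma xm_mul_xm (A B : Finset ι) : (xm A * xm B : MvPolynomial ι ℝ) = xm (A ∪ B) * xm (A ∩ B) := by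
  rw [xm, xm, xm, xm, Finset.prod_union_inter]

/-- restriction of a complex -/
def RS (Γ : Finset ι → Prop) (col : ι → C) (S : Finset C) (τ : Finset ι) : Prop :=
  Γ τ ∧ ∀ i ∈ τ, col i ∈ S

/-- colour-restricted link -/
def LG (Γ : Finset ι → Prop) (col : ι → C) (S : Finset C) (F τ : Finset ι) : Prop :=
  Γ (τ ∪ F) ∧ ∀ i ∈ τ, col i ∈ S

lemma sub_zet (b : MvPolynomial ι ℝ) : b - zet col S b ∈ NI (RS Γ col S) := by
  induction b using MvPolynomial.induction_on with
  | C a =>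
    rw [zet, aeval_C, algebraMap_eq, sub_self]
    exact Ideal.zero_mem _
  | add p q hp hq =>
    rw [map_add, add_sub_add_comm]; exact Ideal.add_mem _ hp hq
  | mul_X p j hp =>
    rw [map_mul, zet_X]
    split_ifs with hj
    · rw [← sub_mul]
      exact Ideal.mul_mem_right _ _ hp
    · rw [mul_zero, sub_zero]
      apply Ideal.mul_mem_left
      have : (X j : MvPolynomial ι ℝ) = xm {j} := by simp [xm]
      rw [this]
      exact xm_mem_NI fun hh => hj (hh.2 j (by simp))

lemma NI_mono {Γ' : Finset ι → Prop} (hh : ∀ τ, Γ' τ → Γ τ) : NI Γ ≤ NI Γ' := by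
  rw [NI, Ideal.span_le]
  rintro _ ⟨τ, hτ, rfl⟩
  exact xm_mem_NI fun h => hτ (hh τ h)

lemma link_zet {F : Finset ι} {r : MvPolynomial ι ℝ} (hr : r ∈ NI (LG Γ col S F)) :
    xm F * zet col S r ∈ NI Γ := by
  rw [NI] at hr
  induction hr using Submodule.span_induction with
  | mem x hx =>
    obtain ⟨τ, hτ, rfl⟩ := hx
    by_cases hc : ∀ i ∈ τ, col i ∈ S
    · rw [zet_xm_pos hc, mul_comm, xm_mul_xm]
      exact Ideal.mul_mem_right _ _ (xm_mem_NI fun hG => hτ ⟨hG, hc⟩)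
    · rw [zet_xm_neg hc, mul_zero]; exact Ideal.zero_mem _
  | zero => simp
  | add x y _ _ hx hy => rw [map_add, mul_add]; exact Ideal.add_mem _ hx hy
  | smul a x _ hx =>
    rw [smul_eq_mul, map_mul, mul_left_comm]; exact Ideal.mul_mem_left _ _ hx

lemma TI_zet (θ : J → ι → ℝ) {r : MvPolynomial ι ℝ} (hr : r ∈ TI θ) :
    zet col S r ∈ TI (fun j => res col S (θ j)) := by
  obtain ⟨u, hu⟩ := (Ideal.mem_span_range_iff_exists_fun).1 hr
  rw [← hu, map_sum]
  refine Ideal.sum_mem _ fun j _ => ?_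
  rw [map_mul, zet_lin]
  exact Ideal.mul_mem_left _ _ (lin_mem_TI (fun j => res col S (θ j)) j)

/-- indicator rows of colours -/
def psi (col : ι → C) (j : C) : ι → ℝ := fun i => if col i = j then 1 else 0

lemma lin_psi (j : C) : lin (psi col j) = ∑ i ∈ Finset.univ.filter (fun i => col i = j), (X i : MvPolynomial ι ℝ) := by
  rw [lin, Finset.sum_filter]
  refine Finset.sum_congr rfl fun i _ => ?_
  rw [psi]; split_ifs <;> simp

lemma LS_ext {θ : J → ι → ℝ} (hinj : ∀ a, Set.InjOn col (fac a : Set ι))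
    (hsurj : ∀ a, ∀ j, ∃ i ∈ fac a, col i = j)
    (hθ : LS (fun a => (fac a).filter fun i => col i ∈ S) θ) :
    LS fac (Sum.elim (fun j => res col S (θ j)) (fun j : {j : C // j ∉ S} => psi col j.1)) := by
  intro a
  obtain ⟨t, h1, h2⟩ := hθ a
  refine ⟨fun i => Sum.elim (fun j => if col i ∈ S then t i j else 0)
    (fun j => if col i = j.1 then 1 else 0), ?_, ?_⟩
  · intro i hi i' hi'
    rw [Fintype.sum_sum_type]
    simp only [Sum.elim_inl, Sum.elim_inr, res, psi]
    by_cases hc : col i ∈ S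
    · have z : ∀ j : {j : C // j ∉ S}, (if col i = j.1 then (1:ℝ) else 0) = 0 := by
        intro j; rw [if_neg]; intro e; exact j.2 (e ▸ hc)
      simp only [z, zero_mul, Finset.sum_const_zero, add_zero, if_pos hc]
      by_cases hc' : col i' ∈ S
      · simp only [if_pos hc']
        exact h1 i (Finset.mem_filter.2 ⟨hi, hc⟩) i' (Finset.mem_filter.2 ⟨hi', hc'⟩)
      · simp only [if_neg hc', mul_zero, Finset.sum_const_zero]
        rw [if_neg]; rintro rfl; exact hc' hc
    · simp only [if_neg hc, zero_mul, Finset.sum_const_zero, zero_add]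
      rw [Finset.sum_eq_single ⟨col i, hc⟩]
      · simp only [if_true, one_mul]
        by_cases e : i = i'
        · subst e; simp
        · rw [if_neg, if_neg e]
          intro e'; exact e (hinj a hi hi' e'.symm)
      · intro b _ hb
        rw [if_neg, zero_mul]
        intro e; exact hb (Subtype.ext e.symm)
      · simp
  · rintro (j | j) (j' | j')
    · simp only [Sum.elim_inl, res, Sum.inl.injEq]
      rw [← h2 j j', Finset.sum_filter]
      refine Finset.sum_congr rfl fun i _ => ?_
      split_ifs <;> simp
    · simp only [Sum.elim_inl, Sum.elim_inr, res]
      rw [if_neg (by simp)]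
      refine Finset.sum_eq_zero fun i _ => ?_
      by_cases e : col i = j'.1
      · rw [if_neg (by rw [e]; exact j'.2), zero_mul]
      · rw [if_neg e, mul_zero]
    · simp only [Sum.elim_inl, Sum.elim_inr, psi]
      rw [if_neg (by simp)]
      refine Finset.sum_eq_zero fun i _ => ?_
      by_cases e : col i = j.1
      · have hn : col i ∉ S := by rw [e]; exact j.2
        simp [hn]
      · rw [if_neg e, zero_mul]
    · simp only [Sum.elim_inr, psi, Sum.inr.injEq]
      obtain ⟨i, hi, e⟩ := hsurj a j.1
      rw [Finset.sum_eq_single i]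
      · rw [if_pos e, one_mul, e]
        simp only [Subtype.ext_iff]
      · intro i' hi' hne
        rw [if_neg, zero_mul]
        intro e'; exact hne (hinj a hi' hi (e'.trans e.symm))
      · exact fun hn => absurd hi hn

theorem glue (H : Shell Γ fac R h) (hinj : ∀ a, Set.InjOn col (fac a : Set ι))
    (hsurj : ∀ a, ∀ j, ∃ i ∈ fac a, col i = j) {θ : J → ι → ℝ}
    (hθ : LS (fun a => (fac a).filter fun i => col i ∈ S) θ) {b : MvPolynomial ι ℝ}
    (hb : ∀ F, Γ F → F.image col = Sᶜ → b ∈ NI (LG Γ col S F) ⊔ TI θ) :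
    b ∈ NI (RS Γ col S) ⊔ TI θ := by
  have hM := LS_ext (S := S) hinj hsurj hθ
  have h1 : ∀ F : Finset ι, F.image col = Sᶜ →
      xm F * zet col S b ∈ NI Γ ⊔ TI (fun j => res col S (θ j)) := by
    intro F hF
    by_cases hG : Γ F
    · obtain ⟨r, hr, t, ht, e⟩ := Submodule.mem_sup.1 (hb F hG hF)
      rw [← e, map_add, mul_add]
      exact Submodule.add_mem_sup (link_zet hr) (Ideal.mul_mem_left _ _ (TI_zet θ ht))
    · exact Submodule.mem_sup_left (Ideal.mul_mem_right _ _ (xm_mem_NI hG))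
  have h2 : (∏ j : {j : C // j ∉ S}, lin (psi col j.1)) * zet col S b ∈
      NI Γ ⊔ TI (fun j => res col S (θ j)) := by
    simp only [lin_psi]
    rw [Finset.prod_univ_sum, Finset.sum_mul]
    refine Ideal.sum_mem _ fun f hf => ?_
    rw [Fintype.mem_piFinset] at hf
    have hf' : ∀ j, col (f j) = j.1 := fun j => (Finset.mem_filter.1 (hf j)).2
    have hfi : Function.Injective f := by
      intro j j' e
      apply Subtype.ext
      rw [← hf' j, ← hf' j', e]
    have e : ∏ j, (X (f j) : MvPolynomial ι ℝ) = xm (Finset.univ.image f) := by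
      rw [xm, Finset.prod_image fun a _ b _ e => hfi e]
    rw [e]
    apply h1
    ext j
    rw [Finset.mem_image, Finset.mem_compl]
    constructor
    · rintro ⟨i, hi, rfl⟩
      obtain ⟨j', _, rfl⟩ := Finset.mem_image.1 hi
      rw [hf']; exact j'.2
    · intro hj
      exact ⟨f ⟨j, hj⟩, Finset.mem_image_of_mem _ (Finset.mem_univ _), hf' _⟩
  have h3 := prod_cancel H _ hM h2
  simp only [Sum.elim_inl] at h3
  have h4 : NI Γ ⊔ TI (fun j => res col S (θ j)) ≤ NI (RS Γ col S) ⊔ TI θ := by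
    refine sup_le ((NI_mono fun τ hτ => hτ.1).trans le_sup_left) ?_
    rw [TI, Ideal.span_le]
    rintro _ ⟨j, rfl⟩
    have := sub_zet (Γ := Γ) (col := col) (S := S) (lin (θ j))
    rw [zet_lin] at this
    have h5 := Submodule.add_mem_sup (Ideal.neg_mem_iff _ |>.2 this) (lin_mem_TI θ j)
    rwa [neg_sub, sub_add_cancel] at h5
  have := Ideal.add_mem _ (Submodule.mem_sup_left (sub_zet (Γ := Γ) (col := col) (S := S) b)) (h4 h3)
  rwa [sub_add_cancel] at this

end Glue
end JKM

namespace JKM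
open Module

section LinkInst
variable {ι J : Type} [Fintype ι] [DecidableEq ι] [Fintype J] [DecidableEq J]

/-- independence of the rows over `T` -/
def Inj (T : Finset ι) (θ : J → ι → ℝ) : Prop :=
  ∀ n : ι → ℝ, (∀ j, ∑ i ∈ T, n i * θ j i = 0) → ∀ i ∈ T, n i = 0

noncomputable def evT (T : Finset ι) (θ : J → ι → ℝ) : (T → ℝ) →ₗ[ℝ] (J → ℝ) where
  toFun n j := ∑ i : T, n i * θ j i
  map_add' x y := by
    funext j; simp [add_mul, Finset.sum_add_distrib]
  map_smul' r x := by
    funext j; simp [Finset.mul_sum, mul_assoc]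

lemma Inj_iff (T : Finset ι) (θ : J → ι → ℝ) : Inj T θ ↔ ∀ n, evT T θ n = 0 → n = 0 := by
  constructor
  · intro h n hn
    let n' : ι → ℝ := fun i => if hi : i ∈ T then n ⟨i, hi⟩ else 0
    have e : ∀ i : T, n' i = n i := fun i => by simp [n']
    have := h n' (by
      intro j
      rw [← Finset.sum_coe_sort T]
      simp only [e]
      exact congrFun hn j)
    funext i
    rw [← e]; exact this i i.2
  · intro h n hn i hi
    have := h (fun i => n i) (by
      funext j
      change ∑ i : T, n i * θ j i = 0
      rw [Finset.sum_coe_sort T fun i => n i * θ j i]; exact hn j)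
    exact congrFun this ⟨i, hi⟩

lemma LS_of_Inj {κ : Type} {fac : κ → Finset ι} {θ : J → ι → ℝ}
    (hc : ∀ a, (fac a).card = Fintype.card J) (hi : ∀ a, Inj (fac a) θ) : LS fac θ := by
  intro a
  have h1 := (Inj_iff _ _).1 (hi a)
  let e : (fac a → ℝ) ≃ₗ[ℝ] (J → ℝ) := LinearEquiv.ofInjectiveOfFinrankEq (evT (fac a) θ)
    (LinearMap.ker_eq_bot.1 (LinearMap.ker_eq_bot'.2 h1)) (by simp [hc a])
  have he : ∀ n, e n = evT (fac a) θ n := fun n => rfl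
  refine ⟨fun i j => if hi : i ∈ fac a then e.symm (Pi.single j 1) ⟨i, hi⟩ else 0, ?_, ?_⟩
  · intro i hi i' hi'
    have h2 : e (Pi.single ⟨i', hi'⟩ 1) = ∑ j, θ j i' • Pi.single j (1 : ℝ) := by
      rw [he]
      funext j
      change ∑ i : fac a, _ = _
      rw [Finset.sum_eq_single ⟨i', hi'⟩]
      · simp [Finset.sum_apply, Pi.single_apply]
      · intro b _ hb; rw [Pi.single_eq_of_ne hb, zero_mul]
      · simp
    have h3 := congrArg e.symm h2
    rw [LinearEquiv.symm_apply_apply, map_sum] at h3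
    have h4 := congrFun h3 ⟨i, hi⟩
    simp only [map_smul, Finset.sum_apply, Pi.smul_apply, smul_eq_mul] at h4
    simp only [dif_pos hi]
    rw [show (if i = i' then (1:ℝ) else 0) = (Pi.single (⟨i', hi'⟩ : fac a) (1:ℝ) : fac a → ℝ) ⟨i, hi⟩ by
      rw [Pi.single_apply]; simp [Subtype.ext_iff], h4]
    exact Finset.sum_congr rfl fun j _ => mul_comm _ _
  · intro j j'
    have h2 : e (e.symm (Pi.single j' 1)) j = (Pi.single j' (1 : ℝ) : J → ℝ) j := by
      rw [LinearEquiv.apply_symm_apply]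
    rw [Pi.single_apply] at h2
    rw [← h2, he]
    change _ = ∑ i : fac a, _
    rw [← Finset.sum_coe_sort (fac a)]
    refine Finset.sum_congr rfl fun i _ => ?_
    simp only [dif_pos i.2]; rw [mul_comm]

lemma Inj_generic {σ : Type} (T : Finset ι) (θ : (σ → ℝ) → J → ι → ℝ)
    (hθ : ∀ j i, PF (fun w => θ w j i)) (w₀ : σ → ℝ) (h0 : Inj T (θ w₀)) :
    ∃ g : MvPolynomial σ ℝ, eval w₀ g ≠ 0 ∧ ∀ w, eval w g ≠ 0 → Inj T (θ w) := by
  simp only [Inj_iff] at h0 ⊢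
  refine generic_inj (fun w => evT T (θ w)) ?_ w₀ h0
  intro n f
  have e : (fun w => f (evT T (θ w) n)) = fun w => ∑ j, (∑ i : T, n i * θ w j i) * f (Pi.single j 1) := by
    funext w
    conv_lhs => rw [← LinearMap.sum_single_apply (φ := fun _ : J => ℝ) (v := evT T (θ w) n)]
    rw [map_sum]
    refine Finset.sum_congr rfl fun j _ => ?_
    have : (LinearMap.single ℝ (fun _ : J => ℝ) j) (evT T (θ w) n j) =
        (evT T (θ w) n j) • (Pi.single j (1:ℝ) : J → ℝ) := by
      funext l
      by_cases hl : l = j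
      · subst hl; simp
      · simp [Pi.single_eq_of_ne hl]
    change f ((LinearMap.single ℝ (fun _ : J => ℝ) j) (evT T (θ w) n j)) = _
    rw [this, map_smul]; rfl
  rw [e]
  exact PF.sum _ fun j _ => (PF.sum _ fun i _ => (PF.const (n i)).mul (hθ j i.1)).mul (PF.const _)

variable {E : Type} [AddCommGroup E] [Module ℝ E] [FiniteDimensional ℝ E]
variable {V : ι → Dual ℝ E} {c : ι → ℝ}
variable {C : Type} [Fintype C] [DecidableEq C] {col : ι → C} {S : Finset C}

/-- the special vectors for a top `F` -/
lemma special (hS : Simple V c) {F : Finset ι} {x : E} (hx : IsVert V c x) (hF : F ⊆ act V c x)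
    (hJ : Fintype.card J + F.card = finrank ℝ E) :
    ∃ u : J → E, (∀ j, ∀ i ∈ F, V i (u j) = 0) ∧
      ∀ x', IsVert V c x' → F ⊆ act V c x' → Inj (act V c x' \ F) (fun j i => V i (u j)) := by
  have hLI := hS x hx.1
  choose u hu using fun k => exists_sol hLI (fun i => if i = k then (1:ℝ) else 0)
  have hcard : Fintype.card J = Fintype.card {i // i ∈ act V c x \ F} := by
    rw [Fintype.card_coe, Finset.card_sdiff_of_subset hF, hx.2]; omega
  let e := Fintype.equivOfCardEq hcard
  have hzero : ∀ g : Dual ℝ E, (∀ i ∈ act V c x, g (u i) = 0) → g = 0 := by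
    intro g hg
    ext v
    have : v = ∑ i ∈ act V c x, V i v • u i := by
      refine eq_of_full hLI hx.2 fun k hk => ?_
      rw [map_sum, Finset.sum_eq_single k]
      · rw [map_smul, hu k k hk, if_pos rfl, smul_eq_mul, mul_one]
      · intro b hb hbk
        rw [map_smul, hu b k hk, if_neg hbk.symm, smul_zero]
      · exact fun hn => absurd hk hn
    rw [this, map_sum]
    simp only [map_smul, LinearMap.zero_apply]
    exact Finset.sum_eq_zero fun i hi => by rw [hg i hi, smul_zero]
  refine ⟨fun j => u (e j).1, ?_, ?_⟩
  · intro j i hi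
    rw [hu _ i (hF hi), if_neg]
    rintro rfl
    exact (Finset.mem_sdiff.1 (e j).2).2 hi
  · intro x' hx' hF' n hn
    have hLI' := hS x' hx'.1
    set φ : Dual ℝ E := ∑ i ∈ act V c x' \ F, n i • V i with hφ
    have h1 : φ - ∑ f ∈ F, φ (u f) • V f = 0 := by
      apply hzero
      intro i hi
      have es : (∑ f ∈ F, φ (u f) • V f) (u i) = ∑ f ∈ F, φ (u f) * V f (u i) := by
        rw [LinearMap.sum_apply]; rfl
      rw [LinearMap.sub_apply, es]
      by_cases hiF : i ∈ F
      · rw [Finset.sum_eq_single i]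
        · rw [hu i i hi, if_pos rfl, mul_one, sub_self]
        · intro b hb hbi; rw [hu i b (hF hb), if_neg hbi, mul_zero]
        · exact fun hh => absurd hiF hh
      · rw [Finset.sum_eq_zero, sub_zero]
        · have := hn (e.symm ⟨i, Finset.mem_sdiff.2 ⟨hi, hiF⟩⟩)
          simp only [Equiv.apply_symm_apply] at this
          rw [hφ, LinearMap.sum_apply]
          simpa using this
        · intro f hf
          rw [hu i f (hF hf), if_neg, mul_zero]
          rintro rfl; exact hiF hf
    have h2 : ∑ i ∈ act V c x', (if i ∈ F then - φ (u i) else n i) • V i = 0 := by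
      rw [← Finset.sum_sdiff hF', ← h1, sub_eq_add_neg, ← Finset.sum_neg_distrib]
      congr 1
      · refine Finset.sum_congr rfl fun i hi => ?_
        rw [if_neg (Finset.mem_sdiff.1 hi).2]
      · refine Finset.sum_congr rfl fun i hi => ?_
        rw [if_pos hi]; exact neg_smul (φ (u i)) (V i)
    intro i hi
    have h3 := (linearIndepOn_finset_iff.1 hLI') _ h2 i (Finset.mem_sdiff.1 hi).1
    rwa [if_neg (Finset.mem_sdiff.1 hi).2] at h3

lemma kill_T {L : MvPolynomial ι ℝ →ₗ[ℝ] ℝ} (hL : IsVol V c L) {F : Finset ι}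
    (hcol : ∀ τ, Fc V c τ → Set.InjOn col (τ : Set ι)) (hF : IsTop V c col S F) {i : ι}
    (hi : col i ∉ S) (hiF : i ∉ F) (q : MvPolynomial ι ℝ) : L (X i * (xm F * q)) = 0 := by
  rw [← mul_assoc, ← xm_insert hiF]
  apply hL.nonface
  intro hf
  have : col i ∈ F.image col := by rw [hF.2]; simpa using hi
  obtain ⟨f, hf', e⟩ := Finset.mem_image.1 this
  have := hcol _ hf (Finset.mem_insert_of_mem hf') (Finset.mem_insert_self _ _) e
  exact hiF (this ▸ hf')

lemma zet_idem (g : MvPolynomial ι ℝ) : zet col S (zet col S g) = zet col S g := by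
  have : (zet col S).comp (zet col S) = zet col S := by
    ext i
    simp only [AlgHom.comp_apply, zet_X]
    split_ifs with hh
    · rw [zet_X, if_pos hh]
    · rw [map_zero]
  exact congrArg (fun f => f g) this

lemma res_kill {L : MvPolynomial ι ℝ →ₗ[ℝ] ℝ} (hL : IsVol V c L) {F : Finset ι}
    (hcol : ∀ τ, Fc V c τ → Set.InjOn col (τ : Set ι)) (hF : IsTop V c col S F) {e : ι → ℝ}
    (he : ∀ i ∈ F, e i = 0) (q : MvPolynomial ι ℝ) :
    L (lin (res col S e) * (xm F * q)) = L (lin e * (xm F * q)) := by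
  rw [L_lin, L_lin]
  refine Finset.sum_congr rfl fun i _ => ?_
  rw [res]
  split_ifs with hh
  · rfl
  · by_cases hiF : i ∈ F
    · rw [he i hiF]
    · rw [kill_T hL hcol hF hh hiF, mul_zero, mul_zero]

lemma zet_enough (hS : Simple V c) {L : MvPolynomial ι ℝ →ₗ[ℝ] ℝ} (hL : IsVol V c L) {F : Finset ι}
    (hcol : ∀ τ, Fc V c τ → Set.InjOn col (τ : Set ι)) (hF : IsTop V c col S F)
    (K : MvPolynomial ι ℝ) (h : ∀ g, L (xm F * (K * zet col S g)) = 0) (g : MvPolynomial ι ℝ) :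
    L (xm F * (K * g)) = 0 := by
  have key : ∀ p : MvPolynomial ι ℝ, ∀ g, L (xm F * (K * p * zet col S g)) = 0 := by
    intro p
    induction p using MvPolynomial.induction_on with
    | C a =>
      intro g
      have := h (MvPolynomial.C a * g)
      rw [map_mul (zet col S)] at this
      have e : zet col S (MvPolynomial.C a : MvPolynomial ι ℝ) = MvPolynomial.C a := by rw [zet, aeval_C, algebraMap_eq]
      rw [e] at this
      rwa [mul_assoc K]
    | add p q hp hq =>
      intro g
      rw [mul_add, add_mul, mul_add, map_add, hp, hq, add_zero]
    | mul_X p w hp =>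
      intro g
      have e : xm F * (K * (p * X w) * zet col S g) = X w * (xm F * (K * p * zet col S g)) := by ring
      rw [e]
      refine X_reduce hL.theta (T := F) ?_ _ ?_ w
      · obtain ⟨x, hx, hFx⟩ := hF.1
        exact (hS x hx).mono (by exact_mod_cast hFx)
      · intro v hv
        by_cases hvS : col v ∈ S
        · have := hp (X v * g)
          rw [map_mul (zet col S), zet_X, if_pos hvS] at this
          rw [← this]
          congr 1; ring
        · exact kill_T hL hcol hF hvS hv _
  have := key g 1
  rwa [map_one, mul_one] at this

end LinkInst
end JKM

namespace JKM
open Module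

section MainAlg
variable {ι J C E L' : Type} [Fintype ι] [DecidableEq ι] [Fintype J] [DecidableEq J]
  [Fintype C] [DecidableEq C] [Fintype L']
  [AddCommGroup E] [Module ℝ E] [FiniteDimensional ℝ E]
variable {V : ι → Dual ℝ E} {c : ι → ℝ} {col : ι → C} {S : Finset C}

lemma top_card (hcol : ∀ τ, Fc V c τ → Set.InjOn col (τ : Set ι))
    (hcard : Fintype.card C = finrank ℝ E) {F : Finset ι} (hF : IsTop V c col S F) :
    S.card + F.card = finrank ℝ E := by
  have h1 : (F.image col).card = F.card := Finset.card_image_of_injOn (hcol F hF.1)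
  rw [hF.2] at h1
  rw [← h1, ← hcard]
  exact Finset.card_add_card_compl S

lemma act_sdiff (hcol : ∀ τ, Fc V c τ → Set.InjOn col (τ : Set ι)) {F : Finset ι}
    (hF : IsTop V c col S F) {x : E} (hx : InP V c x) (hFx : F ⊆ act V c x) :
    act V c x \ F = (act V c x).filter fun i => col i ∈ S := by
  ext i
  rw [Finset.mem_sdiff, Finset.mem_filter]
  constructor
  · rintro ⟨h1, h2⟩; exact ⟨h1, (col_sdiff hcol hF.2 hx hFx h1).1 h2⟩
  · rintro ⟨h1, h2⟩; exact ⟨h1, (col_sdiff hcol hF.2 hx hFx h1).2 h2⟩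

def thw (q : ι → L' → ℝ) (w : (J × L') ⊕ ι → ℝ) (j : J) (i : ι) : ℝ :=
  ∑ l, w (Sum.inl (j, l)) * q i l

lemma thw_PF (q : ι → L' → ℝ) (j : J) (i : ι) :
    PF (fun w : (J × L') ⊕ ι → ℝ => thw q w j i) :=
  PF.sum _ fun l _ => (PF.coord _).mul (PF.const _)

lemma kill_NI {L : MvPolynomial ι ℝ →ₗ[ℝ] ℝ} (hL : IsVol V c L) {p : MvPolynomial ι ℝ}
    (hp : p ∈ NI (Fc V c)) : L p = 0 := by
  rw [NI] at hp
  induction hp using Submodule.span_induction with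
  | mem x hx =>
    obtain ⟨τ, hτ, rfl⟩ := hx
    rw [← mul_one (xm τ)]; exact hL.nonface τ hτ 1
  | zero => exact map_zero L
  | add x y _ _ hx hy => rw [map_add, hx, hy, add_zero]
  | smul a x hx _ =>
    have key : ∀ x ∈ NI (Fc V c), ∀ a, L (a * x) = 0 := by
      intro x hx
      rw [NI] at hx
      induction hx using Submodule.span_induction with
      | mem x hx =>
        obtain ⟨τ, hτ, rfl⟩ := hx
        intro a; rw [mul_comm]; exact hL.nonface τ hτ a
      | zero => intro a; rw [mul_zero]; exact map_zero L
      | add x y _ _ hx hy => intro a; rw [mul_add, map_add, hx, hy, add_zero]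
      | smul b x _ hx => intro a; rw [smul_eq_mul, ← mul_assoc]; exact hx _
    exact key x hx a

lemma link_top (hS : Simple V c) (hC : Cone V)
    (hcol : ∀ τ, Fc V c τ → Set.InjOn col (τ : Set ι))
    (hcard : Fintype.card C = finrank ℝ E) (hJ : Fintype.card J = S.card) (q : ι → L' → ℝ)
    (hq : ∀ u : E, ∃ a : L' → ℝ, ∀ i, V i u = ∑ l, a l * q i l)
    {F : Finset ι} (hF : IsTop V c col S F) {m : ℕ} (hm : 2 * m + 1 ≤ S.card) :
    ∃ g : MvPolynomial ((J × L') ⊕ ι) ℝ, g ≠ 0 ∧ ∀ w, eval w g ≠ 0 →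
      (∀ x, IsVert V c x → Inj ((act V c x).filter fun i => col i ∈ S) (thw (J := J) q w)) →
      ∀ b : MvPolynomial ι ℝ, b.IsHomogeneous m →
        lin (fun i => w (Sum.inr i)) * b ∈ NI (LkS V c col S F) ⊔ TI (thw (J := J) q w) →
        b ∈ NI (LkS V c col S F) ⊔ TI (thw (J := J) q w) := by
  obtain ⟨y, Y, hG⟩ := exists_gen hS
  obtain ⟨κ, _, _, pt, R, h, hpt, H⟩ := exists_shell hS hC hG hcol hF
  obtain ⟨L, hL, hHL⟩ := exists_vol hS hC
  have hFc := top_card hcol hcard hF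
  obtain ⟨x0, hx0, hFx0⟩ := hF.1
  obtain ⟨x, hx, hxx, -⟩ := vertex_lemma hS hC y x0 hx0
  have hFx : F ⊆ act V c x := hFx0.trans hxx
  obtain ⟨u, hu0, hu⟩ := special (J := J) hS hx hFx (by rw [hJ, hFc])
  choose A hA using fun j => hq (u j)
  let w₀ : (J × L') ⊕ ι → ℝ := Sum.elim (fun jl => A jl.1 jl.2) (fun i => c i - V i x)
  have hth : thw q w₀ = fun j i => V i (u j) := by
    funext j i
    rw [hA j i]; rfl
  have hfc : ∀ a, (act V c (pt a) \ F).card = Fintype.card J := by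
    intro a
    rw [Finset.card_sdiff_of_subset (hpt a).2, (hpt a).1.2, hJ]; omega
  have hswap : ∀ (e : ι → ℝ), (∀ i ∈ F, e i = 0) → ∀ r,
      L (xm F * zet col S (lin e * r)) = L (lin e * (xm F * zet col S r)) := by
    intro e he r
    rw [map_mul (zet col S), zet_lin, ← res_kill hL hcol hF he]
    congr 1; ring
  obtain ⟨g, hg0, hg⟩ := link_generic H m (thw q) (fun w i => w (Sum.inr i)) (thw_PF q)
    (fun i => PF.coord _) w₀ (by
      rw [hth]
      exact LS_of_Inj hfc fun a => hu _ (hpt a).1 (hpt a).2)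
    (L ∘ₗ (LinearMap.mulLeft ℝ (xm F)) ∘ₗ (zet col S).toLinearMap)
    (fun p hp => kill_NI hL (link_zet (Γ := Fc V c) hp))
    (by
      intro j p
      show L (xm F * zet col S (lin (thw q w₀ j) * p)) = 0
      rw [hth, hswap _ (hu0 j)]
      exact hL.theta _ _)
    (by
      intro a
      show L (xm F * zet col S (xm (act V c (pt a) \ F))) ≠ 0
      rw [zet_xm_pos, ← xm_sdiff (hpt a).2]
      · exact (hL.pos _ (Fc_sub (hpt a).1.1 subset_rfl) (hpt a).1.2).ne'
      · intro i hi
        rw [act_sdiff hcol hF (hpt a).1.1 (hpt a).2] at hi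
        exact (Finset.mem_filter.1 hi).2)
    (by
      intro p hp hz g
      show L (xm F * zet col S (p * g)) = 0
      have h1 : ∀ g, L (xm F * ((lin c * zet col S p) * zet col S g)) = 0 := by
        intro g
        have h2 : L (xm F * zet col S (lin (fun i => c i - V i x) * p * g)) = 0 := hz g
        rw [mul_assoc, hswap] at h2
        · have e : lin (fun i => c i - V i x) = lin c - lin (fun i => V i x) := by
            rw [← lin_sub]
          rw [e, sub_mul, map_sub, hL.theta, sub_zero, map_mul (zet col S)] at h2
          rw [← h2]; congr 1; ring
        · intro i hi
          have := (mem_act.1 (hFx hi))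
          linarith
      have h3 := zet_enough hS hL hcol hF _ h1
      obtain ⟨k, hk⟩ : ∃ k, 2 * m + (k + 1) = S.card := ⟨S.card - (2 * m + 1), by omega⟩
      have h4 := hHL F m (k+1) (by omega) (zet col S p) (zet_hom hp) (by
        intro g
        rw [← h3 (lin c ^ k * g)]
        congr 1; ring) (zet col S g)
      rw [map_mul (zet col S), ← mul_assoc]; exact h4)
  refine ⟨g, by rintro rfl; simp at hg0, fun w hw hI => hg w hw ?_⟩
  apply LS_of_Inj hfc
  intro a
  rw [act_sdiff hcol hF (hpt a).1.1 (hpt a).2]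
  exact hI _ (hpt a).1

theorem main_alg (hS : Simple V c) (hC : Cone V)
    (hcol : ∀ τ, Fc V c τ → Set.InjOn col (τ : Set ι))
    (hcard : Fintype.card C = finrank ℝ E) (hJ : Fintype.card J = S.card) (q : ι → L' → ℝ)
    (hq : ∀ u : E, ∃ a : L' → ℝ, ∀ i, V i u = ∑ l, a l * q i l) :
    ∃ (A : J → L' → ℝ) (om : ι → ℝ),
      (∀ x, IsVert V c x → Inj ((act V c x).filter fun i => col i ∈ S)
        (fun j i => ∑ l, A j l * q i l)) ∧
      ∀ m, 2 * m + 1 ≤ S.card → ∀ b : MvPolynomial ι ℝ, b.IsHomogeneous m →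
        lin om * b ∈ NI (RS (Fc V c) col S) ⊔ TI (fun j i => ∑ l, A j l * q i l) →
        b ∈ NI (RS (Fc V c) col S) ⊔ TI (fun j i => ∑ l, A j l * q i l) := by
  classical
  choose g1 hg1 hg1' using fun Fm : {F // IsTop V c col S F} × {m : Fin S.card // 2 * m.1 + 1 ≤ S.card} =>
    link_top (J := J) hS hC hcol hcard hJ q hq Fm.1.2 Fm.2.2
  have hv : ∀ x : {x // IsVert V c x}, ∃ g : MvPolynomial ((J × L') ⊕ ι) ℝ, g ≠ 0 ∧
      ∀ w, eval w g ≠ 0 →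
        Inj ((act V c x.1).filter fun i => col i ∈ S) (thw (J := J) q w) := by
    rintro ⟨x, hx⟩
    have hF := vert_top S hcol hcard hx
    have hFx : ((act V c x).filter fun i => col i ∉ S) ⊆ act V c x := Finset.filter_subset _ _
    obtain ⟨u, hu0, hu⟩ := special (J := J) hS hx hFx (by rw [hJ, top_card hcol hcard hF])
    choose A hA using fun j => hq (u j)
    let w₀ : (J × L') ⊕ ι → ℝ := Sum.elim (fun jl => A jl.1 jl.2) (fun i => 0)
    have hth : thw q w₀ = fun j i => V i (u j) := by
      funext j i
      rw [hA j i]; rfl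
    obtain ⟨g, hg, hg'⟩ := Inj_generic ((act V c x).filter fun i => col i ∈ S) (thw q) (thw_PF q) w₀
      (by
        rw [hth, ← act_sdiff hcol hF hx.1 hFx]
        exact hu x hx hFx)
    exact ⟨g, by rintro rfl; simp at hg, hg'⟩
  choose g2 hg2 hg2' using hv
  have := (vert_finite hS).to_subtype
  have hfin : Finite {x // IsVert V c x} := this
  obtain ⟨w, hw⟩ := exists_common (Sum.elim g1 g2) (by rintro (a | a); exacts [hg1 a, hg2 a])
  have hP : ∀ x, IsVert V c x → Inj ((act V c x).filter fun i => col i ∈ S) (thw (J := J) q w) :=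
    fun x hx => hg2' ⟨x, hx⟩ w (hw (Sum.inr ⟨x, hx⟩))
  refine ⟨fun j l => w (Sum.inl (j, l)), fun i => w (Sum.inr i), hP, ?_⟩
  intro m hm b hb hmem
  obtain ⟨y, Y, hG⟩ := exists_gen hS
  by_cases hFe : Fc V c ∅
  swap
  · have : (1 : MvPolynomial ι ℝ) ∈ NI (RS (Fc V c) col S) := by
      have := xm_mem_NI (Γ := RS (Fc V c) col S) (τ := ∅) fun h => hFe h.1
      simpa [xm] using this
    rw [(Ideal.eq_top_iff_one _).2 this, top_sup_eq]; exact Submodule.mem_top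
  have hF0 : IsTop V c col Finset.univ ∅ := ⟨hFe, by simp⟩
  obtain ⟨κ, _, _, pt, R, h, hpt, H⟩ := exists_shell hS hC hG hcol hF0
  have eΓ : LkS V c col Finset.univ ∅ = Fc V c := by
    funext τ
    simp [LkS]
  rw [eΓ] at H
  simp only [Finset.sdiff_empty] at H
  refine glue H (fun a => hcol _ (Fc_sub (hpt a).1.1 subset_rfl)) ?_ ?_ ?_
  · intro a j
    have h1 : (act V c (pt a)).image col = Finset.univ := by
      rw [← Finset.card_eq_iff_eq_univ,
        Finset.card_image_of_injOn (hcol _ (Fc_sub (hpt a).1.1 subset_rfl)), (hpt a).1.2, hcard]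
    have := Finset.mem_univ j
    rw [← h1] at this
    exact Finset.mem_image.1 this
  · apply LS_of_Inj
    · intro a
      have hF := vert_top S hcol hcard (hpt a).1
      have hFx : ((act V c (pt a)).filter fun i => col i ∉ S) ⊆ act V c (pt a) :=
        Finset.filter_subset _ _
      rw [← act_sdiff hcol hF (hpt a).1.1 hFx, Finset.card_sdiff_of_subset hFx, (hpt a).1.2, hJ]
      have := top_card hcol hcard hF
      omega
    · exact fun a => hP _ (hpt a).1
  · intro F hF hFS
    refine hg1' (⟨F, hF, hFS⟩, ⟨⟨m, by omega⟩, hm⟩) w (hw (Sum.inl _)) hP b hb ?_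
    refine (sup_le_sup_right ?_ _ : NI (RS (Fc V c) col S) ⊔ TI _ ≤ _) hmem
    rw [NI]
    refine Ideal.span_le.2 ?_
    rintro p ⟨τ, hτ, rfl⟩
    apply xm_mem_NI
    intro hl
    exact hτ ⟨Fc.mono hl.1 Finset.subset_union_left, hl.2⟩

end MainAlg
end JKM

namespace JKM
open Module

section Dual
variable {n : ℕ}

noncomputable def fct (b : Fin n →₀ ℕ) : ℝ := ∏ i, ((b i).factorial : ℝ)

lemma fct_ne (b : Fin n →₀ ℕ) : fct b ≠ 0 :=
  Finset.prod_ne_zero_iff.2 fun i _ => by exact_mod_cast (Nat.factorial_ne_zero _)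

lemma fct_add (b : Fin n →₀ ℕ) (i : Fin n) :
    fct (b + Finsupp.single i 1) = fct b * (b i + 1) := by
  rw [fct, fct, ← Finset.mul_prod_erase _ _ (Finset.mem_univ i),
    ← Finset.mul_prod_erase (Finset.univ) (fun j => ((b j).factorial : ℝ)) (Finset.mem_univ i)]
  have : ∏ x ∈ Finset.univ.erase i, (((b + Finsupp.single i 1 : Fin n →₀ ℕ) x).factorial : ℝ)
      = ∏ x ∈ Finset.univ.erase i, ((b x).factorial : ℝ) := by
    refine Finset.prod_congr rfl fun j hj => ?_
    rw [Finsupp.add_apply, Finsupp.single_eq_of_ne (Finset.ne_of_mem_erase hj), add_zero]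
  rw [this, Finsupp.add_apply, Finsupp.single_eq_same, Nat.factorial_succ]
  push_cast
  ring

/-- the apolarity pairing -/
noncomputable def pr (γ : MvPolynomial (Fin n) ℝ) : MvPolynomial (Fin n) ℝ →ₗ[ℝ] ℝ :=
  (basisMonomials (Fin n) ℝ).constr ℝ fun b => fct b * coeff b γ

lemma pr_mon (γ : MvPolynomial (Fin n) ℝ) (b : Fin n →₀ ℕ) :
    pr γ (monomial b 1) = fct b * coeff b γ := by
  have := (basisMonomials (Fin n) ℝ).constr_basis ℝ (fun b => fct b * coeff b γ) b
  rwa [coe_basisMonomials] at this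

lemma ext_mon {f g : MvPolynomial (Fin n) ℝ →ₗ[ℝ] ℝ}
    (h : ∀ b, f (monomial b 1) = g (monomial b 1)) : f = g := by
  apply (basisMonomials (Fin n) ℝ).ext
  intro b
  rw [coe_basisMonomials]
  exact h b

lemma pr_inj {γ γ' : MvPolynomial (Fin n) ℝ} (h : ∀ b, pr γ (monomial b 1) = pr γ' (monomial b 1)) :
    γ = γ' := by
  ext b
  have := h b
  rw [pr_mon, pr_mon] at this
  exact mul_left_cancel₀ (fct_ne b) this

lemma coeff_pd (i : Fin n) (γ : MvPolynomial (Fin n) ℝ) (b : Fin n →₀ ℕ) :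
    coeff b (pd i γ) = coeff (b + Finsupp.single i 1) γ * (b i + 1) := by
  induction γ using MvPolynomial.induction_on' with
  | monomial a r =>
    have : pd i (monomial a r) = monomial (a - Finsupp.single i 1) (r * a i) := pderiv_monomial
    rw [this, coeff_monomial, coeff_monomial]
    by_cases hai : a i = 0
    · rw [hai, Nat.cast_zero, mul_zero, ite_self, if_neg, zero_mul]
      rintro rfl; simp at hai
    · have e : a - Finsupp.single i 1 = b ↔ a = b + Finsupp.single i 1 := by
        have hle : Finsupp.single i 1 ≤ a := by
          rw [Finsupp.single_le_iff]; omega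
        exact tsub_eq_iff_eq_add_of_le hle
      by_cases h : a = b + Finsupp.single i 1
      · rw [if_pos (e.2 h), if_pos h, h]; simp
      · rw [if_neg (fun hh => h (e.1 hh)), if_neg h, zero_mul]
  | add p q hp hq => rw [map_add, coeff_add, hp, hq, coeff_add, add_mul]

lemma pr_pd (i : Fin n) (γ q : MvPolynomial (Fin n) ℝ) : pr (pd i γ) q = pr γ (X i * q) := by
  have : pr (pd i γ) = pr γ ∘ₗ LinearMap.mulLeft ℝ (X i) := by
    apply ext_mon
    intro b
    have e : (X i : MvPolynomial (Fin n) ℝ) * monomial b 1 = monomial (b + Finsupp.single i 1) 1 := by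
      rw [X, monomial_mul, add_comm, one_mul]
    rw [LinearMap.comp_apply, LinearMap.mulLeft_apply, e, pr_mon, pr_mon, coeff_pd, fct_add]
    ring
  rw [this]; rfl

lemma pr_linDiff (c : Fin n → ℝ) (γ q : MvPolynomial (Fin n) ℝ) :
    pr (linDiff c γ) q = pr γ (lin c * q) := by
  have : pr (linDiff c γ) = ∑ i, c i • pr (pd i γ) := by
    apply ext_mon
    intro b
    rw [pr_mon, LinearMap.sum_apply, linDiff, LinearMap.sum_apply, coeff_sum, Finset.mul_sum]
    refine Finset.sum_congr rfl fun i _ => ?_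
    rw [LinearMap.smul_apply, LinearMap.smul_apply, pr_mon, coeff_smul, smul_eq_mul, smul_eq_mul]
    ring
  rw [this, LinearMap.sum_apply, L_lin]
  refine Finset.sum_congr rfl fun i _ => ?_
  rw [LinearMap.smul_apply, pr_pd, smul_eq_mul]

lemma pr_pow (i : Fin n) (k : ℕ) (γ q : MvPolynomial (Fin n) ℝ) :
    pr ((pd i ^ k) γ) q = pr γ (X i ^ k * q) := by
  induction k generalizing q with
  | zero => simp
  | succ k ih =>
    rw [pow_succ', Module.End.mul_apply, pr_pd, ih, pow_succ, mul_assoc]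

lemma pr_list (a : Fin n →₀ ℕ) (l : List (Fin n)) (γ q : MvPolynomial (Fin n) ℝ) :
    pr ((l.map fun i => pd i ^ a i).prod γ) q = pr γ ((l.map fun i => X i ^ a i).prod * q) := by
  induction l generalizing q with
  | nil => simp
  | cons i l ih =>
    rw [List.map_cons, List.prod_cons, Module.End.mul_apply, pr_pow, ih, List.map_cons,
      List.prod_cons]
    congr 1; ring

lemma pr_monDiff (a : Fin n →₀ ℕ) (γ q : MvPolynomial (Fin n) ℝ) :
    pr (monDiff a γ) q = pr γ (monomial a 1 * q) := by
  rw [monDiff, pr_list]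
  congr 2
  rw [monomial_eq, C_1, one_mul, Finsupp.prod_fintype _ _ (fun i => pow_zero _)]
  rw [← List.ofFn_eq_map, List.prod_ofFn]

lemma pr_zero (q : MvPolynomial (Fin n) ℝ) : pr 0 q = 0 := by
  have : pr (0 : MvPolynomial (Fin n) ℝ) = 0 := by
    apply ext_mon; intro b; rw [pr_mon]; simp
  rw [this]; rfl

noncomputable def Pk (k : ℕ) (ψ : MvPolynomial (Fin n) ℝ →ₗ[ℝ] ℝ) : MvPolynomial (Fin n) ℝ :=
  ∑ b ∈ Finset.finsuppAntidiag Finset.univ k, monomial b (ψ (monomial b 1) / fct b)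

lemma coeff_Pk (k : ℕ) (ψ : MvPolynomial (Fin n) ℝ →ₗ[ℝ] ℝ) (b : Fin n →₀ ℕ) :
    coeff b (Pk k ψ) = if b.degree = k then ψ (monomial b 1) / fct b else 0 := by
  rw [Pk, coeff_sum]
  simp only [coeff_monomial]
  rw [Finset.sum_ite_eq']
  congr 1
  simp [Finset.mem_finsuppAntidiag, Finsupp.degree_eq_sum]

lemma Pk_hom (k : ℕ) (ψ : MvPolynomial (Fin n) ℝ →ₗ[ℝ] ℝ) : (Pk k ψ).IsHomogeneous k := by
  refine Submodule.sum_mem (homogeneousSubmodule (Fin n) ℝ k) fun b hb => ?_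
  apply isHomogeneous_monomial
  simpa [Finset.mem_finsuppAntidiag, Finsupp.degree_eq_sum] using hb

lemma pr_Pk_mon (k : ℕ) (ψ : MvPolynomial (Fin n) ℝ →ₗ[ℝ] ℝ) (b : Fin n →₀ ℕ) :
    pr (Pk k ψ) (monomial b 1) = if b.degree = k then ψ (monomial b 1) else 0 := by
  rw [pr_mon, coeff_Pk]
  split_ifs
  · rw [mul_div_cancel₀ _ (fct_ne b)]
  · rw [mul_zero]

lemma pr_Pk_lin (k : ℕ) (ψ : MvPolynomial (Fin n) ℝ →ₗ[ℝ] ℝ) (e : Fin n → ℝ) (b : Fin n →₀ ℕ) :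
    pr (Pk k ψ) (lin e * monomial b 1) =
      if b.degree + 1 = k then ψ (lin e * monomial b 1) else 0 := by
  rw [L_lin, L_lin]
  have h : ∀ i, (X i : MvPolynomial (Fin n) ℝ) * monomial b 1 = monomial (b + Finsupp.single i 1) 1 := by
    intro i; rw [X, monomial_mul, add_comm, one_mul]
  have hd : ∀ i, (b + Finsupp.single i 1).degree = b.degree + 1 := by
    intro i; rw [map_add, Finsupp.degree_single]
  simp only [h, pr_Pk_mon, hd]
  split_ifs
  · rfl
  · simp

lemma kill_span {φ : MvPolynomial (Fin n) ℝ →ₗ[ℝ] ℝ} {G : Set (MvPolynomial (Fin n) ℝ)}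
    (h : ∀ g ∈ G, ∀ q, φ (g * q) = 0) {p : MvPolynomial (Fin n) ℝ} (hp : p ∈ Ideal.span G) :
    φ p = 0 := by
  have key : ∀ q, φ (p * q) = 0 := by
    induction hp using Submodule.span_induction with
    | mem x hx => exact h x hx
    | zero => intro q; rw [zero_mul, map_zero]
    | add x y _ _ hx hy => intro q; rw [add_mul, map_add, hx, hy, add_zero]
    | smul a x _ hx =>
      intro q
      have : a • x * q = x * (a * q) := by rw [smul_eq_mul]; ring
      rw [this]; exact hx _
  simpa using key 1

theorem dual_surj {s : ℕ} (Vt : Fin n → Fin s → ℝ) (Δ : Set (Finset (Fin n))) (om : Fin n → ℝ)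
    (m : ℕ)
    (hI : ∀ b : MvPolynomial (Fin n) ℝ, b.IsHomogeneous m →
      lin om * b ∈ NI (fun τ => τ ∈ Δ) ⊔ TI (fun j i => Vt i j) →
      b ∈ NI (fun τ => τ ∈ Δ) ⊔ TI (fun j i => Vt i j))
    (γ : MvPolynomial (Fin n) ℝ) (hγ : γ ∈ stressK Vt Δ m) :
    ∃ γ' ∈ stressK Vt Δ (m + 1), linDiff om γ' = γ := by
  obtain ⟨⟨ht, hc⟩, hh⟩ := hγ
  have ht' : ∀ a : Fin n →₀ ℕ, a.support ∉ Δ → monDiff a γ = 0 := by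
    intro a ha
    rw [SetLike.mem_coe, tStress, Submodule.mem_iInf] at ht
    have := ht a
    rw [Submodule.mem_iInf] at this
    exact this ha
  have hc' : ∀ j, coordDiff Vt j γ = 0 := by
    intro j
    rw [SetLike.mem_coe, Submodule.mem_iInf] at hc
    exact hc j
  have hh' : γ.IsHomogeneous m := hh
  set I := NI (fun τ => τ ∈ Δ) ⊔ TI (fun j i => Vt i j) with hIdef
  have hkill : ∀ p ∈ I, pr γ p = 0 := by
    intro p hp
    obtain ⟨r, hr, t, ht, rfl⟩ := Submodule.mem_sup.1 hp
    rw [map_add, kill_span ?_ hr, kill_span ?_ ht, add_zero]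
    · rintro g ⟨j, rfl⟩ q
      rw [← pr_linDiff]
      have := hc' j
      rw [coordDiff] at this
      rw [this, pr_zero]
    · rintro g ⟨τ, hτ, rfl⟩ q
      rw [xm_eq, ← pr_monDiff, ht', pr_zero]
      convert hτ
      ext i
      rw [Finsupp.mem_support_iff, ind_apply]
      simp
  let T : homogeneousSubmodule (Fin n) ℝ m →ₗ[ℝ] (MvPolynomial (Fin n) ℝ ⧸ I.restrictScalars ℝ) :=
    (I.restrictScalars ℝ).mkQ ∘ₗ LinearMap.mulLeft ℝ (lin om) ∘ₗ Submodule.subtype _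
  have hmem : pr γ ∘ₗ Submodule.subtype (homogeneousSubmodule (Fin n) ℝ m) ∈ LinearMap.range T.dualMap := by
    rw [LinearMap.range_dualMap_eq_dualAnnihilator_ker, Submodule.mem_dualAnnihilator]
    rintro ⟨b, hb⟩ hbT
    apply hkill
    apply hI b hb
    have : (I.restrictScalars ℝ).mkQ (lin om * b) = 0 := hbT
    rwa [Submodule.mkQ_apply, Submodule.Quotient.mk_eq_zero] at this
  obtain ⟨ψ', hψ'⟩ := hmem
  set ψ : MvPolynomial (Fin n) ℝ →ₗ[ℝ] ℝ := ψ' ∘ₗ (I.restrictScalars ℝ).mkQ with hψ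
  have hψI : ∀ p ∈ I, ψ p = 0 := by
    intro p hp
    rw [hψ, LinearMap.comp_apply, Submodule.mkQ_apply,
      (Submodule.Quotient.mk_eq_zero (I.restrictScalars ℝ)).2 hp, map_zero]
  have hψo : ∀ q : MvPolynomial (Fin n) ℝ, q.IsHomogeneous m → ψ (lin om * q) = pr γ q := by
    intro q hq
    exact congrArg (fun f => f ⟨q, hq⟩) hψ'
  refine ⟨Pk (m+1) ψ, ⟨⟨?_, ?_⟩, Pk_hom _ _⟩, ?_⟩
  · rw [SetLike.mem_coe, tStress, Submodule.mem_iInf]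
    intro a
    rw [Submodule.mem_iInf]
    intro ha
    rw [LinearMap.mem_ker]
    apply pr_inj
    intro b
    rw [pr_monDiff, pr_zero, monomial_mul, one_mul, pr_Pk_mon]
    split_ifs
    · apply hψI
      have : monomial (a + b) (1 : ℝ) = monomial b 1 * monomial a 1 := by
        rw [monomial_mul, one_mul, add_comm]
      rw [this]
      exact Ideal.mul_mem_left _ _ (Submodule.mem_sup_left (monomial_mem_NI ha))
    · rfl
  · rw [SetLike.mem_coe, Submodule.mem_iInf]
    intro j
    rw [LinearMap.mem_ker, coordDiff]
    apply pr_inj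
    intro b
    rw [pr_linDiff, pr_zero, pr_Pk_lin]
    split_ifs
    · apply hψI
      exact Ideal.mul_mem_right _ _ (Submodule.mem_sup_right (lin_mem_TI (fun j i => Vt i j) j))
    · rfl
  · apply pr_inj
    intro b
    rw [pr_linDiff, pr_Pk_lin]
    split_ifs with hb
    · exact hψo _ (isHomogeneous_monomial _ (by omega))
    · rw [pr_mon, hh'.coeff_eq_zero (by omega), mul_zero]

end Dual
end JKM

namespace JKM
open Module

section Poly
variable {n d : ℕ}

noncomputable def ctr (p : Fin n → Fin d → ℝ) : Fin d → ℝ := (n : ℝ)⁻¹ • ∑ i, p i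

noncomputable def dt (v : Fin d → ℝ) : Dual ℝ (Fin d → ℝ) := ∑ k, v k • LinearMap.proj k

lemma dt_apply (v x : Fin d → ℝ) : dt v x = ∑ k, v k * x k := by
  simp [dt, LinearMap.sum_apply]

noncomputable def Vpol (p : Fin n → Fin d → ℝ) (i : Fin n) : Dual ℝ (Fin d → ℝ) := dt (p i - ctr p)

lemma dt_sub (v w x : Fin d → ℝ) : dt (v - w) x = dt v x - dt w x := by
  simp only [dt_apply, Pi.sub_apply, sub_mul, Finset.sum_sub_distrib]

lemma dt_comm (v w : Fin d → ℝ) : dt v w = dt w v := by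
  simp only [dt_apply]; exact Finset.sum_congr rfl fun _ _ => mul_comm _ _

lemma sum_sub_ctr (p : Fin n → Fin d → ℝ) (hn : 0 < n) : ∑ i, (p i - ctr p) = 0 := by
  rw [Finset.sum_sub_distrib, Finset.sum_const, Finset.card_univ, Fintype.card_fin, ctr,
    ← Nat.cast_smul_eq_nsmul ℝ, smul_smul, mul_inv_cancel₀ (by positivity), one_smul, sub_self]

lemma Vp_sum (p : Fin n → Fin d → ℝ) (hn : 0 < n) (x : Fin d → ℝ) : ∑ i, Vpol p i x = 0 := by
  have : ∀ i, Vpol p i x = dt x (p i - ctr p) := fun i => dt_comm _ _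
  simp only [this]
  rw [← map_sum, sum_sub_ctr p hn, map_zero]

lemma exists_dt (f : (Fin d → ℝ) →ₗ[ℝ] ℝ) : ∃ y, f = dt y := by
  refine ⟨fun k => f (Pi.single k 1), ?_⟩
  apply (Pi.basisFun ℝ (Fin d)).ext
  intro k
  rw [Pi.basisFun_apply, dt_apply, Finset.sum_eq_single k]
  · simp
  · intro b _ hb; simp [hb]
  · simp

variable {p : Fin n → Fin d → ℝ} {Δ : Set (Finset (Fin n))}

lemma n_pos (hP : IsSimplicialPolytopeBoundary p Δ) : 0 < n := by
  rcases Nat.eq_zero_or_pos n with rfl | h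
  · have := hP.1
    rw [Set.range_eq_empty, AffineSubspace.span_empty] at this
    exact absurd this (AffineSubspace.bot_ne_top _ _ _)
  · exact h

lemma act_mem (hP : IsSimplicialPolytopeBoundary p Δ) {x : Fin d → ℝ}
    (hx : InP (Vpol p) (fun _ => 1) x) : act (Vpol p) (fun _ => 1) x ∈ Δ := by
  have hn := n_pos hP
  have hV : ∀ i, Vpol p i x = dt x (p i) - dt x (ctr p) := fun i => by
    rw [Vpol, dt_sub, dt_comm x, dt_comm x]
  refine (hP.2.2.2 _).2 ⟨dt x, 1 + dt x (ctr p), ?_, ?_, ?_⟩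
  · by_contra hcon
    push Not at hcon
    have : ∀ i, Vpol p i x = 1 := fun i => le_antisymm (hx i) (by rw [hV]; linarith [hcon i])
    have h0 := Vp_sum p hn x
    simp only [this] at h0
    simp at h0
    omega
  · intro i; have := hx i; rw [hV] at this; linarith
  · intro i
    rw [mem_act, hV]
    constructor <;> intro h <;> linarith

lemma Fc_iff (hΔ : IsComplex Δ) (hP : IsSimplicialPolytopeBoundary p Δ) (τ : Finset (Fin n)) :
    Fc (Vpol p) (fun _ => 1) τ ↔ τ ∈ Δ := by
  constructor
  · rintro ⟨x, hx, hτ⟩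
    exact hΔ _ (act_mem hP hx) _ hτ
  · intro hτ
    have hn := n_pos hP
    obtain ⟨f, c, ⟨i0, hi0⟩, hle, heq⟩ := (hP.2.2.2 τ).1 hτ
    have hc : f (ctr p) < c := by
      have h1 : ∑ i, f (p i) < ∑ _i : Fin n, c :=
        Finset.sum_lt_sum (fun i _ => hle i) ⟨i0, Finset.mem_univ _, hi0⟩
      rw [Finset.sum_const, Finset.card_univ, Fintype.card_fin, nsmul_eq_mul] at h1
      rw [ctr, map_smul, map_sum, smul_eq_mul]
      have : (0 : ℝ) < n := by exact_mod_cast hn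
      rw [inv_mul_lt_iff₀ this]; exact h1
    obtain ⟨y, rfl⟩ := exists_dt f
    have hpos : 0 < c - dt y (ctr p) := by linarith
    have hV : ∀ i, Vpol p i ((c - dt y (ctr p))⁻¹ • y) =
        (dt y (p i) - dt y (ctr p)) / (c - dt y (ctr p)) := fun i => by
      rw [map_smul, Vpol, dt_sub, dt_comm y, dt_comm y, smul_eq_mul, div_eq_inv_mul]
    refine ⟨(c - dt y (ctr p))⁻¹ • y, ?_, ?_⟩
    · intro i
      rw [hV, div_le_one hpos]
      linarith [hle i]
    · intro i hi
      rw [mem_act, hV, (heq i).2 hi, div_self hpos.ne']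

lemma Vp_simple (hP : IsSimplicialPolytopeBoundary p Δ) : Simple (Vpol p) (fun _ => 1) := by
  intro x hx
  have hA := hP.2.2.1 _ (act_mem hP hx)
  rw [linearIndepOn_finset_iff]
  intro g hg i hi
  have h1 : ∑ i ∈ act (Vpol p) (fun _ => 1) x, g i = 0 := by
    have := congrArg (fun f => f x) hg
    simp only [LinearMap.sum_apply, LinearMap.smul_apply, LinearMap.zero_apply, smul_eq_mul] at this
    rw [← this]
    refine Finset.sum_congr rfl fun i hi => ?_
    rw [mem_act.1 hi, mul_one]
  have h2 : ∑ i ∈ act (Vpol p) (fun _ => 1) x, g i • p i = 0 := by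
    have h3 : ∑ i ∈ act (Vpol p) (fun _ => 1) x, g i • (p i - ctr p) = 0 := by
      funext k
      have := congrArg (fun f => f (Pi.single k 1)) hg
      simp only [LinearMap.sum_apply, LinearMap.smul_apply, LinearMap.zero_apply, smul_eq_mul, Vpol,
        dt_apply, Pi.single_apply, mul_ite, mul_one, mul_zero, Finset.sum_ite_eq', Finset.mem_univ,
        if_true] at this
      rw [Finset.sum_apply]
      exact this
    simp only [smul_sub, Finset.sum_sub_distrib] at h3
    rwa [← Finset.sum_smul, h1, zero_smul, sub_zero] at h3
  rw [affineIndependent_iff] at hA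
  refine hA Finset.univ (fun i => g i.1) ?_ ?_ ⟨i, hi⟩ (Finset.mem_univ _)
  · rw [← h1]; exact Finset.sum_coe_sort _ g
  · rw [← h2]; exact Finset.sum_coe_sort _ fun i => g i • p i

lemma Vp_cone (hP : IsSimplicialPolytopeBoundary p Δ) : Cone (Vpol p) := by
  intro x hx
  have hn := n_pos hP
  have h0 : ∀ i, Vpol p i x = 0 := by
    intro i
    have := (Finset.sum_eq_zero_iff_of_nonpos (fun i _ => hx i)).1 (Vp_sum p hn x)
    exact this i (Finset.mem_univ i)
  have hv : vectorSpan ℝ (Set.range p) = ⊤ := by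
    rw [← direction_affineSpan, hP.1, AffineSubspace.direction_top]
  have hle : vectorSpan ℝ (Set.range p) ≤ LinearMap.ker (dt x) := by
    rw [vectorSpan_def, Submodule.span_le]
    rintro v ⟨a, ⟨i, rfl⟩, b, ⟨j, rfl⟩, rfl⟩
    have hi := h0 i
    have hj := h0 j
    rw [Vpol, dt_sub, dt_comm _ x, dt_comm _ x] at hi hj
    simp only [SetLike.mem_coe, LinearMap.mem_ker, vsub_eq_sub, map_sub]
    linarith
  rw [hv, top_le_iff, LinearMap.ker_eq_top] at hle
  funext k
  have := congrArg (fun f => f (Pi.single k 1)) hle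
  simpa [dt_apply, Pi.single_apply] using this

theorem main (hΔ : IsComplex Δ) (hP : IsSimplicialPolytopeBoundary p Δ)
    (col : Fin n → Fin d) (hcol : ∀ σ ∈ Δ, Set.InjOn col ↑σ) (S : Finset (Fin d)) :
    ∃ (Vt : Fin n → Fin S.card → ℝ) (π : (Fin (d + 1) → ℝ) →ₗ[ℝ] (Fin S.card → ℝ))
      (c : Fin n → ℝ),
      (∀ i, Vt i = π (homV p i)) ∧
      IsProper Vt (colorRestrict Δ col S) ∧
      ∀ k : ℕ, 1 ≤ k → 2 * k ≤ S.card + 1 →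
        ∀ γ ∈ stressK Vt (colorRestrict Δ col S) (k - 1),
          ∃ γ' ∈ stressK Vt (colorRestrict Δ col S) k, linDiff c γ' = γ := by
  have hS := Vp_simple hP
  have hC := Vp_cone hP
  obtain ⟨A, om, hPr, hI⟩ := main_alg (J := Fin S.card) (col := col) (S := S) hS hC
    (fun τ hτ => hcol τ ((Fc_iff hΔ hP τ).1 hτ)) (by simp) (by simp) (homV p) (by
      intro u
      refine ⟨Fin.snoc u (- dt (ctr p) u), fun i => ?_⟩
      rw [Fin.sum_univ_castSucc]
      simp only [homV, Fin.snoc_castSucc, Fin.snoc_last, mul_one]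
      rw [Vpol, dt_sub, dt_comm (p i), dt_apply u]
      ring)
  let π : (Fin (d + 1) → ℝ) →ₗ[ℝ] (Fin S.card → ℝ) := LinearMap.pi fun j => dt (A j)
  have hπ : ∀ i j, π (homV p i) j = ∑ l, A j l * homV p i l := fun i j => dt_apply _ _
  have hθ : (fun j i => π (homV p i) j) = fun j i => ∑ l, A j l * homV p i l := by
    funext j i; exact hπ i j
  refine ⟨fun i => π (homV p i), π, om, fun i => rfl, ?_, ?_⟩
  · intro σ hσ _
    obtain ⟨x0, hx0, hσx⟩ := (Fc_iff hΔ hP σ).2 hσ.1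
    obtain ⟨x, hx, hxx, -⟩ := vertex_lemma hS hC 0 x0 hx0
    have hi := hPr x hx
    rw [← hθ] at hi
    have hsub : σ ⊆ (act (Vpol p) (fun _ => 1) x).filter fun i => col i ∈ S := fun i hi =>
      Finset.mem_filter.2 ⟨hxx (hσx hi), hσ.2 i hi⟩
    rw [Fintype.linearIndependent_iff]
    intro g hg i
    let g' : Fin n → ℝ := fun i => if hi : i ∈ σ then g ⟨i, hi⟩ else 0
    have e : ∀ i : {x // x ∈ σ}, g' i.1 = g i := fun i => by simp [g']
    rw [← e]
    refine hi g' ?_ i.1 (hsub i.2)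
    intro j
    rw [← Finset.sum_subset hsub]
    · rw [← Finset.sum_coe_sort]
      simp only [e]
      have := congrFun hg j
      rw [Finset.sum_apply] at this
      exact this
    · intro i _ hi
      simp [g', hi]
  · intro k hk1 hk2 γ hγ
    obtain ⟨m, rfl⟩ : ∃ m, k = m + 1 := ⟨k - 1, by omega⟩
    refine dual_surj _ _ om m ?_ γ hγ
    have eΓ : RS (Fc (Vpol p) (fun _ => 1)) col S = fun τ => τ ∈ colorRestrict Δ col S := by
      funext τ
      simp only [RS, Fc_iff hΔ hP]
      rfl
    rw [← eΓ, hθ]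
    exact hI m (by omega)

end Poly
end JKM

theorem stmt16 {n d : ℕ} (p : Fin n → Fin d → ℝ) (Δ : Set (Finset (Fin n)))
    (hΔ : IsComplex Δ) (hP : IsSimplicialPolytopeBoundary p Δ)
    (col : Fin n → Fin d) (hcol : ∀ σ ∈ Δ, Set.InjOn col ↑σ) (S : Finset (Fin d)) :
    ∃ (Vt : Fin n → Fin S.card → ℝ) (π : (Fin (d + 1) → ℝ) →ₗ[ℝ] (Fin S.card → ℝ))
      (c : Fin n → ℝ),
      (∀ i, Vt i = π (homV p i)) ∧
      IsProper Vt (colorRestrict Δ col S) ∧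
      ∀ k : ℕ, 1 ≤ k → 2 * k ≤ S.card + 1 →
        ∀ γ ∈ stressK Vt (colorRestrict Δ col S) (k - 1),
          ∃ γ' ∈ stressK Vt (colorRestrict Δ col S) k, linDiff c γ' = γ := by
  exact JKM.main hΔ hP col hcol S
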